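/- arXiv:1102.1681 — 3 statements merged into one kernel-verified Lean document; each statement's English description precedes it below -/
import Mathlib

section
/- Let τ ≥ ω be a cardinal and let Z and F be fibered Z_τ-sets in I^τ × I^τ with respect to the projection π₁ : I^τ × I^τ → I^τ onto the first factor, where I = [0,1]. Let h : Z → F be a homeomorphism such that π₁ ∘ h = π₁|Z. Then there exists a homeomorphism H : I^τ × I^τ → I^τ × I^τ such that H|Z = h and π₁ ∘ H = π₁. -/
open Set Topology

universe u

/-- A subset `U` of a topological space is functionally open (a cozero set). -/
def FunctionallyOpen {X : Type*} [TopologicalSpace X] (U : Set X) : Prop :=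
  ∃ φ : X → ℝ, Continuous φ ∧ U = φ ⁻¹' {(0 : ℝ)}ᶜ

/-- A countable cover by functionally open sets. -/
def IsCFOCover {X : Type*} [TopologicalSpace X] (𝒰 : Set (Set X)) : Prop :=
  𝒰.Countable ∧ (∀ U ∈ 𝒰, FunctionallyOpen U) ∧ ⋃₀ 𝒰 = Set.univ

/-- Two maps are `𝒰`-close if every point's images lie in a common member of `𝒰`. -/
def UClose {X Y : Type*} (𝒰 : Set (Set Y)) (f g : X → Y) : Prop :=
  ∀ x, ∃ U ∈ 𝒰, f x ∈ U ∧ g x ∈ U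

/-- Two sets are functionally separated if some continuous `[0,1]`-valued function
is `0` on the first and `1` on the second. -/
def FunctionallySeparated {X : Type*} [TopologicalSpace X] (P Q : Set X) : Prop :=
  ∃ φ : X → ℝ, Continuous φ ∧ (∀ x, φ x ∈ Set.Icc (0 : ℝ) 1) ∧
    (∀ p ∈ P, φ p = 0) ∧ (∀ q ∈ Q, φ q = 1)

/-- `Z` is a fibered `Z_τ`-set in `X` with respect to `p`. -/
def FiberedZTauSet {X Y : Type u} [TopologicalSpace X] [TopologicalSpace Y]
    (τ : Cardinal.{u}) (p : X → Y) (Z : Set X) : Prop :=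
  IsClosed Z ∧ ∀ g : X → X, Continuous g → (∀ x, p (g x) = p x) →
    ∀ 𝒞 : Set (Set (Set X)), Cardinal.mk ↥𝒞 < τ → (∀ 𝒰 ∈ 𝒞, IsCFOCover 𝒰) →
      ∃ f : X → X, Continuous f ∧ (∀ x, p (f x) = p x) ∧ (∀ 𝒰 ∈ 𝒞, UClose 𝒰 f g) ∧
        FunctionallySeparated (Set.range f) Z

/-- The symmetric interval `[-1, 1]`. -/
abbrev SymmInterval : Type := Set.Icc (-1 : ℝ) 1

namespace SymmInterval

lemma abs_le (x : SymmInterval) : |(x : ℝ)| ≤ 1 := _root_.abs_le.2 x.2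

/-- The retraction of the line onto `[-1, 1]`. -/
noncomputable def proj (x : ℝ) : SymmInterval := Set.projIcc (-1) 1 (by norm_num) x

lemma continuous_proj : Continuous proj := continuous_projIcc (h := by norm_num)

lemma coe_proj {x : ℝ} (hx : |x| ≤ 1) : (proj x : ℝ) = x := by
  rw [proj, Set.projIcc_of_mem _ (_root_.abs_le.1 hx)]

@[fun_prop]
lemma _root_.Continuous.symmIntervalProj {X : Type*} [TopologicalSpace X] {f : X → ℝ}
    (hf : Continuous f) : Continuous fun x => proj (f x) := continuous_proj.comp hf

instance : Zero SymmInterval := ⟨⟨0, by norm_num⟩⟩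

instance : One SymmInterval := ⟨⟨1, by norm_num⟩⟩

@[simp] lemma coe_zero : ((0 : SymmInterval) : ℝ) = 0 := rfl

@[simp] lemma coe_one : ((1 : SymmInterval) : ℝ) = 1 := rfl

/-- The Möbius transformation of `[-1, 1]` carrying `0` to `c`. -/
noncomputable def mobius (c : ℝ) (y : SymmInterval) : SymmInterval := proj ((y + c) / (1 + c * y))

lemma one_add_mul_pos {c : ℝ} (hc : |c| < 1) (y : SymmInterval) : 0 < 1 + c * (y : ℝ) := by
  have h : |c * (y : ℝ)| < 1 := by
    rw [abs_mul]; nlinarith [y.abs_le, abs_nonneg c, abs_nonneg (y : ℝ)]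
  linarith [(abs_lt.1 h).1]

lemma coe_mobius {c : ℝ} (hc : |c| < 1) (y : SymmInterval) :
    (mobius c y : ℝ) = (y + c) / (1 + c * y) := by
  have hp := one_add_mul_pos hc y
  have h1 := y.2.1
  have h2 := y.2.2
  have h3 := abs_lt.1 hc
  refine coe_proj ?_
  rw [_root_.abs_le, le_div_iff₀ hp, div_le_iff₀ hp]
  constructor <;> nlinarith

lemma mobius_neg_mobius {c : ℝ} (hc : |c| < 1) (y : SymmInterval) :
    mobius (-c) (mobius c y) = y := by
  have hc' : |(-c)| < 1 := by rwa [abs_neg]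
  have hp := one_add_mul_pos hc y
  have hp' := one_add_mul_pos hc' (mobius c y)
  apply Subtype.ext
  rw [coe_mobius hc', div_eq_iff hp'.ne', coe_mobius hc]
  have h := div_mul_cancel₀ ((y : ℝ) + c) hp.ne'
  linear_combination h

lemma bijective_mobius {c : ℝ} (hc : |c| < 1) : Function.Bijective (mobius c) := by
  have hc' : |(-c)| < 1 := by rwa [abs_neg]
  refine Function.bijective_iff_has_inverse.2 ⟨mobius (-c), mobius_neg_mobius hc, fun y => ?_⟩
  simpa using mobius_neg_mobius hc' y

lemma continuous_mobius {X : Type*} [TopologicalSpace X] {c : X → ℝ} {y : X → SymmInterval}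
    (hc : Continuous c) (hy : Continuous y) (h : ∀ x, |c x| < 1) :
    Continuous fun x => mobius (c x) (y x) := by
  unfold mobius
  refine Continuous.symmIntervalProj ?_
  exact Continuous.div (by fun_prop) (by fun_prop) fun x => (one_add_mul_pos (h x) _).ne'

lemma mobius_zero {c : ℝ} (hc : |c| < 1) : (mobius c 0 : ℝ) = c := by
  simp [coe_mobius hc]

/-- The odd homeomorphism of `[-1, 1]` which is multiplication by `k⁻¹` in the coordinate
`y / (1 - |y|)`. -/
noncomputable def dilate (k : ℝ) (y : SymmInterval) : SymmInterval :=
  proj (y / (k + (1 - k) * |(y : ℝ)|))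

lemma dilate_denom_pos {k : ℝ} (hk : 0 < k) (y : SymmInterval) :
    0 < k + (1 - k) * |(y : ℝ)| := by
  rcases (abs_nonneg (y : ℝ)).eq_or_lt with h | h
  · rw [← h]; linarith
  · nlinarith [y.abs_le]

lemma coe_dilate {k : ℝ} (hk : 0 < k) (y : SymmInterval) :
    (dilate k y : ℝ) = y / (k + (1 - k) * |(y : ℝ)|) := by
  have hp := dilate_denom_pos hk y
  refine coe_proj ?_
  rw [abs_div, abs_of_pos hp, div_le_one hp]
  nlinarith [y.abs_le]

lemma dilate_inv_dilate {k : ℝ} (hk : 0 < k) (y : SymmInterval) :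
    dilate k⁻¹ (dilate k y) = y := by
  have hp := dilate_denom_pos hk y
  have hp' := dilate_denom_pos (inv_pos.2 hk) (dilate k y)
  apply Subtype.ext
  rw [coe_dilate (inv_pos.2 hk), div_eq_iff hp'.ne', coe_dilate hk, abs_div, abs_of_pos hp]
  field_simp
  ring

lemma bijective_dilate {k : ℝ} (hk : 0 < k) : Function.Bijective (dilate k) := by
  refine Function.bijective_iff_has_inverse.2 ⟨dilate k⁻¹, dilate_inv_dilate hk, fun y => ?_⟩
  simpa using dilate_inv_dilate (inv_pos.2 hk) y

lemma continuous_dilate {k : ℝ} (hk : 0 < k) : Continuous (dilate k) := by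
  unfold dilate
  refine Continuous.symmIntervalProj ?_
  exact Continuous.div (by fun_prop) (by fun_prop) fun x => (dilate_denom_pos hk x).ne'

lemma le_abs_dilate {r η : ℝ} (hr : 0 < r) (hη : 0 < η) (hη1 : η ≤ 1) {y : SymmInterval}
    (hy : r ≤ |(y : ℝ)|) : 1 - η ≤ |(dilate (η * r) y : ℝ)| := by
  have hk : 0 < η * r := mul_pos hη hr
  have hp := dilate_denom_pos hk y
  rw [coe_dilate hk, abs_div, abs_of_pos hp, le_div_iff₀ hp]
  have h1 : η * r ≤ η * |(y : ℝ)| := by gcongr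
  have h2 := y.abs_le
  nlinarith [mul_nonneg (sub_nonneg.2 hη1) (mul_nonneg hk.le (abs_nonneg (y : ℝ))),
    mul_nonneg hη.le hk.le]

lemma abs_dilate_le {r δ : ℝ} (hr : r < 1) (hδ : 0 < δ) {y : SymmInterval}
    (hy : |(y : ℝ)| ≤ r) : |(dilate (1 / (δ * (1 - r))) y : ℝ)| ≤ δ := by
  have hk : 0 < 1 / (δ * (1 - r)) := by have := sub_pos.2 hr; positivity
  have hp := dilate_denom_pos hk y
  rw [coe_dilate hk, abs_div, abs_of_pos hp, div_le_iff₀ hp]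
  have h0 := abs_nonneg (y : ℝ)
  have h1 := sub_pos.2 hr
  have h2 : δ * (1 / (δ * (1 - r)) * (1 - |(y : ℝ)|)) = (1 - |(y : ℝ)|) / (1 - r) := by
    field_simp
  have h3 : 1 ≤ (1 - |(y : ℝ)|) / (1 - r) := by rw [le_div_iff₀ h1]; linarith
  nlinarith [y.abs_le]

/-- A homeomorphism of `[-1, 1]` expanding a small neighbourhood of `c`. -/
noncomputable def expandAt (δ η : ℝ) (c y : SymmInterval) : SymmInterval :=
  dilate (η * (δ / 4)) (mobius (-((1 - δ / 4) * c)) y)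

lemma abs_expandAt_center_lt {δ : ℝ} (hδ : 0 < δ) (hδ1 : δ ≤ 1) (c : SymmInterval) :
    |(-((1 - δ / 4) * (c : ℝ)))| < 1 := by
  rw [abs_neg, abs_mul, abs_of_pos (by linarith)]
  nlinarith [c.abs_le, abs_nonneg (c : ℝ)]

lemma bijective_expandAt {δ η : ℝ} (hδ : 0 < δ) (hδ1 : δ ≤ 1) (hη : 0 < η) (c : SymmInterval) :
    Function.Bijective (expandAt δ η c) :=
  (bijective_dilate (by positivity)).comp (bijective_mobius (abs_expandAt_center_lt hδ hδ1 c))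

lemma continuous_expandAt {X : Type*} [TopologicalSpace X] {δ η : ℝ} (hδ : 0 < δ) (hδ1 : δ ≤ 1)
    (hη : 0 < η) {c y : X → SymmInterval} (hc : Continuous c) (hy : Continuous y) :
    Continuous fun x => expandAt δ η (c x) (y x) :=
  (continuous_dilate (by positivity)).comp
    (continuous_mobius (by fun_prop) hy fun x => abs_expandAt_center_lt hδ hδ1 (c x))

lemma le_abs_expandAt {δ η : ℝ} (hδ : 0 < δ) (hδ1 : δ ≤ 1) (hη : 0 < η) (hη1 : η ≤ 1)
    {c y : SymmInterval} (h : δ ≤ |(y : ℝ) - c|) : 1 - η ≤ |(expandAt δ η c y : ℝ)| := by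
  refine le_abs_dilate (by positivity) hη hη1 ?_
  have hc := abs_expandAt_center_lt hδ hδ1 c
  have hp := one_add_mul_pos hc y
  rw [coe_mobius hc, abs_div, abs_of_pos hp, le_div_iff₀ hp]
  have h1 : 1 + -((1 - δ / 4) * (c : ℝ)) * y ≤ 2 := by
    have : |(-((1 - δ / 4) * (c : ℝ)) * y)| ≤ 1 := by
      rw [abs_mul]; nlinarith [y.abs_le, abs_nonneg (y : ℝ), abs_nonneg (-((1 - δ / 4) * (c : ℝ)))]
    linarith [(_root_.abs_le.1 this).2]
  have h2 : |(y : ℝ) - c| ≤ |(y : ℝ) + -((1 - δ / 4) * c)| + δ / 4 := by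
    have h3 : |(δ / 4) * (c : ℝ)| ≤ δ / 4 := by
      rw [abs_mul, abs_of_pos (by positivity)]; nlinarith [c.abs_le]
    have h4 := abs_add_le ((y : ℝ) + -((1 - δ / 4) * c)) (-((δ / 4) * c))
    rw [abs_neg] at h4
    have h5 : (y : ℝ) + -((1 - δ / 4) * c) + -((δ / 4) * c) = y - c := by ring
    rw [h5] at h4
    linarith
  nlinarith

/-- The homeomorphism of `[-1, 1]` which translates by `ε t` away from the end points. -/
noncomputable def shift (ε : ℝ) (t x : SymmInterval) : SymmInterval :=
  proj (x + t * min ε ((1 - |(x : ℝ)|) / 2))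

lemma abs_shift_sub_le {ε : ℝ} (hε : 0 < ε) (t x : SymmInterval) :
    |(t : ℝ) * min ε ((1 - |(x : ℝ)|) / 2)| ≤ min ε ((1 - |(x : ℝ)|) / 2) := by
  have h : 0 ≤ min ε ((1 - |(x : ℝ)|) / 2) := le_min hε.le (by linarith [x.abs_le])
  rw [abs_mul, abs_of_nonneg h]
  nlinarith [t.abs_le]

lemma coe_shift {ε : ℝ} (hε : 0 < ε) (t x : SymmInterval) :
    (shift ε t x : ℝ) = x + t * min ε ((1 - |(x : ℝ)|) / 2) := by
  refine coe_proj ((abs_add_le _ _).trans ?_)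
  have := abs_shift_sub_le hε t x
  linarith [min_le_right ε ((1 - |(x : ℝ)|) / 2), x.abs_le]

lemma continuous_shift (ε : ℝ) : Continuous fun p : SymmInterval × SymmInterval =>
    shift ε p.1 p.2 := by
  unfold shift
  fun_prop

lemma bijective_shift {ε : ℝ} (hε : 0 < ε) (t : SymmInterval) :
    Function.Bijective (shift ε t) := by
  constructor
  · intro x y hxy
    have h := congrArg Subtype.val hxy
    rw [coe_shift hε, coe_shift hε] at h
    have h1 : |min ε ((1 - |(x : ℝ)|) / 2) - min ε ((1 - |(y : ℝ)|) / 2)| ≤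
        |(x : ℝ) - y| / 2 := by
      refine (abs_min_sub_min_le_max _ _ _ _).trans ?_
      rw [sub_self, abs_zero, max_eq_right (abs_nonneg _)]
      rw [show (1 - |(x : ℝ)|) / 2 - (1 - |(y : ℝ)|) / 2 = -(|(x : ℝ)| - |(y : ℝ)|) / 2 by ring,
        abs_div, abs_neg, abs_two]
      linarith [abs_abs_sub_abs_le (x : ℝ) y]
    have h2 : (x : ℝ) - y =
        -(t * (min ε ((1 - |(x : ℝ)|) / 2) - min ε ((1 - |(y : ℝ)|) / 2))) := by linarith
    have h3 : |(x : ℝ) - y| ≤ |(x : ℝ) - y| / 2 := by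
      conv_lhs => rw [h2, abs_neg, abs_mul]
      nlinarith [t.abs_le, abs_nonneg (t : ℝ),
        abs_nonneg (min ε ((1 - |(x : ℝ)|) / 2) - min ε ((1 - |(y : ℝ)|) / 2))]
    have h4 : |(x : ℝ) - y| = 0 := le_antisymm (by linarith) (abs_nonneg _)
    exact Subtype.ext (sub_eq_zero.1 (abs_eq_zero.1 h4))
  · have hc : Continuous (shift ε t) :=
      (continuous_shift ε).comp (Continuous.prodMk_right t)
    have hm : ∀ x : SymmInterval, |(x : ℝ)| = 1 → shift ε t x = x := by
      intro x hx
      apply Subtype.ext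
      rw [coe_shift hε, hx]
      simp [hε.le]
    intro y
    have : PreconnectedSpace SymmInterval := Subtype.preconnectedSpace isPreconnected_Icc
    have h := intermediate_value_univ (⟨-1, by norm_num⟩ : SymmInterval) 1 hc
    rw [hm _ (by norm_num), hm 1 (by simp)] at h
    exact h ⟨y.2.1, y.2.2⟩

end SymmInterval

section FiberHomeomorph

variable {B ι : Type*} [TopologicalSpace B]

/-- The sup norm of the coordinates in `S`. -/
noncomputable def coordNorm (S : Finset ι) (x : ι → SymmInterval) : ℝ :=
  ‖fun i : S => (x i : ℝ)‖

lemma continuous_coordNorm (S : Finset ι) : Continuous (coordNorm S) := by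
  unfold coordNorm
  fun_prop

lemma coordNorm_nonneg (S : Finset ι) (x : ι → SymmInterval) : 0 ≤ coordNorm S x := norm_nonneg _

lemma coordNorm_le {S : Finset ι} {x : ι → SymmInterval} {r : ℝ} (hr : 0 ≤ r)
    (h : ∀ i ∈ S, |(x i : ℝ)| ≤ r) : coordNorm S x ≤ r :=
  (pi_norm_le_iff_of_nonneg hr).2 fun i => h i i.2

lemma abs_le_coordNorm {S : Finset ι} (x : ι → SymmInterval) {i : ι} (hi : i ∈ S) :
    |(x i : ℝ)| ≤ coordNorm S x :=
  norm_le_pi_norm (fun i : S => (x i : ℝ)) ⟨i, hi⟩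

lemma coordNorm_le_one (S : Finset ι) (x : ι → SymmInterval) : coordNorm S x ≤ 1 :=
  coordNorm_le zero_le_one fun i _ => (x i).abs_le

lemma coordNorm_eq_mul {S : Finset ι} {x y : ι → SymmInterval} {c : ℝ} (hc : 0 ≤ c)
    (h : ∀ i ∈ S, (y i : ℝ) = c * x i) : coordNorm S y = c * coordNorm S x := by
  have : (fun i : S => (y i : ℝ)) = c • fun i : S => (x i : ℝ) := funext fun i => h i i.2
  rw [coordNorm, this, norm_smul, Real.norm_of_nonneg hc, coordNorm]

/-- The profile of a square with a corner cut off. -/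
noncomputable def cornerProfile (ε r : ℝ) : ℝ := min 1 (2 - ε - r)

lemma continuous_cornerProfile (ε : ℝ) : Continuous (cornerProfile ε) := by
  unfold cornerProfile
  fun_prop

lemma le_cornerProfile {ε r : ℝ} (hε : 0 ≤ ε) (hr : r ≤ 1) : 1 - ε ≤ cornerProfile ε r :=
  le_min (by linarith) (by linarith)

lemma cornerProfile_le_one (ε r : ℝ) : cornerProfile ε r ≤ 1 := min_le_left _ _

lemma cornerProfile_le (ε r : ℝ) : cornerProfile ε r ≤ 2 - ε - r := min_le_right _ _

open Classical in
/-- The self-map of the cube which shrinks the coordinates in `S` where the coordinates in `T` are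
large, and then stretches the coordinates in `T` so as to fill the cube again. -/
noncomputable def cutCorner (ε : ℝ) (S T : Finset ι) (x : ι → SymmInterval) : ι → SymmInterval :=
  fun i => if i ∈ S then SymmInterval.proj (cornerProfile ε (coordNorm T x) * x i)
    else if i ∈ T then
      SymmInterval.proj (x i / cornerProfile ε (cornerProfile ε (coordNorm T x) * coordNorm S x))
    else x i

section CutCorner

variable {ε : ℝ} {S T : Finset ι}

lemma cornerProfile_pos (hε : 0 ≤ ε) (hε1 : ε < 1) {r : ℝ} (hr : r ≤ 1) :
    0 < cornerProfile ε r := by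
  linarith [le_cornerProfile hε hr]

lemma cornerProfile_mul_coordNorm_le_one (x : ι → SymmInterval) :
    cornerProfile ε (coordNorm T x) * coordNorm S x ≤ 1 :=
  mul_le_one₀ (cornerProfile_le_one _ _) (coordNorm_nonneg _ _) (coordNorm_le_one _ _)

lemma coe_cutCorner_of_mem (hε : 0 ≤ ε) (hε1 : ε < 1) (x : ι → SymmInterval) {i : ι}
    (hi : i ∈ S) :
    (cutCorner ε S T x i : ℝ) = cornerProfile ε (coordNorm T x) * x i := by
  have hp := cornerProfile_pos hε hε1 (coordNorm_le_one T x)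
  rw [cutCorner, if_pos hi, SymmInterval.coe_proj]
  rw [abs_mul, abs_of_pos hp]
  exact mul_le_one₀ (cornerProfile_le_one _ _) (abs_nonneg _) (x i).abs_le

lemma coordNorm_cutCorner (hε : 0 ≤ ε) (hε1 : ε < 1) (x : ι → SymmInterval) :
    coordNorm S (cutCorner ε S T x) = cornerProfile ε (coordNorm T x) * coordNorm S x :=
  coordNorm_eq_mul (cornerProfile_pos hε hε1 (coordNorm_le_one T x)).le fun _ hi =>
    coe_cutCorner_of_mem hε hε1 x hi

lemma coe_cutCorner_of_mem_right (hε : 0 ≤ ε) (hε1 : ε < 1) (x : ι → SymmInterval)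
    (hST : Disjoint S T) {i : ι} (hi : i ∈ T) :
    (cutCorner ε S T x i : ℝ) =
      x i / cornerProfile ε (cornerProfile ε (coordNorm T x) * coordNorm S x) := by
  have h1 := cornerProfile_mul_coordNorm_le_one x (ε := ε) (S := S) (T := T)
  have hp := cornerProfile_pos hε hε1 h1
  rw [cutCorner, if_neg (Finset.disjoint_right.1 hST hi), if_pos hi, SymmInterval.coe_proj]
  rw [abs_div, abs_of_pos hp, div_le_one hp]
  refine le_min (x i).abs_le ?_
  have h2 := abs_le_coordNorm x hi
  have h3 : cornerProfile ε (coordNorm T x) * coordNorm S x ≤ cornerProfile ε (coordNorm T x) :=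
    mul_le_of_le_one_right (cornerProfile_pos hε hε1 (coordNorm_le_one T x)).le
      (coordNorm_le_one S x)
  linarith [cornerProfile_le ε (coordNorm T x)]

lemma cutCorner_of_notMem (x : ι → SymmInterval) {i : ι} (hS : i ∉ S) (hT : i ∉ T) :
    cutCorner ε S T x i = x i := by
  rw [cutCorner, if_neg hS, if_neg hT]

lemma cutCorner_cutCorner (hε : 0 ≤ ε) (hε1 : ε < 1) (x : ι → SymmInterval)
    (hST : Disjoint S T) : cutCorner ε T S (cutCorner ε S T x) = x := by
  have hS := coordNorm_cutCorner hε hε1 x (S := S) (T := T)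
  have h1 := cornerProfile_mul_coordNorm_le_one x (ε := ε) (S := S) (T := T)
  have hp := cornerProfile_pos hε hε1 h1
  have hq := cornerProfile_pos hε hε1 (coordNorm_le_one T x)
  have hT : cornerProfile ε (cornerProfile ε (coordNorm T x) * coordNorm S x) *
      coordNorm T (cutCorner ε S T x) = coordNorm T x := by
    refine (coordNorm_eq_mul hp.le fun i hi => ?_).symm
    rw [coe_cutCorner_of_mem_right hε hε1 x hST hi]
    field_simp
  funext i
  apply Subtype.ext
  by_cases hiT : i ∈ T
  · rw [coe_cutCorner_of_mem hε hε1 _ hiT, coe_cutCorner_of_mem_right hε hε1 x hST hiT, hS]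
    field_simp
  by_cases hiS : i ∈ S
  · rw [coe_cutCorner_of_mem_right hε hε1 _ hST.symm hiS, coe_cutCorner_of_mem hε hε1 x hiS, hS,
      hT]
    field_simp
  · rw [cutCorner_of_notMem _ hiT hiS, cutCorner_of_notMem _ hiS hiT]

lemma continuous_cutCorner (hε : 0 ≤ ε) (hε1 : ε < 1) : Continuous (cutCorner (ι := ι) ε S T) := by
  have hT := continuous_coordNorm (ι := ι) T
  have hS := continuous_coordNorm (ι := ι) S
  have hs := continuous_cornerProfile ε
  refine continuous_pi fun i => ?_
  unfold cutCorner
  split_ifs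
  · fun_prop
  · refine Continuous.symmIntervalProj (Continuous.div (by fun_prop) (by fun_prop) fun x => ?_)
    exact (cornerProfile_pos hε hε1 (cornerProfile_mul_coordNorm_le_one x)).ne'
  · fun_prop

lemma abs_cutCorner_sub_le (hε : 0 ≤ ε) (hε1 : ε < 1) (x : ι → SymmInterval)
    {i : ι} (hi : i ∉ T) : |(cutCorner ε S T x i : ℝ) - x i| ≤ ε := by
  by_cases hS : i ∈ S
  · rw [coe_cutCorner_of_mem hε hε1 x hS]
    have h1 := le_cornerProfile hε (coordNorm_le_one T x)
    have h2 := cornerProfile_le_one ε (coordNorm T x)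
    have h3 : cornerProfile ε (coordNorm T x) * x i - x i =
      -((1 - cornerProfile ε (coordNorm T x)) * x i) := by ring
    rw [h3, abs_neg, abs_mul, abs_of_nonneg (by linarith)]
    nlinarith [(x i).abs_le, abs_nonneg (x i : ℝ)]
  · rw [cutCorner_of_notMem x hS hi, sub_self, abs_zero]
    exact hε

/-- `cutCorner` as a homeomorphism of `B × [-1, 1]^ι` over `B`. -/
noncomputable def cutCornerHomeomorph (hε : 0 ≤ ε) (hε1 : ε < 1)
    (B : Type*) [TopologicalSpace B] (hST : Disjoint S T) :
    B × (ι → SymmInterval) ≃ₜ B × (ι → SymmInterval) :=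
  (Homeomorph.refl B).prodCongr
    { toFun := cutCorner ε S T
      invFun := cutCorner ε T S
      left_inv := fun x => cutCorner_cutCorner hε hε1 x hST
      right_inv := fun x => cutCorner_cutCorner hε hε1 x hST.symm
      continuous_toFun := continuous_cutCorner hε hε1
      continuous_invFun := continuous_cutCorner hε hε1 }

end CutCorner

open Classical in
/-- A family of bijections of `[-1, 1]`, acting on the coordinates in `S` and depending on the
remaining coordinates, defines a homeomorphism over the base. -/
lemma exists_shear [CompactSpace B] [T2Space B] (S : Set ι)
    (φ : ι → B → (ι → SymmInterval) → SymmInterval → SymmInterval)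
    (hc : ∀ i ∈ S, Continuous fun q : B × (ι → SymmInterval) => φ i q.1 q.2 (q.2 i))
    (hb : ∀ i ∈ S, ∀ b x, Function.Bijective (φ i b x))
    (hdep : ∀ i ∈ S, ∀ b x x', (∀ k ∉ S, x k = x' k) → φ i b x = φ i b x') :
    ∃ H : B × (ι → SymmInterval) ≃ₜ B × (ι → SymmInterval), (∀ p, (H p).1 = p.1) ∧
      (∀ p, ∀ i ∈ S, (H p).2 i = φ i p.1 p.2 (p.2 i)) ∧ ∀ p, ∀ i ∉ S, (H p).2 i = p.2 i := by
  let G : B × (ι → SymmInterval) → B × (ι → SymmInterval) := fun p =>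
    (p.1, fun i => if i ∈ S then φ i p.1 p.2 (p.2 i) else p.2 i)
  have hS : ∀ p, ∀ i ∈ S, (G p).2 i = φ i p.1 p.2 (p.2 i) := fun p i hi => if_pos hi
  have hnS : ∀ p, ∀ i ∉ S, (G p).2 i = p.2 i := fun p i hi => if_neg hi
  have hG : Continuous G := by
    refine continuous_fst.prodMk (continuous_pi fun i => ?_)
    split_ifs with hi
    · exact hc i hi
    · fun_prop
  have hGb : Function.Bijective G := by
    constructor
    · rintro ⟨b, x⟩ ⟨b', x'⟩ h
      obtain rfl : b = b' := congrArg Prod.fst h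
      have h2 : ∀ i, (G (b, x)).2 i = (G (b, x')).2 i := fun i => by rw [h]
      have hk : ∀ k ∉ S, x k = x' k := fun k hk => by
        simpa only [hnS _ k hk] using h2 k
      refine Prod.ext rfl (funext fun i => ?_)
      by_cases hi : i ∈ S
      · have := h2 i
        rw [hS _ i hi, hS _ i hi, hdep i hi b x x' hk] at this
        exact (hb i hi b x').1 this
      · exact hk i hi
    · rintro ⟨b, y⟩
      choose! g hg using fun (i : ι) (hi : i ∈ S) => (hb i hi b y).2 (y i)
      have hd : ∀ k ∉ S, (fun i => if i ∈ S then g i else y i) k = y k := fun k hk => if_neg hk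
      refine ⟨(b, fun i => if i ∈ S then g i else y i), Prod.ext rfl (funext fun i => ?_)⟩
      by_cases hi : i ∈ S
      · rw [hS _ i hi, hdep i hi b _ y hd]
        simp only [if_pos hi, hg i hi]
      · rw [hnS _ i hi]
        exact hd i hi
  exact ⟨Continuous.homeoOfEquivCompactToT2 (f := Equiv.ofBijective G hGb) hG,
    fun _ => rfl, hS, hnS⟩

end FiberHomeomorph

section PushOff

variable {B Q : Type*} [TopologicalSpace B] [CompactSpace B] [T2Space B]
  [MetricSpace Q] [CompactSpace Q]

/-- The identity of `B × Q` can be approximated over `B` by maps whose image misses `Z`. -/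
def FiberApproxMissed (Z : Set (B × Q)) : Prop :=
  ∀ ε > 0, ∃ f : B × Q → Q, Continuous f ∧ (∀ p, (p.1, f p) ∉ Z) ∧ ∀ p, dist (f p) p.2 ≤ ε

lemma exists_forall_dist_lt_of_continuous {u : B × Q → Q} (hu : Continuous u) {ε : ℝ}
    (hε : 0 < ε) : ∃ δ > 0, ∀ b x y, dist x y < δ → dist (u (b, x)) (u (b, y)) < ε := by
  let _ : UniformSpace B := uniformSpaceOfCompactR1
  have h := CompactSpace.uniformContinuous_of_continuous hu
  have h2 := h (Metric.dist_mem_uniformity hε)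
  rw [Filter.mem_map, uniformity_prod, Filter.mem_inf_iff_superset] at h2
  obtain ⟨s, hs, t, ht, hst⟩ := h2
  obtain ⟨V, hV, hVs⟩ := Filter.mem_comap.1 hs
  obtain ⟨W, hW, hWt⟩ := Filter.mem_comap.1 ht
  obtain ⟨δ, hδ, hδW⟩ := Metric.mem_uniformity_dist.1 hW
  refine ⟨δ, hδ, fun b x y hxy => ?_⟩
  exact @hst ((b, x), (b, y)) ⟨hVs (refl_mem_uniformity hV), hWt (hδW hxy)⟩

lemma FiberApproxMissed.image {Z : Set (B × Q)} (hZ : FiberApproxMissed Z)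
    (H : B × Q ≃ₜ B × Q) (hH : ∀ p, (H p).1 = p.1) : FiberApproxMissed (H '' Z) := by
  intro ε hε
  obtain ⟨δ, hδ, h⟩ := exists_forall_dist_lt_of_continuous (u := fun p => (H p).2)
    (by fun_prop) hε
  obtain ⟨f, hf, hfZ, hfδ⟩ := hZ (δ / 2) (half_pos hδ)
  have hs : ∀ p, (H.symm p).1 = p.1 := fun p => by
    rw [← hH (H.symm p), H.apply_symm_apply]
  refine ⟨fun p => (H (p.1, f (H.symm p))).2, by fun_prop, ?_, ?_⟩
  · rintro p ⟨z, hz, hzp⟩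
    have h1 : H (p.1, f (H.symm p)) = (p.1, (H (p.1, f (H.symm p))).2) :=
      Prod.ext (hH _) rfl
    rw [← h1] at hzp
    rw [H.injective hzp, ← hs p] at hz
    exact hfZ _ hz
  · intro p
    have h1 : H (p.1, (H.symm p).2) = p := by
      rw [← hs p, Prod.mk.eta, H.apply_symm_apply]
    have h2 := h p.1 (f (H.symm p)) (H.symm p).2 ((hfδ _).trans_lt (half_lt_self hδ))
    rw [h1] at h2
    exact h2.le

/-- Pairs of mutually inverse maps over `B`, seen as pairs of maps into the fibre. -/
def fiberEquivPairs (B Q : Type*) [TopologicalSpace B] [TopologicalSpace Q] :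
    Set (C(B × Q, Q) × C(B × Q, Q)) :=
  {w | ∀ p : B × Q, w.2 (p.1, w.1 p) = p.2 ∧ w.1 (p.1, w.2 p) = p.2}

lemma isClosed_fiberEquivPairs {B Q : Type*} [TopologicalSpace B] [CompactSpace B] [MetricSpace Q]
    [CompactSpace Q] : IsClosed (fiberEquivPairs B Q) := by
  simp only [fiberEquivPairs, Set.ofPred_forall, Set.ofPred_and]
  refine isClosed_iInter fun p => IsClosed.inter ?_ ?_
  · exact isClosed_eq (by fun_prop) continuous_const
  · exact isClosed_eq (by fun_prop) continuous_const

/-- The homeomorphism determined by a pair of mutually inverse maps over `B`. -/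
def fiberHomeomorphOfPair (w : fiberEquivPairs B Q) : B × Q ≃ₜ B × Q where
  toFun p := (p.1, w.1.1 p)
  invFun p := (p.1, w.1.2 p)
  left_inv p := Prod.ext rfl (w.2 p).1
  right_inv p := Prod.ext rfl (w.2 p).2
  continuous_toFun := by fun_prop
  continuous_invFun := by fun_prop

/-- The pair of mutually inverse maps determined by a homeomorphism over `B`. -/
def pairOfFiberHomeomorph (H : B × Q ≃ₜ B × Q) (hH : ∀ p, (H p).1 = p.1) :
    fiberEquivPairs B Q :=
  ⟨(⟨fun p => (H p).2, by fun_prop⟩, ⟨fun p => (H.symm p).2, by fun_prop⟩), fun p => by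
    have hs : (H.symm p).1 = p.1 := by rw [← hH (H.symm p), H.apply_symm_apply]
    have h1 : (p.1, (H p).2) = H p := Prod.ext (hH p).symm rfl
    have h2 : (p.1, (H.symm p).2) = H.symm p := Prod.ext hs.symm rfl
    simp only [ContinuousMap.coe_mk, h1, h2, H.symm_apply_apply, H.apply_symm_apply, and_self]⟩

/-- If each of countably many closed sets can be pushed off by small homeomorphisms over the base,
then all of them can be pushed off simultaneously. -/
theorem exists_homeomorph_forall_notMem {Z : Set (B × Q)} (hZc : IsClosed Z)
    (hZ : FiberApproxMissed Z) (W : ℕ → Set Q) (hW : ∀ n, IsClosed (W n))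
    (hpush : ∀ Z' : Set (B × Q), IsClosed Z' → FiberApproxMissed Z' → ∀ n, ∀ ε > 0,
      ∃ g : B × Q ≃ₜ B × Q, (∀ p, (g p).1 = p.1) ∧ (∀ p, dist (g p).2 p.2 < ε) ∧
        ∀ z ∈ Z', (g z).2 ∉ W n) :
    ∃ H : B × Q ≃ₜ B × Q, (∀ p, (H p).1 = p.1) ∧ ∀ z ∈ Z, ∀ n, (H z).2 ∉ W n := by
  have : CompleteSpace (fiberEquivPairs B Q) := isClosed_fiberEquivPairs.completeSpace_coe
  let O : ℕ → Set (fiberEquivPairs B Q) := fun n => {w | Set.MapsTo w.1.1 Z (W n)ᶜ}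
  have hO : ∀ n, IsOpen (O n) := fun n =>
    (ContinuousMap.isOpen_setOfPred_mapsTo hZc.isCompact (hW n).isOpen_compl).preimage
      (continuous_fst.comp continuous_subtype_val)
  have hd : ∀ n, Dense (O n) := by
    intro n
    rw [Metric.dense_iff]
    intro w r hr
    obtain ⟨δ, hδ, hv⟩ := exists_forall_dist_lt_of_continuous w.1.2.continuous (half_pos hr)
    have hwc : IsClosed (fiberHomeomorphOfPair w '' Z) :=
      (fiberHomeomorphOfPair w).isClosedMap _ hZc
    obtain ⟨g, hg1, hg2, hg3⟩ := hpush (fiberHomeomorphOfPair w '' Z) hwc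
      (hZ.image _ fun _ => rfl) n (min δ (r / 2)) (lt_min hδ (half_pos hr))
    have hs : ∀ p, (g.symm p).1 = p.1 := fun p => by
      rw [← hg1 (g.symm p), g.apply_symm_apply]
    have hgs : ∀ p, dist (g.symm p).2 p.2 < min δ (r / 2) := fun p => by
      have := hg2 (g.symm p)
      rwa [g.apply_symm_apply, dist_comm] at this
    let w' := pairOfFiberHomeomorph ((fiberHomeomorphOfPair w).trans g) fun p => hg1 _
    refine ⟨w', ?_, ?_⟩
    · rw [Metric.mem_ball, Subtype.dist_eq, Prod.dist_eq]
      refine (max_le ?_ ?_ : _ ≤ r / 2).trans_lt (half_lt_self hr)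
      · refine (ContinuousMap.dist_le (half_pos hr).le).2 fun p => ?_
        exact ((hg2 (p.1, w.1.1 p)).trans_le (min_le_right _ _)).le
      · refine (ContinuousMap.dist_le (half_pos hr).le).2 fun p => ?_
        have h1 := (hv p.1 (g.symm p).2 p.2 ((hgs p).trans_le (min_le_left _ _))).le
        rwa [← hs p, Prod.mk.eta, hs p] at h1
    · intro z hz
      exact hg3 (z.1, w.1.1 z) ⟨z, hz, rfl⟩
  let w₀ : fiberEquivPairs B Q := ⟨(⟨Prod.snd, continuous_snd⟩, ⟨Prod.snd, continuous_snd⟩),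
    fun _ => ⟨rfl, rfl⟩⟩
  obtain ⟨w, -, hw⟩ := Metric.dense_iff.1 (dense_iInter_of_isOpen_nat hO hd) w₀ 1 one_pos
  exact ⟨fiberHomeomorphOfPair w, fun _ => rfl, fun z hz n => Set.mem_iInter.1 hw n hz⟩

end PushOff

section Interior

variable {B : Type*} [TopologicalSpace B]

lemma exists_coord_close_subset {V : Set ((ℕ → SymmInterval) × (ℕ → SymmInterval))}
    (hV : V ∈ uniformity (ℕ → SymmInterval)) :
    ∃ N : ℕ, ∃ ε > 0, ∀ x y : ℕ → SymmInterval, (∀ i < N, |(x i : ℝ) - y i| < ε) → (x, y) ∈ V := by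
  rw [Pi.uniformity, Filter.mem_iInf] at hV
  obtain ⟨I, hI, U, hU, rfl⟩ := hV
  have h1 : ∀ i : I, ∃ ε > 0, ∀ x y : ℕ → SymmInterval,
      |(x i : ℝ) - y i| < ε → (x, y) ∈ U i := by
    intro i
    obtain ⟨t, ht, htU⟩ := Filter.mem_comap.1 (hU i)
    obtain ⟨ε, hε, h⟩ := Metric.mem_uniformity_dist.1 ht
    exact ⟨ε, hε, fun x y hxy => htU (h hxy)⟩
  choose ε hε hεU using h1
  have : Finite I := hI
  obtain ⟨N, hN⟩ := hI.bddAbove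
  have h2 : ∃ δ > 0, ∀ i : I, δ ≤ ε i := by
    cases isEmpty_or_nonempty I
    · exact ⟨1, one_pos, fun i => isEmptyElim i⟩
    · obtain ⟨i, hi⟩ := Finite.exists_min ε
      exact ⟨ε i, hε i, hi⟩
  obtain ⟨δ, hδ, hδε⟩ := h2
  refine ⟨N + 1, δ, hδ, fun x y h => Set.mem_iInter.2 fun i => ?_⟩
  exact hεU i x y ((h i (Nat.lt_succ_of_le (hN i.2))).trans_le (hδε i))

lemma coord_close_mem_uniformity (N : ℕ) {ε : ℝ} (hε : 0 < ε) :
    {w : (ℕ → SymmInterval) × (ℕ → SymmInterval) | ∀ i < N, |(w.1 i : ℝ) - w.2 i| < ε} ∈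
      uniformity (ℕ → SymmInterval) := by
  have : {w : (ℕ → SymmInterval) × (ℕ → SymmInterval) | ∀ i < N, |(w.1 i : ℝ) - w.2 i| < ε} =
      ⋂ i ∈ Finset.range N, {w | |(w.1 i : ℝ) - w.2 i| < ε} := by
    ext; simp
  rw [this, Filter.biInter_finset_mem]
  intro i _
  rw [Pi.uniformity]
  exact Filter.mem_iInf_of_mem i
    (Filter.mem_comap.2 ⟨_, Metric.dist_mem_uniformity hε, fun w hw => hw⟩)

/-- The identity of `B × [-1, 1]^ℕ` can be approximated over `B`, coordinate by coordinate, by maps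
whose image misses `Z`. -/
def CoordApproxMissed (Z : Set (B × (ℕ → SymmInterval))) : Prop :=
  ∀ N : ℕ, ∀ ε > 0, ∃ f : B × (ℕ → SymmInterval) → ℕ → SymmInterval, Continuous f ∧
    (∀ p, (p.1, f p) ∉ Z) ∧ ∀ p, ∀ i < N, |(f p i : ℝ) - p.2 i| ≤ ε

variable [CompactSpace B]

lemma exists_finite_separation {Z : Set (B × (ℕ → SymmInterval))} (hZ : IsClosed Z)
    {f : B × (ℕ → SymmInterval) → ℕ → SymmInterval} (hf : Continuous f)
    (hfZ : ∀ p, (p.1, f p) ∉ Z) :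
    ∃ M : ℕ, ∃ δ > 0, ∀ z ∈ Z, ∀ x, ∃ i < M, δ ≤ |(z.2 i : ℝ) - f (z.1, x) i| := by
  let _ : MetricSpace (ℕ → SymmInterval) := UniformSpace.metricSpace _
  have hK : IsCompact (Z ×ˢ (Set.univ : Set (ℕ → SymmInterval))) :=
    hZ.isCompact.prod isCompact_univ
  have hc : Continuous fun q : (B × (ℕ → SymmInterval)) × (ℕ → SymmInterval) =>
      dist q.1.2 (f (q.1.1, q.2)) := by fun_prop
  obtain ⟨r, hr, h⟩ := hK.exists_forall_le' hc.continuousOn (a := 0) (by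
    rintro ⟨z, x⟩ ⟨hz, -⟩
    refine dist_pos.2 fun (h : z.2 = f (z.1, x)) => hfZ (z.1, x) ?_
    rw [← h]
    exact hz)
  obtain ⟨M, δ, hδ, hM⟩ := exists_coord_close_subset (Metric.dist_mem_uniformity hr)
  refine ⟨M, δ, hδ, fun z hz x => ?_⟩
  by_contra! hcon
  exact absurd (hM _ _ hcon) (not_lt.2 (h (z, x) ⟨hz, trivial⟩))

variable [T2Space B]

lemma exists_small_homeomorph_abs_lt_one {Z : Set (B × (ℕ → SymmInterval))} (hZ : IsClosed Z)
    (hZm : CoordApproxMissed Z) (j N : ℕ) {ε : ℝ} (hε : 0 < ε) :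
    ∃ g : B × (ℕ → SymmInterval) ≃ₜ B × (ℕ → SymmInterval), (∀ p, (g p).1 = p.1) ∧
      (∀ p, ∀ i < N, |((g p).2 i : ℝ) - p.2 i| < ε) ∧ ∀ z ∈ Z, |((g z).2 j : ℝ)| < 1 := by
  wlog hjN : j < N generalizing N
  · obtain ⟨g, h1, h2, h3⟩ := this (j + 1) (Nat.lt_succ_self j)
    exact ⟨g, h1, fun p i hi => h2 p i (by omega), h3⟩
  obtain ⟨a, ha, ha8, haε⟩ : ∃ a : ℝ, 0 < a ∧ a ≤ 1 / 8 ∧ 6 * a < ε :=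
    ⟨min (1 / 8) (ε / 7), lt_min (by norm_num) (by positivity), min_le_left _ _, by
      linarith [min_le_right (1 / 8 : ℝ) (ε / 7)]⟩
  obtain ⟨f, hf, hfZ, hfN⟩ := hZm N a ha
  obtain ⟨M', δ₀, hδ₀, hsep'⟩ := exists_finite_separation hZ hf hfZ
  obtain ⟨M, hNM, hsep⟩ : ∃ M ≥ N, ∀ z ∈ Z, ∀ x, ∃ i < M, δ₀ ≤ |(z.2 i : ℝ) - f (z.1, x) i| :=
    ⟨max N M', le_max_left _ _, fun z hz x => by
      obtain ⟨i, hi, h⟩ := hsep' z hz x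
      exact ⟨i, hi.trans_le (le_max_right _ _), h⟩⟩
  obtain ⟨δ, hδ, hδa, hδ₁⟩ : ∃ δ : ℝ, 0 < δ ∧ δ ≤ 2 * a ∧ 2 * δ ≤ δ₀ :=
    ⟨min (2 * a) (δ₀ / 2), lt_min (by positivity) (by positivity), min_le_left _ _, by
      linarith [min_le_right (2 * a) (δ₀ / 2)]⟩
  have hδ1 : δ ≤ 1 := by linarith
  -- the approximating map, composed with a contraction forgetting all but `N` coordinates
  let u : (ℕ → SymmInterval) → ℕ → SymmInterval := fun x i =>
    if i < N then SymmInterval.proj ((1 - 4 * a) * x i) else 0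
  have hu : Continuous u := by
    refine continuous_pi fun i => ?_
    by_cases hi : i < N <;> simp only [u, hi, if_true, if_false] <;> fun_prop
  have huc : ∀ x, ∀ i < N, (u x i : ℝ) = (1 - 4 * a) * x i := fun x i hi => by
    simp only [u, hi, if_true]
    refine SymmInterval.coe_proj ?_
    rw [abs_mul, abs_of_pos (by linarith)]
    nlinarith [(x i).abs_le, abs_nonneg (x i : ℝ)]
  let F : B → (ℕ → SymmInterval) → ℕ → SymmInterval := fun b x => f (b, u x)
  have hF : Continuous fun q : B × (ℕ → SymmInterval) => F q.1 q.2 := by fun_prop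
  -- the target of the coordinates `N ≤ m ≤ M + N`
  let c : ℕ → B → (ℕ → SymmInterval) → SymmInterval := fun m b x =>
    if m < M then F b x m else if m < M + N then
      SymmInterval.proj ((F b x (m - M) - u x (m - M)) / a) else 1
  have hcc : ∀ m, Continuous fun q : B × (ℕ → SymmInterval) => c m q.1 q.2 := by
    intro m
    simp only [c]
    split_ifs <;> fun_prop
  have hcdep : ∀ m b x x', (∀ i < N, x i = x' i) → c m b x = c m b x' := by
    intro m b x x' h
    have : u x = u x' := by
      funext i
      by_cases hi : i < N
      · simp only [u, hi, if_true, h i hi]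
      · simp only [u, hi, if_false]
    simp only [c, F, this]
  let Y : Finset ℕ := Finset.Icc N (M + N)
  -- the four factors
  obtain ⟨G₁, hG₁, hG₁N, hG₁'⟩ := exists_shear (B := B) {i : ℕ | i < N}
    (fun i _ x => SymmInterval.shift a (x (M + i)))
    (fun i _ => (SymmInterval.continuous_shift a).comp
      (by fun_prop : Continuous fun q : B × (ℕ → SymmInterval) => (q.2 (M + i), q.2 i)))
    (fun i _ _ x => SymmInterval.bijective_shift ha _)
    (fun i _ _ x x' h => by rw [h (M + i) (by simp; omega)])
  have hdis : Disjoint (Finset.range N) {M + N} := by simp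
  let G₂ := cutCornerHomeomorph (ε := 4 * a) (by positivity) (by linarith) B hdis
  obtain ⟨G₃, hG₃, hG₃Y, hG₃'⟩ := exists_shear (B := B) (Y : Set ℕ)
    (fun m b x => SymmInterval.expandAt δ (a / 2) (c m b x))
    (fun m _ => SymmInterval.continuous_expandAt hδ hδ1 (by positivity) (hcc m) (by fun_prop))
    (fun m _ b x => SymmInterval.bijective_expandAt hδ hδ1 (by positivity) _)
    (fun m _ b x x' h => by
      rw [hcdep m b x x' fun i hi => h i (by simp [Y]; omega)])
  have hdis' : Disjoint {j} Y := by simp [Y]; omega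
  let G₄ := cutCornerHomeomorph (ε := a) ha.le (by linarith) B hdis'
  have hG₂1 : ∀ p, (G₂ p).1 = p.1 := fun _ => rfl
  have hG₄1 : ∀ p, (G₄ p).1 = p.1 := fun _ => rfl
  have hback : ∀ p, ∃ q, p = G₁ (G₂ q) ∧ q.1 = p.1 := fun p =>
    ⟨G₂.symm (G₁.symm p), by simp, by
      rw [← hG₂1, ← hG₁]; simp⟩
  have hforw : ∀ q, (G₁.symm.trans (G₂.symm.trans (G₃.trans G₄))) (G₁ (G₂ q)) = G₄ (G₃ q) :=
    fun q => by simp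
  refine ⟨G₁.symm.trans (G₂.symm.trans (G₃.trans G₄)), fun p => ?_, fun p i hi => ?_,
    fun z hz => ?_⟩
  · obtain ⟨q, rfl, hq⟩ := hback p
    rw [hforw, hG₄1, hG₃, hq]
  · obtain ⟨q, rfl, hq⟩ := hback p
    rw [hforw]
    have hiY : i ∉ Y := by simp [Y]; omega
    have h1 : |((G₁ (G₂ q)).2 i : ℝ) - (G₂ q).2 i| ≤ a := by
      rw [hG₁N _ i hi, SymmInterval.coe_shift ha, add_sub_cancel_left]
      exact (SymmInterval.abs_shift_sub_le ha _ _).trans (min_le_left _ _)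
    have h2 : |((G₂ q).2 i : ℝ) - q.2 i| ≤ 4 * a :=
      abs_cutCorner_sub_le (by positivity) (by linarith) q.2 (by simp; omega)
    have h3 : (G₃ q).2 i = q.2 i := hG₃' q i hiY
    have h4 : |((G₄ (G₃ q)).2 i : ℝ) - (G₃ q).2 i| ≤ a :=
      abs_cutCorner_sub_le ha.le (by linarith) _ hiY
    rw [h3] at h4
    rw [abs_le] at h1 h2 h4
    rw [abs_lt]
    constructor <;> linarith [h1.1, h1.2, h2.1, h2.2, h4.1, h4.2]
  · obtain ⟨q, rfl, hq⟩ := hback z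
    rw [hforw]
    have key : ∃ m ∈ Y, δ ≤ |(q.2 m : ℝ) - c m q.1 q.2| := by
      by_contra! hcon
      obtain ⟨i, hi, hsi⟩ := hsep _ hz (u q.2)
      rw [← hq] at hsi
      change δ₀ ≤ |((G₁ (G₂ q)).2 i : ℝ) - F q.1 q.2 i| at hsi
      have hG₂Y : ∀ m, N ≤ m → m < M + N → (G₂ q).2 m = q.2 m := fun m h1 h2 =>
        cutCorner_of_notMem q.2 (by simp; omega) (by simp; omega)
      by_cases hiN : i < N
      · have hw := hcon (M + N) (by simp [Y])
        have ht := hcon (M + i) (by simp [Y]; omega)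
        have hcw : c (M + N) q.1 q.2 = 1 := by simp [c]
        have hFu : |(F q.1 q.2 i : ℝ) - u q.2 i| ≤ a := hfN (q.1, u q.2) i hiN
        have hct : (c (M + i) q.1 q.2 : ℝ) = (F q.1 q.2 i - u q.2 i) / a := by
          have h1 : ¬ M + i < M := by omega
          have h2 : M + i < M + N := by omega
          simp only [c, h1, h2, if_true, if_false, Nat.add_sub_cancel_left]
          refine SymmInterval.coe_proj ?_
          rwa [abs_div, abs_of_pos ha, div_le_one ha]
        have hs : ∃ s : ℝ, ((G₂ q).2 i : ℝ) = s * q.2 i ∧ 1 - 4 * a ≤ s ∧ s ≤ 1 - 4 * a + δ := by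
          refine ⟨_, coe_cutCorner_of_mem (by positivity) (by linarith) q.2
            (Finset.mem_range.2 hiN), le_cornerProfile (by positivity) (coordNorm_le_one _ _), ?_⟩
          refine (cornerProfile_le _ _).trans ?_
          have h1 := abs_le_coordNorm q.2 (Finset.mem_singleton_self (M + N))
          rw [hcw, SymmInterval.coe_one] at hw
          linarith [(abs_lt.1 hw).1, le_abs_self (q.2 (M + N) : ℝ)]
        obtain ⟨s, hs, hs1, hs2⟩ := hs
        have hq1 := (q.2 i).abs_le
        have hx : |((G₂ q).2 i : ℝ)| ≤ 1 - 2 * a := by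
          rw [hs, abs_mul, abs_of_pos (by linarith)]
          nlinarith [abs_nonneg (q.2 i : ℝ)]
        have hz' : ((G₁ (G₂ q)).2 i : ℝ) = s * q.2 i + q.2 (M + i) * a := by
          rw [hG₁N _ i hiN, SymmInterval.coe_shift ha, min_eq_left (by linarith), hs,
            hG₂Y (M + i) (by omega) (by omega)]
        rw [hct] at ht
        have h5 : ((G₁ (G₂ q)).2 i : ℝ) - F q.1 q.2 i = (s - (1 - 4 * a)) * q.2 i +
            a * ((q.2 (M + i) : ℝ) - (F q.1 q.2 i - u q.2 i) / a) := by
          rw [hz', huc _ i hiN]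
          field_simp
          ring
        have h6 : |(s - (1 - 4 * a)) * (q.2 i : ℝ)| ≤ δ := by
          rw [abs_mul, abs_of_nonneg (by linarith)]
          nlinarith [abs_nonneg (q.2 i : ℝ)]
        have h7 : |a * ((q.2 (M + i) : ℝ) - (F q.1 q.2 i - u q.2 i) / a)| < δ := by
          rw [abs_mul, abs_of_pos ha]
          nlinarith [abs_nonneg ((q.2 (M + i) : ℝ) - (F q.1 q.2 i - u q.2 i) / a)]
        rw [h5] at hsi
        linarith [abs_add_le ((s - (1 - 4 * a)) * (q.2 i : ℝ))
          (a * ((q.2 (M + i) : ℝ) - (F q.1 q.2 i - u q.2 i) / a))]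
      · have h1 := hcon i (by simp [Y]; omega)
        have h2 : c i q.1 q.2 = F q.1 q.2 i := by simp only [c, hi, if_true]
        rw [h2] at h1
        rw [hG₁' _ i hiN, hG₂Y i (by omega) (by omega)] at hsi
        linarith
    obtain ⟨m, hm, hδm⟩ := key
    have h1 : 1 - a / 2 ≤ coordNorm Y (G₃ q).2 := by
      refine le_trans ?_ (abs_le_coordNorm _ hm)
      rw [hG₃Y q m hm]
      exact SymmInterval.le_abs_expandAt hδ hδ1 (by positivity) (by linarith) hδm
    have h2 : ((G₄ (G₃ q)).2 j : ℝ) = cornerProfile a (coordNorm Y (G₃ q).2) * (G₃ q).2 j :=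
      coe_cutCorner_of_mem ha.le (by linarith) _ (Finset.mem_singleton_self j)
    have h3 := cornerProfile_le a (coordNorm Y (G₃ q).2)
    have h4 := cornerProfile_pos ha.le (by linarith) (coordNorm_le_one Y (G₃ q).2)
    rw [h2, abs_mul, abs_of_pos h4]
    nlinarith [((G₃ q).2 j).abs_le]

/-- A closed set which can be missed over the base by approximations of the identity can be moved
over the base into the pseudo-interior. -/
theorem exists_homeomorph_forall_abs_lt_one {Z : Set (B × (ℕ → SymmInterval))} (hZ : IsClosed Z)
    (hZm : CoordApproxMissed Z) :
    ∃ H : B × (ℕ → SymmInterval) ≃ₜ B × (ℕ → SymmInterval), (∀ p, (H p).1 = p.1) ∧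
      ∀ z ∈ Z, ∀ j, |((H z).2 j : ℝ)| < 1 := by
  let _ : MetricSpace (ℕ → SymmInterval) := UniformSpace.metricSpace _
  suffices h : ∃ H : B × (ℕ → SymmInterval) ≃ₜ B × (ℕ → SymmInterval), (∀ p, (H p).1 = p.1) ∧
      ∀ z ∈ Z, ∀ j, (H z).2 ∉ {x : ℕ → SymmInterval | 1 ≤ |(x j : ℝ)|} by
    obtain ⟨H, hH, h⟩ := h
    exact ⟨H, hH, fun z hz j => not_le.1 (h z hz j)⟩
  refine exists_homeomorph_forall_notMem hZ ?_ _ ?_ ?_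
  · intro ε hε
    obtain ⟨N, δ, hδ, hN⟩ := exists_coord_close_subset (Metric.dist_mem_uniformity hε)
    obtain ⟨f, hf, hfZ, hfN⟩ := hZm N (δ / 2) (half_pos hδ)
    exact ⟨f, hf, hfZ, fun p =>
      (hN _ _ fun i hi => (hfN p i hi).trans_lt (half_lt_self hδ) : dist _ _ < ε).le⟩
  · exact fun j => isClosed_le continuous_const (by fun_prop)
  · intro Z' hZ' hZm' j ε hε
    obtain ⟨N, δ, hδ, hN⟩ := exists_coord_close_subset (Metric.dist_mem_uniformity hε)
    obtain ⟨g, hg, hgN, hgj⟩ := exists_small_homeomorph_abs_lt_one hZ' (fun N' δ' hδ' => by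
      obtain ⟨r, hr, hr'⟩ := Metric.mem_uniformity_dist.1 (coord_close_mem_uniformity N' hδ')
      obtain ⟨f, hf, hfZ, hfr⟩ := hZm' (r / 2) (half_pos hr)
      exact ⟨f, hf, hfZ, fun p i hi =>
        (hr' ((hfr p).trans_lt (half_lt_self hr)) i hi).le⟩) j N hδ
    exact ⟨g, hg, fun p => hN _ _ (hgN p), fun z hz => not_le.2 (hgj z hz)⟩

end Interior

section Assembly

variable {B ι : Type*} [TopologicalSpace B] [LinearOrder ι]

/-- The restriction of a point to the blocks of index at most `α`. -/
def restrictBlocks (α : ι) (p : B × (ι × ℕ → SymmInterval)) :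
    (B × (Iio α × ℕ → SymmInterval)) × (ℕ → SymmInterval) :=
  ((p.1, fun i => p.2 (i.1, i.2)), fun n => p.2 (α, n))

lemma continuous_restrictBlocks (α : ι) : Continuous (restrictBlocks (B := B) α) := by
  unfold restrictBlocks
  fun_prop

/-- Extension by `0` to the blocks of index larger than `α`. -/
def extendBlocks (α : ι) (q : (B × (Iio α × ℕ → SymmInterval)) × (ℕ → SymmInterval)) :
    B × (ι × ℕ → SymmInterval) :=
  (q.1.1, fun i => if h : i.1 < α then q.1.2 (⟨i.1, h⟩, i.2) else if i.1 = α then q.2 i.2 else 0)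

lemma continuous_extendBlocks (α : ι) : Continuous (extendBlocks (B := B) α) := by
  refine (continuous_fst.comp continuous_fst).prodMk (continuous_pi fun i => ?_)
  split_ifs <;> fun_prop

variable [CompactSpace B] [T2Space B]

/-- Homeomorphisms acting on the blocks of coordinates, each depending on the preceding blocks,
define a homeomorphism over the base. -/
theorem exists_triangular_homeomorph [WellFoundedLT ι]
    (H : ∀ α : ι, (B × (Iio α × ℕ → SymmInterval)) × (ℕ → SymmInterval) ≃ₜ
      (B × (Iio α × ℕ → SymmInterval)) × (ℕ → SymmInterval))
    (hH : ∀ α p, (H α p).1 = p.1) :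
    ∃ G : B × (ι × ℕ → SymmInterval) ≃ₜ B × (ι × ℕ → SymmInterval), (∀ p, (G p).1 = p.1) ∧
      ∀ p i, (G p).2 i = (H i.1 (restrictBlocks i.1 p)).2 i.2 := by
  let G : B × (ι × ℕ → SymmInterval) → B × (ι × ℕ → SymmInterval) := fun p =>
    (p.1, fun i => (H i.1 (restrictBlocks i.1 p)).2 i.2)
  have hG : Continuous G := by
    refine continuous_fst.prodMk (continuous_pi fun i => ?_)
    have := (H i.1).continuous.comp (continuous_restrictBlocks (B := B) i.1)
    exact (continuous_apply i.2).comp (continuous_snd.comp this)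
  have hGb : Function.Bijective G := by
    constructor
    · rintro ⟨b, x⟩ ⟨b', x'⟩ h
      obtain rfl : b = b' := congrArg Prod.fst h
      have key : ∀ α n, x (α, n) = x' (α, n) := by
        intro α
        induction α using WellFoundedLT.induction with
        | ind α ih =>
          have h1 : (restrictBlocks α (b, x)).1 = (restrictBlocks α (b, x')).1 :=
            Prod.ext rfl (funext fun i => ih i.1.1 i.1.2 i.2)
          have h2 : H α (restrictBlocks α (b, x)) = H α (restrictBlocks α (b, x')) := by
            refine Prod.ext (by rw [hH, hH, h1]) (funext fun n => ?_)
            exact congrFun (congrArg Prod.snd h) (α, n)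
          exact fun n => congrFun (congrArg Prod.snd ((H α).injective h2)) n
      exact Prod.ext rfl (funext fun i => key i.1 i.2)
    · rintro ⟨b, y⟩
      let F : ∀ α : ι, (∀ β : ι, β < α → ℕ → SymmInterval) → ℕ → SymmInterval := fun α x =>
        ((H α).symm ((b, fun i => x i.1.1 i.1.2 i.2), fun n => y (α, n))).2
      let x : ι → ℕ → SymmInterval := (wellFounded_lt (α := ι)).fix F
      have hx : ∀ α, x α = F α fun β _ => x β := fun α => (wellFounded_lt (α := ι)).fix_eq F α
      refine ⟨(b, fun i => x i.1 i.2), Prod.ext rfl (funext fun i => ?_)⟩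
      have h1 : restrictBlocks i.1 (b, fun i => x i.1 i.2) =
          (H i.1).symm ((b, fun j => x j.1.1 j.2), fun n => y (i.1, n)) := by
        refine Prod.ext ?_ (hx i.1)
        rw [← hH i.1 ((H i.1).symm _), Homeomorph.apply_symm_apply]
        rfl
      show (H i.1 (restrictBlocks i.1 (b, fun i => x i.1 i.2))).2 i.2 = y i
      rw [h1, Homeomorph.apply_symm_apply]
  exact ⟨Continuous.homeoOfEquivCompactToT2 (f := Equiv.ofBijective G hGb) hG,
    fun _ => rfl, fun _ _ => rfl⟩

/-- A closed set which can be missed over the base by maps fixing the blocks below a given one and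
approximating the identity on that block can be moved over the base into the pseudo-interior. -/
theorem exists_homeomorph_forall_abs_lt_one_of_blocks [WellFoundedLT ι]
    {Z : Set (B × (ι × ℕ → SymmInterval))} (hZ : IsClosed Z)
    (hm : ∀ (α : ι) (N : ℕ), ∀ ε > 0, ∃ f : B × (ι × ℕ → SymmInterval) → ι × ℕ → SymmInterval,
      Continuous f ∧ (∀ p, ∀ β < α, ∀ n, f p (β, n) = p.2 (β, n)) ∧
      (∀ p, ∀ n < N, |(f p (α, n) : ℝ) - p.2 (α, n)| ≤ ε) ∧
      ∀ p z, (p.1, z) ∈ Z → ∃ β ≤ α, ∃ n, z (β, n) ≠ f p (β, n)) :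
    ∃ H : B × (ι × ℕ → SymmInterval) ≃ₜ B × (ι × ℕ → SymmInterval), (∀ p, (H p).1 = p.1) ∧
      ∀ z ∈ Z, ∀ i, |((H z).2 i : ℝ)| < 1 := by
  have hα : ∀ α : ι, ∃ H : (B × (Iio α × ℕ → SymmInterval)) × (ℕ → SymmInterval) ≃ₜ
      (B × (Iio α × ℕ → SymmInterval)) × (ℕ → SymmInterval), (∀ p, (H p).1 = p.1) ∧
      ∀ z ∈ restrictBlocks α '' Z, ∀ j, |((H z).2 j : ℝ)| < 1 := by
    intro α
    refine exists_homeomorph_forall_abs_lt_one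
      (hZ.isCompact.image (continuous_restrictBlocks α)).isClosed fun N ε hε => ?_
    obtain ⟨f, hf, hf1, hf2, hf3⟩ := hm α N ε hε
    refine ⟨fun q n => f (extendBlocks α q) (α, n), ?_, ?_, ?_⟩
    · have := hf.comp (continuous_extendBlocks (B := B) α)
      exact continuous_pi fun n => (continuous_apply (α, n)).comp this
    · rintro ⟨⟨b, x⟩, y⟩ ⟨⟨b', z⟩, hz, h⟩
      obtain rfl : b' = b := congrArg (fun q => q.1.1) h
      obtain ⟨β, hβ, n, hn⟩ := hf3 (extendBlocks α ((b', x), y)) z hz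
      refine hn ?_
      rcases hβ.lt_or_eq with hβ | rfl
      · rw [hf1 _ β hβ]
        have := congrFun (congrArg (fun q => q.1.2) h) (⟨β, hβ⟩, n)
        simpa [extendBlocks, hβ, restrictBlocks] using this
      · exact congrFun (congrArg Prod.snd h) n
    · intro q n hn
      simpa [extendBlocks] using hf2 (extendBlocks α q) n hn
  choose H hH hHZ using hα
  obtain ⟨G, hG, hGH⟩ := exists_triangular_homeomorph H hH
  refine ⟨G, hG, fun z hz i => ?_⟩
  rw [hGH]
  exact hHZ i.1 _ (mem_image_of_mem _ hz) i.2

end Assembly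

section Extension

variable {P X : Type*} [TopologicalSpace P] [CompactSpace P] [TopologicalSpace X]

lemma exists_nonneg_lt_one_forall_le {f : P → ℝ} (hf : Continuous f) (h : ∀ p, f p < 1) :
    ∃ r : ℝ, 0 ≤ r ∧ r < 1 ∧ ∀ p, f p ≤ r := by
  cases isEmpty_or_nonempty P
  · exact ⟨0, le_rfl, one_pos, fun p => isEmptyElim p⟩
  · obtain ⟨q, -, hq⟩ := isCompact_univ.exists_isMaxOn univ_nonempty hf.continuousOn
    exact ⟨max 0 (f q), le_max_left _ _, max_lt one_pos (h q),
      fun p => (hq (mem_univ p)).trans (le_max_right _ _)⟩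

/-- A form of the Tietze extension theorem for functions which factor through a continuous map. -/
lemma exists_continuous_factor [CompactSpace X] [T2Space X] {u : P → X} (hu : Continuous u)
    {v : P → ℝ} (hv : Continuous v) (huv : ∀ p p', u p = u p' → v p = v p') {r : ℝ} (hr : 0 ≤ r)
    (hvr : ∀ p, |v p| ≤ r) :
    ∃ g : X → ℝ, Continuous g ∧ (∀ p, g (u p) = v p) ∧ ∀ x, |g x| ≤ r := by
  let u' : C(P, range u) := ⟨rangeFactorization u, by fun_prop⟩
  have hq : Topology.IsQuotientMap u' :=
    u'.continuous.isClosedMap.isQuotientMap u'.continuous rangeFactorization_surjective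
  have hf : Function.FactorsThrough (⟨v, hv⟩ : C(P, ℝ)) u' := fun p p' h =>
    huv p p' (congrArg Subtype.val h)
  let w : C(range u, ℝ) := hq.lift ⟨v, hv⟩ hf
  obtain ⟨g, hg⟩ := w.exists_restrict_eq (isCompact_range hu).isClosed
  have hr' : -r ≤ r := by linarith
  have hgv : ∀ p, g (u p) = v p := fun p => by
    have h1 : w (u' p) = v p := congrArg (fun f : C(P, ℝ) => f p) (hq.lift_comp ⟨v, hv⟩ hf)
    rw [← h1, ← hg]
    rfl
  refine ⟨fun x => projIcc (-r) r hr' (g x), ?_, fun p => ?_, fun x => ?_⟩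
  · exact continuous_subtype_val.comp (continuous_projIcc.comp g.continuous)
  · simp only [hgv, projIcc_of_mem hr' (abs_le.1 (hvr p))]
  · exact abs_le.2 (projIcc (-r) r hr' (g x)).2

end Extension

section Shear

variable {B ι : Type*} [TopologicalSpace B] [CompactSpace B] [T2Space B]

/-- Möbius transformations can be applied to the coordinates in `S` of a compact family of points,
with parameters determined by the remaining coordinates. -/
lemma exists_mobius_shear {P : Type*} [TopologicalSpace P] [CompactSpace P] (S : Set ι)
    {u : P → B × (ι → SymmInterval)} (hu : Continuous u) {v : P → ι → ℝ} (hv : Continuous v)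
    (hdet : ∀ p p', (u p).1 = (u p').1 → (∀ k ∉ S, (u p).2 k = (u p').2 k) →
      ∀ i ∈ S, v p i = v p' i) (hv1 : ∀ p, ∀ i ∈ S, |v p i| < 1) :
    ∃ K : B × (ι → SymmInterval) ≃ₜ B × (ι → SymmInterval), (∀ q, (K q).1 = q.1) ∧
      (∀ p, ∀ i ∈ S, (K (u p)).2 i = SymmInterval.mobius (v p i) ((u p).2 i)) ∧
      ∀ q, ∀ i ∉ S, (K q).2 i = q.2 i := by
  let res : B × (ι → SymmInterval) → B × ({k // k ∉ S} → SymmInterval) := fun q =>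
    (q.1, fun k => q.2 k)
  have hres : Continuous res := by unfold res; fun_prop
  have hg : ∀ i ∈ S, ∃ g : B × ({k // k ∉ S} → SymmInterval) → ℝ, Continuous g ∧
      (∀ p, g (res (u p)) = v p i) ∧ ∀ x, |g x| < 1 := by
    intro i hi
    have hvi : Continuous fun p => v p i := by fun_prop
    obtain ⟨r, hr, hr1, hvr⟩ := exists_nonneg_lt_one_forall_le hvi.abs fun p => hv1 p i hi
    obtain ⟨g, hg, hgu, hgr⟩ := exists_continuous_factor (hres.comp hu) hvi
      (fun p p' (h : res (u p) = res (u p')) => hdet p p' (Prod.ext_iff.1 h).1 (fun k hk => congrFun (Prod.ext_iff.1 h).2 ⟨k, hk⟩) i hi)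
      hr hvr
    exact ⟨g, hg, hgu, fun x => (hgr x).trans_lt hr1⟩
  choose! g hgc hgu hg1 using hg
  obtain ⟨K, hK, hKS, hKn⟩ := exists_shear S
    (fun i b x y => SymmInterval.mobius (g i (res (b, x))) y)
    (fun i hi => SymmInterval.continuous_mobius ((hgc i hi).comp hres) (by fun_prop)
      fun q => hg1 i hi _)
    (fun i hi b x => SymmInterval.bijective_mobius (hg1 i hi _))
    (fun i hi b x x' h => by
      have : res (b, x) = res (b, x') := Prod.ext rfl (funext fun k => h k k.2)
      simp only [this])
  exact ⟨K, hK, fun p i hi => by rw [hKS _ i hi, ← hgu i hi p], hKn⟩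

/-- Reindexing of the coordinates, over the base. -/
def reindexHomeomorph (B : Type*) [TopologicalSpace B] {ι κ : Type*} (e : ι ≃ κ) :
    B × (ι → SymmInterval) ≃ₜ B × (κ → SymmInterval) where
  toFun p := (p.1, fun k => p.2 (e.symm k))
  invFun p := (p.1, fun i => p.2 (e i))
  left_inv p := by simp
  right_inv p := by simp
  continuous_toFun := by fun_prop
  continuous_invFun := by fun_prop

/-- A compact set in the pseudo-interior can be moved over the base so that one half of its
coordinates vanish, the remaining ones being bounded by `1 / 2`. -/
lemma exists_homeomorph_inr_eq_zero_of_prod_nat {A : Type*}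
    {Z : Set (B × ((A × ℕ) ⊕ A → SymmInterval))} (hZ : IsClosed Z)
    (hint : ∀ z ∈ Z, ∀ i, |(z.2 i : ℝ)| < 1) :
    ∃ H : B × ((A × ℕ) ⊕ A → SymmInterval) ≃ₜ B × ((A × ℕ) ⊕ A → SymmInterval),
      (∀ p, (H p).1 = p.1) ∧
      (∀ z ∈ Z, ∀ i, |((H z).2 (Sum.inl i) : ℝ)| ≤ 1 / 2) ∧
      ∀ z ∈ Z, ∀ a, (H z).2 (Sum.inr a) = 0 := by
  have : CompactSpace Z := isCompact_iff_compactSpace.1 hZ.isCompact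
  have hr : ∀ i, ∃ r : ℝ, 0 ≤ r ∧ r < 1 ∧ ∀ z : Z, |(z.1.2 i : ℝ)| ≤ r := fun i =>
    exists_nonneg_lt_one_forall_le (by fun_prop) fun z => hint z z.2 i
  choose r hr0 hr1 hr using hr
  let δ : ℕ → ℝ := fun m => 1 / 8 * (1 / ((m : ℝ) + 1))
  have hδ : ∀ m, 0 < δ m := fun m => by positivity
  have hδ8 : ∀ m, δ m ≤ 1 / 8 := fun m => by
    have : 1 / ((m : ℝ) + 1) ≤ 1 := by
      rw [div_le_one (by positivity)]; linarith [(Nat.cast_nonneg m : (0 : ℝ) ≤ m)]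
    simp only [δ]; linarith
  have hδ0 : Filter.Tendsto δ Filter.atTop (𝓝 0) := by
    simpa only [mul_zero] using
      (tendsto_one_div_add_atTop_nhds_zero_nat (𝕜 := ℝ)).const_mul (1 / 8 : ℝ)
  let k : A × ℕ → ℝ := fun i => 1 / (δ i.2 * (1 - r (Sum.inl i)))
  have hk : ∀ i, 0 < k i := fun i =>
    one_div_pos.2 (mul_pos (hδ _) (sub_pos.2 (hr1 _)))
  have hc4 : ∀ x : SymmInterval, |(x : ℝ) / 4| ≤ 1 / 4 := fun x => by
    rw [abs_div, abs_of_pos (by norm_num : (0 : ℝ) < 4)]; linarith [x.abs_le]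
  have hc1 : ∀ x : SymmInterval, |(x : ℝ) / 4| < 1 := fun x => (hc4 x).trans_lt (by norm_num)
  obtain ⟨G, hG, hGl, hGr⟩ := exists_shear (B := B) (range (Sum.inl : A × ℕ → (A × ℕ) ⊕ A))
    (fun i b x y => Sum.elim (fun j => SymmInterval.mobius (x (Sum.inr j.1) / 4)
      (SymmInterval.dilate (k j) y)) (fun _ => y) i)
    (by
      rintro _ ⟨j, rfl⟩
      exact SymmInterval.continuous_mobius (by fun_prop)
        ((SymmInterval.continuous_dilate (hk j)).comp (by fun_prop)) fun q => hc1 _)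
    (by
      rintro _ ⟨j, rfl⟩ b x
      exact (SymmInterval.bijective_mobius (hc1 _)).comp (SymmInterval.bijective_dilate (hk j)))
    (by
      rintro _ ⟨j, rfl⟩ b x x' h
      simp only [Sum.elim_inl, h (Sum.inr j.1) (by simp)])
  have hGr' : ∀ p a, (G p).2 (Sum.inr a) = p.2 (Sum.inr a) := fun p a => hGr p _ (by simp)
  have hGl' : ∀ z ∈ Z, ∀ j : A × ℕ, ∃ t : ℝ, |t| ≤ δ j.2 ∧
      ((G z).2 (Sum.inl j) : ℝ) =
        (t + z.2 (Sum.inr j.1) / 4) / (1 + z.2 (Sum.inr j.1) / 4 * t) := by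
    intro z hz j
    refine ⟨SymmInterval.dilate (k j) (z.2 (Sum.inl j)),
      SymmInterval.abs_dilate_le (hr1 _) (hδ _) (hr _ ⟨z, hz⟩), ?_⟩
    rw [hGl z _ (mem_range_self j), ← SymmInterval.coe_mobius (hc1 _)]
    rfl
  have hlim : ∀ z ∈ Z, ∀ a, Filter.Tendsto (fun m => ((G z).2 (Sum.inl (a, m)) : ℝ))
      Filter.atTop (𝓝 ((G z).2 (Sum.inr a) / 4)) := by
    intro z hz a
    choose t ht htG using fun m => hGl' z hz (a, m)
    have ht0 : Filter.Tendsto t Filter.atTop (𝓝 0) := squeeze_zero_norm ht hδ0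
    have h1 := (ht0.add_const ((z.2 (Sum.inr a) : ℝ) / 4)).div
      ((ht0.const_mul ((z.2 (Sum.inr a) : ℝ) / 4)).const_add 1) (by simp)
    rw [hGr']
    simp only [htG]
    simpa [Pi.div_def] using h1
  obtain ⟨K, hK, hKr, hKl⟩ := exists_mobius_shear (P := Z)
    (range (Sum.inr : A → (A × ℕ) ⊕ A)) (u := fun z => G z)
    (v := fun z i => -((G z).2 i : ℝ)) (by fun_prop) (by fun_prop)
    (by
      rintro ⟨z, hz⟩ ⟨z', hz'⟩ - h _ ⟨a, rfl⟩
      have h1 := hlim z hz a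
      simp only [fun m => h (Sum.inl (a, m)) (by simp)] at h1
      have := tendsto_nhds_unique h1 (hlim z' hz' a)
      simp only
      linarith)
    (by
      rintro ⟨z, hz⟩ _ ⟨a, rfl⟩
      simp only [abs_neg, hGr']
      exact hint z hz _)
  refine ⟨G.trans K, fun p => (hK _).trans (hG p), fun z hz i => ?_, fun z hz a => ?_⟩
  · show |((K (G z)).2 (Sum.inl i) : ℝ)| ≤ _
    rw [hKl _ _ (by simp)]
    obtain ⟨t, ht, h⟩ := hGl' z hz i
    have h1 := hc4 (z.2 (Sum.inr i.1))
    set c : ℝ := z.2 (Sum.inr i.1) / 4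
    have h2 : |c * t| ≤ 1 / 4 * (1 / 8) := by
      rw [abs_mul]
      exact mul_le_mul h1 (ht.trans (hδ8 _)) (abs_nonneg _) (by norm_num)
    have h3 : 0 < 1 + c * t := by linarith [(abs_le.1 h2).1]
    rw [h, abs_div, abs_of_pos h3, div_le_iff₀ h3]
    linarith [abs_add_le t c, ht.trans (hδ8 _), (abs_le.1 h2).1]
  · show (K (G z)).2 (Sum.inr a) = 0
    rw [hKr ⟨z, hz⟩ _ (mem_range_self a)]
    apply Subtype.ext
    rw [SymmInterval.coe_mobius]
    · simp
    · simp only [abs_neg, hGr']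
      exact hint z hz _

lemma exists_homeomorph_inr_eq_zero {A : Type*} [Infinite A]
    {Z : Set (B × (A → SymmInterval))} (hZ : IsClosed Z)
    (hint : ∀ z ∈ Z, ∀ i, |(z.2 i : ℝ)| < 1) :
    ∃ H : B × (A → SymmInterval) ≃ₜ B × (A ⊕ A → SymmInterval), (∀ p, (H p).1 = p.1) ∧
      (∀ z ∈ Z, ∀ a, |((H z).2 (Sum.inl a) : ℝ)| ≤ 1 / 2) ∧
      ∀ z ∈ Z, ∀ a, (H z).2 (Sum.inr a) = 0 := by
  have h1 : Cardinal.mk A = Cardinal.mk (A × ℕ) := by simp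
  have h2 : Cardinal.mk A = Cardinal.mk ((A × ℕ) ⊕ A) := by simp
  obtain ⟨e⟩ := Cardinal.eq.1 h1
  obtain ⟨e'⟩ := Cardinal.eq.1 h2
  obtain ⟨H, hH, hHl, hHr⟩ := exists_homeomorph_inr_eq_zero_of_prod_nat
    (Z := reindexHomeomorph B e' '' Z) ((reindexHomeomorph B e').isClosedMap _ hZ)
    (by rintro _ ⟨z, hz, rfl⟩ i; exact hint z hz _)
  refine ⟨((reindexHomeomorph B e').trans H).trans
    (reindexHomeomorph B (e.symm.sumCongr (Equiv.refl A))), fun p => hH _, fun z hz a => ?_,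
    fun z hz a => ?_⟩
  · exact hHl _ (mem_image_of_mem _ hz) (e a)
  · exact hHr _ (mem_image_of_mem _ hz) a

/-- A homeomorphism over the base between compact sets lying, up to a bounded factor, in
complementary coordinate planes extends to a homeomorphism over the base. -/
lemma exists_homeomorph_extension_of_complementary {A : Type*}
    {Z F : Set (B × (A ⊕ A → SymmInterval))} (hZ : IsClosed Z) (hF : IsClosed F)
    (hZl : ∀ z ∈ Z, ∀ a, |(z.2 (Sum.inl a) : ℝ)| ≤ 1 / 2)
    (hZr : ∀ z ∈ Z, ∀ a, z.2 (Sum.inr a) = 0)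
    (hFr : ∀ z ∈ F, ∀ a, |(z.2 (Sum.inr a) : ℝ)| ≤ 1 / 2)
    (hFl : ∀ z ∈ F, ∀ a, z.2 (Sum.inl a) = 0) (h : Z ≃ₜ F) (hh : ∀ z, (h z).1.1 = z.1.1) :
    ∃ H : B × (A ⊕ A → SymmInterval) ≃ₜ B × (A ⊕ A → SymmInterval), (∀ p, (H p).1 = p.1) ∧
      ∀ z : Z, H z = h z := by
  have : CompactSpace Z := isCompact_iff_compactSpace.1 hZ.isCompact
  have : CompactSpace F := isCompact_iff_compactSpace.1 hF.isCompact
  have half_lt : ∀ {t : ℝ}, |t| ≤ 1 / 2 → |t| < 1 := fun ht => ht.trans_lt (by norm_num)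
  obtain ⟨K, hK, hKr, hKl⟩ := exists_mobius_shear (P := Z) (range (Sum.inr : A → A ⊕ A))
    (u := fun z : Z => z.1) (v := fun z i => ((h z).1.2 i : ℝ)) (by fun_prop) (by fun_prop)
    (by
      rintro z z' h1 h2 i -
      have : z = z' := Subtype.ext (Prod.ext h1 (funext fun i => by
        rcases i with a | a
        · exact h2 _ (by simp)
        · rw [hZr z z.2, hZr z' z'.2]))
      rw [this])
    (by rintro z _ ⟨a, rfl⟩; exact half_lt (hFr _ (h z).2 a))
  obtain ⟨L, hL, hLl, hLr⟩ := exists_mobius_shear (P := F) (range (Sum.inl : A → A ⊕ A))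
    (u := fun z : F => z.1) (v := fun z i => ((h.symm z).1.2 i : ℝ)) (by fun_prop) (by fun_prop)
    (by
      rintro z z' h1 h2 i -
      have : z = z' := Subtype.ext (Prod.ext h1 (funext fun i => by
        rcases i with a | a
        · rw [hFl z z.2, hFl z' z'.2]
        · exact h2 _ (by simp)))
      rw [this])
    (by rintro z _ ⟨a, rfl⟩; exact half_lt (hZl _ (h.symm z).2 a))
  have hLs : ∀ p, (L.symm p).1 = p.1 := fun p => by rw [← hL, L.apply_symm_apply]
  refine ⟨K.trans L.symm, fun p => (hLs _).trans (hK p), fun z => ?_⟩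
  show L.symm (K z) = h z
  rw [Homeomorph.symm_apply_eq]
  refine Prod.ext (by rw [hK, hL, hh]) (funext fun i => ?_)
  rcases i with a | a
  · rw [hKl _ _ (by simp), hLl _ _ (mem_range_self a), hFl _ (h z).2]
    apply Subtype.ext
    rw [SymmInterval.mobius_zero] <;> rw [h.symm_apply_apply]
    exact half_lt (hZl z z.2 a)
  · rw [hLr _ _ (by simp), hKr _ _ (mem_range_self a), hZr z z.2]
    exact Subtype.ext (SymmInterval.mobius_zero (half_lt (hFr _ (h z).2 a)))

end Shear

section Blocks

variable {B A : Type*} [TopologicalSpace B] [CompactSpace B] [T2Space B]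

lemma exists_homeomorph_forall_abs_lt_one_of_equiv {ι : Type*} [LinearOrder ι] [WellFoundedLT ι]
    (e : A ≃ ι × ℕ) {Z : Set (B × (A → SymmInterval))} (hZ : IsClosed Z)
    (hm : ∀ (α : ι) (N : ℕ), ∀ ε > 0, ∃ f : B × (A → SymmInterval) → A → SymmInterval,
      Continuous f ∧ (∀ p a, (e a).1 < α → f p a = p.2 a) ∧
      (∀ p a, (e a).1 = α → (e a).2 < N → |(f p a : ℝ) - p.2 a| ≤ ε) ∧
      ∀ p z, (p.1, z) ∈ Z → ∃ a, (e a).1 ≤ α ∧ z a ≠ f p a) :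
    ∃ H : B × (A → SymmInterval) ≃ₜ B × (A → SymmInterval), (∀ p, (H p).1 = p.1) ∧
      ∀ z ∈ Z, ∀ a, |((H z).2 a : ℝ)| < 1 := by
  let R := reindexHomeomorph B e
  obtain ⟨H, hH, hHZ⟩ := exists_homeomorph_forall_abs_lt_one_of_blocks
    (R.isClosedMap _ hZ) (fun α N ε hε => by
      obtain ⟨f, hf, hf1, hf2, hf3⟩ := hm α N ε hε
      refine ⟨fun p i => f (R.symm p) (e.symm i), ?_, ?_, ?_, ?_⟩
      · have := hf.comp R.symm.continuous
        exact continuous_pi fun i => (continuous_apply _).comp this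
      · intro p β hβ n
        have := hf1 (R.symm p) (e.symm (β, n)) (by simpa using hβ)
        simpa [R, reindexHomeomorph] using this
      · intro p n hn
        have := hf2 (R.symm p) (e.symm (α, n)) (by simp) (by simpa using hn)
        simpa [R, reindexHomeomorph] using this
      · rintro p z ⟨⟨b, z'⟩, hz, h⟩
        obtain ⟨a, ha, hne⟩ := hf3 (R.symm p) z' (by
          have h1 : b = p.1 := (Prod.ext_iff.1 h).1
          rwa [h1] at hz)
        refine ⟨(e a).1, ha, (e a).2, ?_⟩
        have h2 : z (e a) = z' a := by
          simpa [R, reindexHomeomorph] using (congrFun (Prod.ext_iff.1 h).2 (e a)).symm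
        simpa [h2] using hne)
  refine ⟨(R.trans H).trans R.symm, fun p => hH _, fun z hz a => ?_⟩
  exact hHZ _ (mem_image_of_mem R hz) (e a)

end Blocks

lemma exists_countable_superset_closed {A : Type*} (g : Finset A → Finset A) {C₀ : Set A}
    (h₀ : C₀.Countable) :
    ∃ C, C₀ ⊆ C ∧ C.Countable ∧ ∀ T : Finset A, (T : Set A) ⊆ C → (g T : Set A) ⊆ C := by
  let C : ℕ → Set A := fun n =>
    n.rec C₀ fun _ D => D ∪ ⋃ T ∈ {T : Finset A | (T : Set A) ⊆ D}, (g T : Set A)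
  have hs : ∀ n, C (n + 1) = C n ∪ ⋃ T ∈ {T : Finset A | (T : Set A) ⊆ C n}, (g T : Set A) :=
    fun n => rfl
  have hmono : Monotone C := monotone_nat_of_le_succ fun n => by
    rw [hs]; exact subset_union_left
  have hc : ∀ n, (C n).Countable := by
    intro n
    induction n with
    | zero => exact h₀
    | succ n ih =>
      rw [hs]
      refine ih.union (Set.Countable.biUnion ?_ fun T _ => (g T).countable_toSet)
      refine ((countable_ofPred_finite_subset ih).preimage
        (Finset.coe_injective (α := A))).mono fun T hT => ?_
      exact ⟨T.finite_toSet, hT⟩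
  refine ⟨⋃ n, C n, subset_iUnion C 0, countable_iUnion hc, fun T hT => ?_⟩
  obtain ⟨n, hn⟩ := hmono.directed_le.exists_mem_subset_of_finset_subset_biUnion hT
  refine subset_trans ?_ (subset_iUnion C (n + 1))
  rw [hs]
  exact subset_union_of_subset_right (subset_biUnion_of_mem
    (u := fun T : Finset A => (g T : Set A))
    (show T ∈ {T : Finset A | (T : Set A) ⊆ C n} from hn)) _

/-- A partition of a set of uncountable cardinality into a well-ordered family of countable blocks,
each of which is closed under an operation on finite sets depending on the preceding blocks. -/
theorem exists_equiv_prod_nat_closed {A : Type u} (hA : Cardinal.aleph0 < Cardinal.mk A)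
    (g : Set A → Finset A → Finset A) :
    ∃ e : A ≃ (Cardinal.mk A).ord.ToType × ℕ, ∀ α,
      Cardinal.mk {a | (e a).1 < α} < Cardinal.mk A ∧
      ∀ T : Finset A, (∀ a ∈ T, (e a).1 = α) → ∀ a ∈ g {a | (e a).1 < α} T, (e a).1 ≤ α := by
  have step : ∀ S : Set A, Cardinal.mk S < Cardinal.mk A → ∀ a : A, ∃ C : Set A, C.Countable ∧
      C.Infinite ∧ Disjoint S C ∧ a ∈ S ∪ C ∧ ∀ T : Finset A, (T : Set A) ⊆ C →
        (g S T : Set A) ⊆ S ∪ C := by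
    intro S hS a
    have hSc : (Sᶜ).Infinite := by
      have h1 : Cardinal.mk (Sᶜ : Set A) = Cardinal.mk A :=
        haveI : Infinite A := Cardinal.aleph0_le_mk_iff.1 hA.le
        Cardinal.mk_compl_of_infinite S hS
      rw [← Set.infinite_coe_iff, ← Cardinal.aleph0_le_mk_iff, h1]
      exact hA.le
    obtain ⟨D, hDS, hD, hDc⟩ : ∃ D ⊆ Sᶜ, D.Infinite ∧ D.Countable := by
      have := hSc.to_subtype
      let i := Infinite.natEmbedding (Sᶜ : Set A)
      refine ⟨range fun n => (i n : A), by rintro _ ⟨n, rfl⟩; exact (i n).2,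
        infinite_range_of_injective fun m n h => i.injective (Subtype.ext h), countable_range _⟩
    obtain ⟨C, hC0, hC, hCg⟩ := exists_countable_superset_closed (g S) (hDc.insert a)
    refine ⟨C \ S, hC.mono sdiff_subset, hD.mono fun x hx => ⟨hC0 (mem_insert_of_mem _ hx), hDS hx⟩,
      disjoint_sdiff_right, ?_, fun T hT => ?_⟩
    · rw [union_sdiff_self]
      exact Or.inr (hC0 (mem_insert _ _))
    · rw [union_sdiff_self]
      exact (hCg T (hT.trans sdiff_subset)).trans subset_union_right
  choose! K hKc hKi hKd hKa hKg using step
  obtain ⟨s⟩ : Nonempty ((Cardinal.mk A).ord.ToType ≃ A) := Cardinal.eq.1 (by simp)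
  let wf := wellFounded_lt (α := (Cardinal.mk A).ord.ToType)
  let F : ∀ α, (∀ β, β < α → Set A) → Set A := fun α C => K (⋃ β : Iio α, C β β.2) (s α)
  let C := wf.fix F
  let S : (Cardinal.mk A).ord.ToType → Set A := fun α => ⋃ β : Iio α, C β
  have hCS : ∀ α, C α = K (S α) (s α) := fun α => wf.fix_eq F α
  have hS' : ∀ α, (∀ β < α, (C β).Countable) → Cardinal.mk (S α) < Cardinal.mk A := by
    intro α h
    refine (Cardinal.mk_iUnion_le _).trans_lt (Cardinal.mul_lt_of_lt hA.le ?_ ?_)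
    · exact (Cardinal.mk_Iio_lt α (by simp)).trans_eq (by simp)
    · exact (ciSup_le' fun β : Iio α => (h β β.2).le_aleph0).trans_lt hA
  have hCc : ∀ α, (C α).Countable := by
    intro α
    induction α using WellFoundedLT.induction with
    | ind α ih => rw [hCS]; exact hKc _ (hS' α ih) _
  have hS : ∀ α, Cardinal.mk (S α) < Cardinal.mk A := fun α => hS' α fun β _ => hCc β
  have hd : ∀ {α β a}, β < α → a ∈ C β → a ∉ C α := fun {α β a} hβ haβ haα => by
    rw [hCS α] at haα
    exact Set.disjoint_left.1 (hKd _ (hS α) (s α)) (mem_iUnion.2 ⟨⟨β, hβ⟩, haβ⟩) haα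
  have hu : ∀ a, ∃! α, a ∈ C α := by
    intro a
    refine existsUnique_of_exists_of_unique ?_ fun α β hα hβ => ?_
    · have := hKa _ (hS (s.symm a)) a
      rw [← s.apply_symm_apply a, s.symm_apply_apply, ← hCS, s.apply_symm_apply] at this
      rcases this with h | h
      · obtain ⟨β, hβ⟩ := mem_iUnion.1 h
        exact ⟨β, hβ⟩
      · exact ⟨_, h⟩
    · rcases lt_trichotomy α β with h | h | h
      · exact absurd hβ (hd h hα)
      · exact h
      · exact absurd hα (hd h hβ)
  have henc : ∀ α, Nonempty (C α ≃ ℕ) := fun α => by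
    have : Countable (C α) := (hCc α).to_subtype
    have : Infinite (C α) := by
      rw [Set.infinite_coe_iff, hCS]; exact hKi _ (hS α) _
    exact nonempty_equiv_of_countable
  let enc := fun α => (henc α).some
  let e : A ≃ (Cardinal.mk A).ord.ToType × ℕ := (Set.sigmaEquiv C hu).symm.trans
    ((Equiv.sigmaCongrRight enc).trans (Equiv.sigmaEquivProd _ ℕ))
  have he' : ∀ i, e.symm i ∈ C i.1 := fun i => ((enc i.1).symm i.2).2
  have he : ∀ {a α}, (e a).1 = α ↔ a ∈ C α := fun {a α} => by
    have h1 : a ∈ C (e a).1 := by simpa using he' (e a)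
    exact ⟨fun h => h ▸ h1, fun h => (hu a).unique h1 h⟩
  have heS : ∀ α, {a | (e a).1 < α} = S α := fun α => by
    ext a
    simp only [mem_ofPred_eq, S, mem_iUnion]
    exact ⟨fun h => ⟨⟨_, h⟩, he.1 rfl⟩, fun ⟨β, hβ⟩ => he.2 hβ ▸ β.2⟩
  refine ⟨e, fun α => ⟨by rw [heS]; exact hS α, fun T hT a ha => ?_⟩⟩
  rw [heS] at ha
  have h1 := hKg (S α) (hS α) (s α) T (by
    rw [← hCS]
    exact fun a ha => he.1 (hT a ha)) ha
  rw [← hCS, ← heS] at h1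
  rcases h1 with h1 | h1
  · exact le_of_lt h1
  · exact (he.2 h1).le

section CubeHomeomorph

/-- The affine homeomorphism from the cube `[0, 1]^A` to `[-1, 1]^A`, over the base. -/
noncomputable def toSymmCube (B A : Type*) [TopologicalSpace B] :
    B × (A → unitInterval) ≃ₜ B × (A → SymmInterval) :=
  (Homeomorph.refl B).prodCongr
    (Homeomorph.piCongrRight fun _ => (iccHomeoI (-1) 1 (by norm_num)).symm)

variable {B A : Type*} [TopologicalSpace B]

lemma coe_toSymmCube_snd (p : B × (A → unitInterval)) (a : A) :
    ((toSymmCube B A p).2 a : ℝ) = 2 * p.2 a - 1 := by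
  have : ((toSymmCube B A p).2 a : ℝ) = (1 - -1) * p.2 a + -1 :=
    iccHomeoI_symm_apply_coe (-1) 1 (by norm_num) (p.2 a)
  rw [this]
  ring

end CubeHomeomorph

lemma finite_initial_block {A ι : Type*} (e : A ≃ ι × ℕ) (α : ι) (N : ℕ) :
    {a | (e a).1 = α ∧ (e a).2 < N}.Finite := by
  have : {a | (e a).1 = α ∧ (e a).2 < N} = e ⁻¹' ({α} ×ˢ Iio N) := by ext; simp
  rw [this]
  exact ((finite_singleton α).prod (finite_Iio N)).preimage e.injective.injOn

section FiberedZTau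

variable {B A : Type u} [TopologicalSpace B] {τ : Cardinal.{u}}

lemma FiberedZTauSet.exists_coord_approx_missed {Z : Set (B × (A → unitInterval))}
    (hZ : FiberedZTauSet τ Prod.fst Z) {D : Set (A × ℕ)} (hD : Cardinal.mk D < τ) :
    ∃ f : B × (A → unitInterval) → A → unitInterval, Continuous f ∧ (∀ p, (p.1, f p) ∉ Z) ∧
      ∀ p, ∀ i ∈ D, |(f p i.1 : ℝ) - p.2 i.1| < 2 / ((i.2 : ℝ) + 1) := by
  let U : A × ℕ → ℚ → Set (B × (A → unitInterval)) := fun i q =>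
    {x | |(x.2 i.1 : ℝ) - q| < 1 / ((i.2 : ℝ) + 1)}
  have hU : ∀ i, IsCFOCover (range (U i)) := by
    refine fun i => ⟨countable_range _, ?_, ?_⟩
    · rintro _ ⟨q, rfl⟩
      refine ⟨fun x => max 0 (1 / ((i.2 : ℝ) + 1) - |(x.2 i.1 : ℝ) - q|), by fun_prop, ?_⟩
      ext x
      simp [U]
    · refine eq_univ_of_forall fun x => ?_
      obtain ⟨q, hq⟩ := exists_rat_near (x.2 i.1 : ℝ)
        (by positivity : (0 : ℝ) < 1 / ((i.2 : ℝ) + 1))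
      exact ⟨_, mem_range_self q, hq⟩
  obtain ⟨f, hf, hf1, hfU, φ, -, -, hφ0, hφ1⟩ := hZ.2 id continuous_id (fun _ => rfl)
    ((fun i => range (U i)) '' D) (Cardinal.mk_image_le.trans_lt hD)
    (by rintro _ ⟨i, -, rfl⟩; exact hU i)
  refine ⟨fun p => (f p).2, by fun_prop, fun p hp => ?_, fun p i hi => ?_⟩
  · have h1 : (p.1, (f p).2) = f p := Prod.ext (hf1 p).symm rfl
    rw [h1] at hp
    have h2 := hφ1 _ hp
    rw [hφ0 _ (mem_range_self p)] at h2
    exact zero_ne_one h2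
  · obtain ⟨_, ⟨q, rfl⟩, h1, h2⟩ := hfU _ (mem_image_of_mem _ hi) p
    calc |((f p).2 i.1 : ℝ) - p.2 i.1| ≤ |((f p).2 i.1 : ℝ) - q| + |(p.2 i.1 : ℝ) - q| := by
          rw [abs_sub_comm (p.2 i.1 : ℝ)]; exact abs_sub_le _ _ _
      _ < 1 / ((i.2 : ℝ) + 1) + 1 / ((i.2 : ℝ) + 1) := add_lt_add h1 h2
      _ = 2 / ((i.2 : ℝ) + 1) := by ring

/-- The defining property of fibered `Z_τ`-sets in terms of the coordinates of `[-1, 1]^A`. -/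
lemma FiberedZTauSet.exists_symm_coord_approx_missed {Z : Set (B × (A → unitInterval))}
    (hZ : FiberedZTauSet τ Prod.fst Z) {D : Set (A × ℕ)} (hD : Cardinal.mk D < τ) :
    ∃ f : B × (A → SymmInterval) → A → SymmInterval, Continuous f ∧
      (∀ p, (p.1, f p) ∉ toSymmCube B A '' Z) ∧
      ∀ p, ∀ i ∈ D, |(f p i.1 : ℝ) - p.2 i.1| < 4 / ((i.2 : ℝ) + 1) := by
  obtain ⟨f, hf, hfZ, hfD⟩ := hZ.exists_coord_approx_missed hD
  let T := toSymmCube B A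
  refine ⟨fun p => (T (p.1, f (T.symm p))).2, ?_, ?_, ?_⟩
  · exact continuous_snd.comp (T.continuous.comp
      (continuous_fst.prodMk (hf.comp T.symm.continuous)))
  · rintro p ⟨z, hz, h⟩
    have h1 : z = (p.1, f (T.symm p)) := T.injective (h.trans (Prod.ext rfl rfl))
    exact hfZ (T.symm p) (h1 ▸ hz)
  · intro p i hi
    have h1 := hfD (T.symm p) i hi
    have h2 : (p.2 i.1 : ℝ) = 2 * (T.symm p).2 i.1 - 1 := by
      rw [← coe_toSymmCube_snd, T.apply_symm_apply]
    rw [h2]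
    simp only [T, coe_toSymmCube_snd]
    calc |2 * (f (T.symm p) i.1 : ℝ) - 1 - (2 * (T.symm p).2 i.1 - 1)|
        = 2 * |(f (T.symm p) i.1 : ℝ) - (T.symm p).2 i.1| := by
          rw [← abs_two, ← abs_mul, abs_two]; ring_nf
      _ < 2 * (2 / ((i.2 : ℝ) + 1)) := by linarith
      _ = 4 / ((i.2 : ℝ) + 1) := by ring

variable [CompactSpace B]

lemma FiberedZTauSet.exists_eq_on_missed {Z : Set (B × (A → unitInterval))}
    (hτ : Cardinal.aleph0 < τ) (hZ : FiberedZTauSet τ Prod.fst Z) {S : Set A}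
    (hS : Cardinal.mk S < τ) (T : Finset A) :
    ∃ f : B × (A → SymmInterval) → A → SymmInterval, Continuous f ∧
      (∀ p, ∀ a ∈ S ∪ T, f p a = p.2 a) ∧
      ∃ T' : Finset A, ∀ p z, (p.1, z) ∈ toSymmCube B A '' Z → ∃ a ∈ T', z a ≠ f p a := by
  have hST : Cardinal.mk (S ∪ T : Set A) < τ :=
    (Cardinal.mk_union_le S T).trans_lt (Cardinal.add_lt_of_lt hτ.le hS
      ((Cardinal.lt_aleph0_of_finite _).trans hτ))
  obtain ⟨f, hf, hfZ, hfD⟩ := hZ.exists_symm_coord_approx_missed (D := (S ∪ T) ×ˢ univ) (by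
    rw [Cardinal.mk_congr (Equiv.Set.prod _ _), Cardinal.mk_prod]
    simpa using Cardinal.mul_lt_of_lt hτ.le hST hτ)
  refine ⟨f, hf, fun p a ha => ?_, ?_⟩
  · refine Subtype.ext (sub_eq_zero.1 (abs_nonpos_iff.1 (ge_of_tendsto' (x := Filter.atTop)
      ?_ fun n : ℕ => (hfD p (a, n) ⟨ha, mem_univ n⟩).le)))
    simpa [div_eq_mul_inv] using
      (tendsto_one_div_add_atTop_nhds_zero_nat (𝕜 := ℝ)).const_mul (4 : ℝ)
  · have hZc : IsClosed (toSymmCube B A '' Z) := (toSymmCube B A).isClosedMap _ hZ.1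
    let K : Set ((B × (A → SymmInterval)) × (A → SymmInterval)) :=
      {w | (w.1.1, w.2) ∈ toSymmCube B A '' Z}
    have hK : IsCompact K := (hZc.preimage (by fun_prop)).isCompact
    obtain ⟨T', hT'⟩ := hK.elim_finite_subcover (fun a => {w | w.2 a ≠ f w.1 a})
      (fun a => isOpen_ne_fun (by fun_prop) (by fun_prop)) (by
        rintro ⟨p, z⟩ hw
        by_contra hne
        simp only [mem_iUnion, mem_ofPred_eq, not_exists, not_not] at hne
        obtain rfl : z = f p := funext hne
        exact hfZ p hw)
    refine ⟨T', fun p z hz => ?_⟩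
    simpa using hT' (show (p, z) ∈ K from hz)

variable [T2Space B]

/-- A fibered `Z_τ`-set in `B × [0, 1]^τ` can be moved over the base into the pseudo-interior. -/
theorem FiberedZTauSet.exists_homeomorph_forall_abs_lt_one (hA : Cardinal.aleph0 ≤ Cardinal.mk A)
    {Z : Set (B × (A → unitInterval))} (hZ : FiberedZTauSet (Cardinal.mk A) Prod.fst Z) :
    ∃ H : B × (A → SymmInterval) ≃ₜ B × (A → SymmInterval), (∀ p, (H p).1 = p.1) ∧
      ∀ z ∈ toSymmCube B A '' Z, ∀ a, |((H z).2 a : ℝ)| < 1 := by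
  have hZc : IsClosed (toSymmCube B A '' Z) := (toSymmCube B A).isClosedMap _ hZ.1
  rcases hA.eq_or_lt with hA | hA
  · have : Countable A := Cardinal.mk_le_aleph0_iff.1 hA.ge
    have : Infinite A := Cardinal.aleph0_le_mk_iff.1 hA.le
    obtain ⟨e⟩ : Nonempty (A ≃ Unit × ℕ) := nonempty_equiv_of_countable
    refine exists_homeomorph_forall_abs_lt_one_of_equiv e hZc fun α N ε hε => ?_
    obtain ⟨n, hn⟩ := exists_nat_one_div_lt (by positivity : 0 < ε / 4)
    obtain ⟨f, hf, hfZ, hfD⟩ := hZ.exists_symm_coord_approx_missed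
      (D := {a | (e a).1 = α ∧ (e a).2 < N} ×ˢ {n})
      (by rw [← hA]; exact ((finite_initial_block e α N).prod (finite_singleton n)).lt_aleph0)
    refine ⟨f, hf, fun p a h => (h.ne (Subsingleton.elim _ _)).elim, fun p a h ha => ?_,
      fun p z hz => ?_⟩
    · refine (hfD p (a, n) ⟨⟨h, ha⟩, rfl⟩).le.trans ?_
      show 4 / ((n : ℝ) + 1) ≤ ε
      rw [div_eq_mul_one_div]
      linarith
    · by_contra! hne
      obtain rfl : z = f p := funext fun a => hne a le_rfl
      exact hfZ p hz
  · have key : ∀ S : Set A, ∀ T : Finset A, Cardinal.mk S < Cardinal.mk A → _ :=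
      fun S T hS => hZ.exists_eq_on_missed hA hS T
    choose! f hf hfS g hg using key
    obtain ⟨e, he⟩ := exists_equiv_prod_nat_closed hA g
    refine exists_homeomorph_forall_abs_lt_one_of_equiv e hZc fun α N ε hε => ?_
    obtain ⟨hS, hgα⟩ := he α
    let T := (finite_initial_block e α N).toFinset
    have hT : ∀ a, a ∈ T ↔ (e a).1 = α ∧ (e a).2 < N := by simp [T]
    refine ⟨f {a | (e a).1 < α} T, hf _ _ hS, fun p a ha => hfS _ _ hS p a (Or.inl ha),
      fun p a ha hn => ?_, fun p z hz => ?_⟩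
    · rw [hfS _ _ hS p a (Or.inr ((hT a).2 ⟨ha, hn⟩)), sub_self, abs_zero]
      exact hε.le
    · obtain ⟨a, ha, hne⟩ := hg _ T hS p z hz
      exact ⟨a, hgα T (fun a ha => ((hT a).1 ha).1) a ha, hne⟩

/-- A fibered `Z_τ`-set in `B × [0, 1]^τ` can be moved over the base into a position where one half
of its coordinates vanish, the remaining ones being bounded by `1 / 2`. -/
theorem FiberedZTauSet.exists_homeomorph_inr_eq_zero (hA : Cardinal.aleph0 ≤ Cardinal.mk A)
    {Z : Set (B × (A → unitInterval))} (hZ : FiberedZTauSet (Cardinal.mk A) Prod.fst Z) :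
    ∃ H : B × (A → unitInterval) ≃ₜ B × (A ⊕ A → SymmInterval), (∀ p, (H p).1 = p.1) ∧
      (∀ z ∈ Z, ∀ a, |((H z).2 (Sum.inl a) : ℝ)| ≤ 1 / 2) ∧
      ∀ z ∈ Z, ∀ a, (H z).2 (Sum.inr a) = 0 := by
  have : Infinite A := Cardinal.aleph0_le_mk_iff.1 hA
  obtain ⟨G, hG, hGZ⟩ := hZ.exists_homeomorph_forall_abs_lt_one hA
  have hc : IsClosed (G '' (toSymmCube B A '' Z)) :=
    G.isClosedMap _ ((toSymmCube B A).isClosedMap _ hZ.1)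
  obtain ⟨H, hH, hHl, hHr⟩ := _root_.exists_homeomorph_inr_eq_zero hc
    (by rintro _ ⟨z, hz, rfl⟩; exact hGZ z hz)
  have hm : ∀ z ∈ Z, G (toSymmCube B A z) ∈ G '' (toSymmCube B A '' Z) := fun z hz =>
    mem_image_of_mem _ (mem_image_of_mem _ hz)
  exact ⟨((toSymmCube B A).trans G).trans H, fun p => (hH _).trans (hG _),
    fun z hz => hHl _ (hm z hz), fun z hz => hHr _ (hm z hz)⟩

end FiberedZTau

/-- Fibered `Z_τ`-set unknotting in the Tychonov cube product `I^τ × I^τ` over the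
first projection. -/
theorem fibered_Z_tau_unknotting_Tychonov_cube
    (τ : Cardinal.{u}) (hτ : Cardinal.aleph0 ≤ τ)
    (A : Type u) (hA : Cardinal.mk A = τ)
    (Z F : Set ((A → unitInterval) × (A → unitInterval)))
    (hZ : FiberedZTauSet τ Prod.fst Z) (hF : FiberedZTauSet τ Prod.fst F)
    (h : ↥Z ≃ₜ ↥F)
    (hfib : ∀ z : Z, ((h z : (A → unitInterval) × (A → unitInterval))).1 =
      (z : (A → unitInterval) × (A → unitInterval)).1) :
    ∃ H : ((A → unitInterval) × (A → unitInterval)) ≃ₜ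
        ((A → unitInterval) × (A → unitInterval)),
      (∀ z : Z, H (z : (A → unitInterval) × (A → unitInterval)) =
        (h z : (A → unitInterval) × (A → unitInterval))) ∧
      ∀ x, (H x).1 = x.1 := by
  subst hA
  obtain ⟨G, hG, hGl, hGr⟩ := hZ.exists_homeomorph_inr_eq_zero hτ
  obtain ⟨K', hK', hKl', hKr'⟩ := hF.exists_homeomorph_inr_eq_zero hτ
  let K := K'.trans (reindexHomeomorph (A → unitInterval) (Equiv.sumComm A A))
  have hK : ∀ p, (K p).1 = p.1 := hK'
  let h' : G '' Z ≃ₜ K '' F := (G.image Z).symm.trans (h.trans (K.image F))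
  have hh' : ∀ z : Z, (h' (G.image Z z) : (A → unitInterval) × (A ⊕ A → SymmInterval)) =
      K (h z) := fun z => by
    show (K.image F (h ((G.image Z).symm (G.image Z z)))).1 = _
    rw [Homeomorph.symm_apply_apply]
    rfl
  obtain ⟨H, hH, hHh⟩ := exists_homeomorph_extension_of_complementary
    (G.isClosedMap _ hZ.1) (K.isClosedMap _ hF.1)
    (by rintro _ ⟨z, hz, rfl⟩; exact hGl z hz) (by rintro _ ⟨z, hz, rfl⟩; exact hGr z hz)
    (by rintro _ ⟨z, hz, rfl⟩; exact hKl' z hz) (by rintro _ ⟨z, hz, rfl⟩; exact hKr' z hz)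
    h' (by
      rintro ⟨_, z, hz, rfl⟩
      refine (congrArg Prod.fst (hh' ⟨z, hz⟩)).trans ?_
      rw [hK, hfib, hG])
  have hKs : ∀ p, (K.symm p).1 = p.1 := fun p => by rw [← hK, K.apply_symm_apply]
  refine ⟨(G.trans H).trans K.symm, fun z => ?_, fun x => (hKs _).trans ((hH _).trans (hG x))⟩
  show K.symm (H (G z)) = h z
  rw [Homeomorph.symm_apply_eq, ← hh']
  exact hHh (G.image Z z)
end

section
/- Let τ > ω be a cardinal and let h : Z → F be a homeomorphism between Z_τ-sets Z and F in the Tychonov cube I^τ. Then there is a homeomorphism H : I^τ → I^τ such that H|Z = h. -/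
open Set Topology

universe u

/-- `Z` is a `Z_τ`-set in `X`. -/
def ZTauSet {X : Type u} [TopologicalSpace X] (τ : Cardinal.{u}) (Z : Set X) : Prop :=
  IsClosed Z ∧ ∀ g : X → X, Continuous g →
    ∀ 𝒞 : Set (Set (Set X)), Cardinal.mk ↥𝒞 < τ → (∀ 𝒰 ∈ 𝒞, IsCFOCover 𝒰) →
      ∃ f : X → X, Continuous f ∧ (∀ 𝒰 ∈ 𝒞, UClose 𝒰 f g) ∧
        FunctionallySeparated (Set.range f) Z

namespace TychonovCube

noncomputable section

/-- The first coordinate of the inverse corner slide at scale `c`. -/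
def pullFst (c w r : ℝ) : ℝ := min w r + max (w - r + max 0 (c - max w r / 2)) 0

/-- The second coordinate of the inverse corner slide at scale `c`. -/
def pullSnd (c w r : ℝ) : ℝ := min w r + max (-(w - r + max 0 (c - max w r / 2))) 0

/-- The amount by which the corner slide at scale `c` decreases `w - r`. -/
def slideAmount (c w r : ℝ) : ℝ :=
  max 0 (min (2 * c - min w r - (w - r)) ((w - r + 2 * c - min w r) / 3))

/-- The first coordinate of the corner slide at scale `c`. -/
def slideFst (c w r : ℝ) : ℝ := min w r + max (w - r - slideAmount c w r) 0

/-- The second coordinate of the corner slide at scale `c`. -/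
def slideSnd (c w r : ℝ) : ℝ := min w r + max (-(w - r - slideAmount c w r)) 0

variable {c w r : ℝ}

theorem slideFst_pull : slideFst c (pullFst c w r) (pullSnd c w r) = w := by
  unfold slideFst pullFst pullSnd slideAmount; grind

theorem slideSnd_pull : slideSnd c (pullFst c w r) (pullSnd c w r) = r := by
  unfold slideSnd pullFst pullSnd slideAmount; grind

theorem pullFst_slide : pullFst c (slideFst c w r) (slideSnd c w r) = w := by
  unfold slideFst slideSnd pullFst slideAmount; grind

theorem pullSnd_slide : pullSnd c (slideFst c w r) (slideSnd c w r) = r := by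
  unfold slideFst slideSnd pullSnd slideAmount; grind

theorem pullFst_lipschitz {w' : ℝ} :
    |pullFst c w r - pullFst c w' r| ≤ 3 * |w - w'| := by
  unfold pullFst; grind

theorem abs_slideFst_sub_le (hr : 0 ≤ r) (hc : 0 < c) : |slideFst c w r - w| ≤ c := by
  unfold slideFst slideAmount; grind

theorem slideFst_le (hw : 0 ≤ w) (hr : 0 ≤ r) (hwc : w ≤ c / 2) :
    slideFst c w r ≤ r := by
  unfold slideFst slideAmount; grind

theorem le_pullFst (hw : 0 ≤ w) (hr : 0 ≤ r) (hrc : r ≤ c / 4) : c / 2 ≤ pullFst c w r := by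
  unfold pullFst; grind

/-- The interval `[-1, 1]`. -/
abbrev J : Type := Icc (-1 : ℝ) 1

/-- A continuous self-map of the box `[0, 2] × [0, 1]` fixing the second coordinate on the upper
half. -/
structure BoxMap where
  /-- The first component. -/
  fst : ℝ → ℝ → ℝ
  /-- The second component. -/
  snd : ℝ → ℝ → ℝ
  continuous_fst : Continuous fun q : ℝ × ℝ => fst q.1 q.2
  continuous_snd : Continuous fun q : ℝ × ℝ => snd q.1 q.2
  fst_mem : ∀ w r, w ∈ Icc (0 : ℝ) 2 → r ∈ Icc (0 : ℝ) 1 → fst w r ∈ Icc (0 : ℝ) 2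
  snd_mem : ∀ w r, w ∈ Icc (0 : ℝ) 2 → r ∈ Icc (0 : ℝ) 1 → snd w r ∈ Icc (0 : ℝ) 1
  snd_eq : ∀ w r, w ∈ Icc (0 : ℝ) 2 → r ∈ Icc (0 : ℝ) 1 → 1 / 2 ≤ r → snd w r = r
  snd_le : ∀ w r, w ∈ Icc (0 : ℝ) 2 → r ∈ Icc (0 : ℝ) 1 → r ≤ 1 / 2 → snd w r ≤ 1 / 2

/-- The inverse corner slide as a self-map of the box. -/
def BoxMap.pull (c : ℝ) (hc : 0 < c) (hc' : c ≤ 1 / 4) : BoxMap where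
  fst := pullFst c
  snd := pullSnd c
  continuous_fst := by unfold pullFst; fun_prop
  continuous_snd := by unfold pullSnd; fun_prop
  fst_mem w r hw hr := by simp only [mem_Icc] at *; unfold pullFst; grind
  snd_mem w r hw hr := by simp only [mem_Icc] at *; unfold pullSnd; grind
  snd_eq w r hw hr h := by simp only [mem_Icc] at *; unfold pullSnd; grind
  snd_le w r hw hr h := by simp only [mem_Icc] at *; unfold pullSnd; grind

/-- The corner slide as a self-map of the box. -/
def BoxMap.slide (c : ℝ) (hc : 0 < c) (hc' : c ≤ 1 / 4) : BoxMap where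
  fst := slideFst c
  snd := slideSnd c
  continuous_fst := by unfold slideFst slideAmount; fun_prop
  continuous_snd := by unfold slideSnd slideAmount; fun_prop
  fst_mem w r hw hr := by simp only [mem_Icc] at *; unfold slideFst slideAmount; grind
  snd_mem w r hw hr := by simp only [mem_Icc] at *; unfold slideSnd slideAmount; grind
  snd_eq w r hw hr h := by simp only [mem_Icc] at *; unfold slideSnd slideAmount; grind
  snd_le w r hw hr h := by simp only [mem_Icc] at *; unfold slideSnd slideAmount; grind

section Lift

variable {C : Type*} [Fintype C]

/-- The distance of a point of the finite-dimensional cube from the boundary. -/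
def depth (x : C → J) : ℝ := 1 - ‖fun i => (x i : ℝ)‖

theorem continuous_depth : Continuous (depth : (C → J) → ℝ) := by
  unfold depth; fun_prop

theorem depth_mem (x : C → J) : depth x ∈ Icc (0 : ℝ) 1 := by
  have h : ‖fun i => (x i : ℝ)‖ ≤ 1 :=
    (pi_norm_le_iff_of_nonneg zero_le_one).2 fun i => abs_le.2 (x i).2
  have := norm_nonneg fun i => (x i : ℝ)
  exact ⟨by unfold depth; linarith, by unfold depth; linarith⟩

theorem abs_le_one_sub_depth (x : C → J) (i : C) : |(x i : ℝ)| ≤ 1 - depth x := by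
  simpa [depth] using norm_le_pi_norm (fun i => (x i : ℝ)) i

theorem one_sub_mem (w : J) : 1 - (w : ℝ) ∈ Icc (0 : ℝ) 2 :=
  ⟨by linarith [w.2.2], by linarith [w.2.1]⟩

namespace BoxMap

variable (β γ : BoxMap)

/-- The radial scaling factor of the lift of a box map. -/
def scale (w r : ℝ) : ℝ := 1 + (r - β.snd w r) / max (1 - r) (1 / 2)

theorem scale_mul {w r : ℝ} (hw : w ∈ Icc (0 : ℝ) 2) (hr : r ∈ Icc (0 : ℝ) 1) :
    β.scale w r * (1 - r) = 1 - β.snd w r := by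
  unfold scale
  rcases le_total (1 / 2) r with h | h
  · rw [β.snd_eq w r hw hr h]; simp
  · rw [max_eq_left (by linarith)]
    have : 1 - r ≠ 0 := by linarith
    field_simp; ring

theorem scale_nonneg {w r : ℝ} (hw : w ∈ Icc (0 : ℝ) 2) (hr : r ∈ Icc (0 : ℝ) 1) :
    0 ≤ β.scale w r := by
  rcases le_total (1 / 2) r with h | h
  · unfold scale; rw [β.snd_eq w r hw hr h]; simp
  · have h1 := β.scale_mul hw hr
    have h2 := (β.snd_mem w r hw hr).2
    by_contra! h3
    nlinarith

theorem scale_mul_scale {w r : ℝ} (hw : w ∈ Icc (0 : ℝ) 2) (hr : r ∈ Icc (0 : ℝ) 1)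
    (hγ : γ.snd (β.fst w r) (β.snd w r) = r) :
    γ.scale (β.fst w r) (β.snd w r) * β.scale w r = 1 := by
  rcases le_total (1 / 2) r with h | h
  · have := β.snd_eq w r hw hr h
    rw [this] at hγ
    simp [scale, hγ, this]
  · have h1 := β.scale_mul hw hr
    have h2 := γ.scale_mul (β.fst_mem w r hw hr) (β.snd_mem w r hw hr)
    rw [hγ] at h2
    have h3 : 1 - r ≠ 0 := by linarith
    apply mul_right_cancel₀ h3
    rw [mul_assoc, h1, h2, one_mul]

/-- The radial lift of a box map to the product of an interval and a finite-dimensional cube. -/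
def lift (q : J × (C → J)) : J × (C → J) :=
  (⟨1 - β.fst (1 - q.1) (depth q.2), by
      have := β.fst_mem _ _ (one_sub_mem q.1) (depth_mem q.2)
      exact ⟨by linarith [this.2], by linarith [this.1]⟩⟩,
    fun i => ⟨β.scale (1 - q.1) (depth q.2) * q.2 i, by
      have h1 := β.scale_mul (one_sub_mem q.1) (depth_mem q.2)
      have h2 := β.scale_nonneg (one_sub_mem q.1) (depth_mem q.2)
      have h3 := (β.snd_mem _ _ (one_sub_mem q.1) (depth_mem q.2)).1
      have h4 := mul_le_mul_of_nonneg_left (abs_le_one_sub_depth q.2 i) h2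
      rw [mem_Icc, ← abs_le, abs_mul, abs_of_nonneg h2]
      linarith⟩)

theorem continuous_lift : Continuous (β.lift : J × (C → J) → J × (C → J)) := by
  have hq : Continuous fun q : J × (C → J) => ((1 - q.1 : ℝ), depth q.2) :=
    Continuous.prodMk (by fun_prop) (continuous_depth.comp _root_.continuous_snd)
  have h1 := β.continuous_fst.comp hq
  have h2 := β.continuous_snd.comp hq
  have hd : Continuous fun q : J × (C → J) => depth q.2 :=
    continuous_depth.comp _root_.continuous_snd
  refine Continuous.prodMk (Continuous.subtype_mk (continuous_const.sub h1) _)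
    (continuous_pi fun i => Continuous.subtype_mk ?_ _)
  refine Continuous.mul ?_ (by fun_prop)
  refine continuous_const.add ((hd.sub h2).div (by fun_prop) fun q => ?_)
  have : (0 : ℝ) < max (1 - depth q.2) (1 / 2) := lt_max_of_lt_right (by norm_num)
  exact this.ne'

theorem one_sub_lift_fst (q : J × (C → J)) :
    1 - ((β.lift q).1 : ℝ) = β.fst (1 - q.1) (depth q.2) := by
  simp [lift]

theorem depth_lift (q : J × (C → J)) :
    depth (β.lift q).2 = β.snd (1 - q.1) (depth q.2) := by
  have h1 := β.scale_mul (one_sub_mem q.1) (depth_mem q.2)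
  have h2 := β.scale_nonneg (one_sub_mem q.1) (depth_mem q.2)
  have : (fun i => ((β.lift q).2 i : ℝ)) =
      β.scale (1 - q.1) (depth q.2) • fun i => (q.2 i : ℝ) := by
    ext i; simp [lift]
  rw [depth, this, norm_smul, Real.norm_of_nonneg h2]
  have h3 : ‖fun i => (q.2 i : ℝ)‖ = 1 - depth q.2 := by simp [depth]
  rw [h3, h1]; ring

theorem lift_lift (q : J × (C → J))
    (h₁ : ∀ w r, γ.fst (β.fst w r) (β.snd w r) = w)
    (h₂ : ∀ w r, γ.snd (β.fst w r) (β.snd w r) = r) :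
    γ.lift (β.lift q) = q := by
  refine Prod.ext (Subtype.ext ?_) (funext fun i => Subtype.ext ?_)
  · have := γ.one_sub_lift_fst (β.lift q)
    rw [depth_lift, one_sub_lift_fst β, h₁] at this
    linarith
  · change γ.scale (1 - (β.lift q).1) (depth (β.lift q).2) *
      (β.scale (1 - q.1) (depth q.2) * q.2 i) = q.2 i
    rw [one_sub_lift_fst, depth_lift, ← mul_assoc,
      scale_mul_scale β γ (one_sub_mem q.1) (depth_mem q.2) (h₂ _ _), one_mul]

end BoxMap

/-- The radial corner slide as a homeomorphism. -/
def slideHomeo (C : Type*) [Fintype C] (c : ℝ) (hc : 0 < c) (hc' : c ≤ 1 / 4) :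
    J × (C → J) ≃ₜ J × (C → J) where
  toFun := (BoxMap.slide c hc hc').lift
  invFun := (BoxMap.pull c hc hc').lift
  left_inv q := BoxMap.lift_lift _ _ q (fun _ _ => pullFst_slide) fun _ _ => pullSnd_slide
  right_inv q := BoxMap.lift_lift _ _ q (fun _ _ => slideFst_pull) fun _ _ => slideSnd_pull
  continuous_toFun := BoxMap.continuous_lift _
  continuous_invFun := BoxMap.continuous_lift _

end Lift

section InfiniteComposition

open Filter

variable {Y : ℕ → Type*} [∀ n, TopologicalSpace (Y n)]

/-- The first coordinate after `n` steps of a sequence of homeomorphisms, the `n`-th of which acts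
on the first coordinate and on the `n`-th factor. -/
def carry (L : ∀ n, J × Y n ≃ₜ J × Y n) (q : J × ∀ n, Y n) : ℕ → J
  | 0 => q.1
  | n + 1 => (L n (carry L q n, q.2 n)).1

variable (L : ∀ n, J × Y n ≃ₜ J × Y n)

theorem carry_congr {q q' : J × ∀ n, Y n} (h : q.1 = q'.1) (n : ℕ)
    (hn : ∀ k < n, q.2 k = q'.2 k) : carry L q n = carry L q' n := by
  induction n with
  | zero => exact h
  | succ n ih =>
    rw [carry, carry, ih fun k hk => hn k (hk.trans n.lt_succ_self), hn n n.lt_succ_self]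

theorem continuous_carry (n : ℕ) : Continuous fun q : J × ∀ n, Y n => carry L q n := by
  induction n with
  | zero => exact continuous_fst
  | succ n ih => simp only [carry]; fun_prop

theorem exists_carry_eq (n : ℕ) (v : J) (y : ∀ n, Y n) :
    ∃ q : J × ∀ n, Y n, carry L q n = v ∧ ∀ k < n, (L k (carry L q k, q.2 k)).2 = y k := by
  induction n generalizing v with
  | zero => exact ⟨(v, y), rfl, by simp⟩
  | succ n ih =>
    obtain ⟨q, hq, hq'⟩ := ih ((L n).symm (v, y n)).1
    have hc : ∀ k ≤ n, carry L (q.1, Function.update q.2 n ((L n).symm (v, y n)).2) k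
        = carry L q k := fun k hk => by
      refine carry_congr L ?_ k fun j hj => ?_
      · rfl
      · simp [Function.update_of_ne (hj.trans_le hk).ne]
    have hn : L n (carry L (q.1, Function.update q.2 n ((L n).symm (v, y n)).2) n,
        Function.update q.2 n ((L n).symm (v, y n)).2 n) = (v, y n) := by
      rw [hc n le_rfl, hq, Function.update_self, Prod.mk.eta, Homeomorph.apply_symm_apply]
    refine ⟨(q.1, Function.update q.2 n ((L n).symm (v, y n)).2), ?_, fun k hk => ?_⟩
    · rw [carry, hn]
    · rcases (Nat.lt_succ_iff_lt_or_eq.1 hk) with h | rfl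
      · rw [hc k h.le, ← hq' k h]
        dsimp only
        rw [Function.update_of_ne h.ne]
      · rw [hn]

variable {L} in
theorem eq_of_carry_tendsto {M : ℝ} {q q' : J × ∀ n, Y n} {l : ℝ}
    (hL : ∀ n ≥ 1, ∀ w w' y,
      |(((L n).symm (w, y)).1 : ℝ) - ((L n).symm (w', y)).1| ≤ 3 * |(w : ℝ) - w'|)
    (hq : ∀ n, |(carry L q n : ℝ) - l| ≤ M * (1 / 4) ^ n)
    (hq' : ∀ n, |(carry L q' n : ℝ) - l| ≤ M * (1 / 4) ^ n)
    (h : ∀ n, (L n (carry L q n, q.2 n)).2 = (L n (carry L q' n, q'.2 n)).2) : q = q' := by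
  have hback : ∀ (p : J × ∀ n, Y n) n,
      (L n).symm (carry L p (n + 1), (L n (carry L p n, p.2 n)).2) = (carry L p n, p.2 n) :=
    fun p n => by rw [carry, Prod.mk.eta, Homeomorph.symm_apply_apply]
  have hstep : ∀ n ≥ 1, |(carry L q n : ℝ) - carry L q' n| ≤
      3 * |(carry L q (n + 1) : ℝ) - carry L q' (n + 1)| := fun n hn => by
    have := hL n hn (carry L q (n + 1)) (carry L q' (n + 1)) (L n (carry L q n, q.2 n)).2
    rwa [hback q, h n, hback q'] at this
  have hiter : ∀ n ≥ 1, ∀ j, |(carry L q n : ℝ) - carry L q' n| ≤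
      3 ^ j * |(carry L q (n + j) : ℝ) - carry L q' (n + j)| := fun n hn j => by
    induction j with
    | zero => simp
    | succ j ih =>
      refine ih.trans ?_
      rw [pow_succ, mul_assoc]
      exact mul_le_mul_of_nonneg_left (hstep (n + j) (by omega)) (by positivity)
  have heq : ∀ n ≥ 1, carry L q n = carry L q' n := fun n hn => by
    have hb : ∀ j, |(carry L q n : ℝ) - carry L q' n| ≤
        (2 * M * (1 / 4) ^ n) * (3 / 4) ^ j := fun j => by
      refine (hiter n hn j).trans ?_
      have h1 : |(carry L q (n + j) : ℝ) - carry L q' (n + j)| ≤ 2 * (M * (1 / 4) ^ (n + j)) := by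
        have := abs_sub_le (carry L q (n + j) : ℝ) l (carry L q' (n + j))
        rw [abs_sub_comm l] at this
        linarith [hq (n + j), hq' (n + j)]
      refine (mul_le_mul_of_nonneg_left h1 (by positivity)).trans (le_of_eq ?_)
      rw [pow_add, show (3 / 4 : ℝ) = 3 * (1 / 4) by norm_num, mul_pow]; ring
    have hlim : Tendsto (fun j : ℕ => (2 * M * (1 / 4) ^ n) * (3 / 4 : ℝ) ^ j) atTop (𝓝 0) := by
      simpa using (tendsto_pow_atTop_nhds_zero_of_lt_one (by norm_num)
        (by norm_num : (3 / 4 : ℝ) < 1)).const_mul (2 * M * (1 / 4) ^ n)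
    have := ge_of_tendsto' hlim hb
    exact Subtype.ext (sub_eq_zero.1 (abs_nonpos_iff.1 this))
  have hall : ∀ n, (carry L q n, q.2 n) = (carry L q' n, q'.2 n) := fun n => by
    rw [← hback q, ← hback q', h n, heq (n + 1) (by omega)]
  exact Prod.ext (Prod.ext_iff.1 (hall 0)).1 (funext fun n => (Prod.ext_iff.1 (hall n)).2)

variable [∀ n, CompactSpace (Y n)] [∀ n, T2Space (Y n)]

theorem exists_homeomorph_tendsto_carry {M : ℝ}
    (hM : ∀ n p, |((L n p).1 : ℝ) - p.1| ≤ M * (1 / 4) ^ n)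
    (hL : ∀ n ≥ 1, ∀ w w' y,
      |(((L n).symm (w, y)).1 : ℝ) - ((L n).symm (w', y)).1| ≤ 3 * |(w : ℝ) - w'|) :
    ∃ H : (J × ∀ n, Y n) ≃ₜ (J × ∀ n, Y n),
      ∀ q, Tendsto (fun n => carry L q n) atTop (𝓝 (H q).1) := by
  have hstep : ∀ q n, dist (carry L q n) (carry L q (n + 1)) ≤ M * (1 / 4) ^ n := fun q n => by
    rw [dist_comm, Subtype.dist_eq, Real.dist_eq]; exact hM n _
  choose l hl using fun q => cauchySeq_tendsto_of_complete
    (cauchySeq_of_le_geometric (1 / 4) M (by norm_num) (hstep q))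
  have hdist : ∀ q n, |(carry L q n : ℝ) - l q| ≤ (M / (1 - 1 / 4)) * (1 / 4) ^ n := fun q n => by
    have := dist_le_of_le_geometric_of_tendsto (1 / 4) M (by norm_num) (hstep q) (hl q) n
    rw [Subtype.dist_eq, Real.dist_eq] at this
    exact this.trans (le_of_eq (by ring))
  have hpow : Tendsto (fun n : ℕ => (M / (1 - 1 / 4)) * (1 / 4 : ℝ) ^ n) atTop (𝓝 0) := by
    simpa using (tendsto_pow_atTop_nhds_zero_of_lt_one (by norm_num)
      (by norm_num : (1 / 4 : ℝ) < 1)).const_mul (M / (1 - 1 / 4))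
  have hcont : Continuous l := by
    have : TendstoUniformly (fun n q => carry L q n) l atTop := by
      rw [Metric.tendstoUniformly_iff]
      intro ε hε
      filter_upwards [hpow.eventually_lt_const hε] with n hn q
      rw [dist_comm, Subtype.dist_eq, Real.dist_eq]
      exact (hdist q n).trans_lt hn
    exact this.continuous (Frequently.of_forall fun n => continuous_carry L n)
  let f : (J × ∀ n, Y n) → (J × ∀ n, Y n) := fun q => (l q, fun n => (L n (carry L q n, q.2 n)).2)
  have hf : Continuous f := hcont.prodMk <| continuous_pi fun n => by
    have := continuous_carry L n
    fun_prop
  have hinj : Function.Injective f := fun q q' h => by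
    have h1 : l q = l q' := congrArg Prod.fst h
    refine eq_of_carry_tendsto hL (hdist q) (h1 ▸ hdist q') fun n => ?_
    exact congrFun (congrArg Prod.snd h) n
  have hsurj : Function.Surjective f := by
    rintro ⟨v, y⟩
    choose q hq hq' using fun n => exists_carry_eq L n v y
    have hlim : Tendsto (fun n => f (q n)) atTop (𝓝 (v, y)) := by
      refine Tendsto.prodMk_nhds ?_ (tendsto_pi_nhds.2 fun k => ?_)
      · rw [tendsto_iff_dist_tendsto_zero]
        refine squeeze_zero (fun _ => dist_nonneg) (fun n => ?_) hpow
        have := hdist (q n) n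
        rwa [hq n, abs_sub_comm, ← Real.dist_eq, ← Subtype.dist_eq] at this
      · refine tendsto_const_nhds.congr' ?_
        filter_upwards [eventually_gt_atTop k] with n hn
        exact (hq' n k hn).symm
    have hcl : IsClosed (range f) := (isCompact_range hf).isClosed
    exact hcl.mem_of_tendsto hlim (Eventually.of_forall fun n => mem_range_self _)
  exact ⟨hf.homeoOfEquivCompactToT2 (f := Equiv.ofBijective f ⟨hinj, hsurj⟩), hl⟩

end InfiniteComposition

theorem one_add_mul_pos {p : ℝ} (hp : |p| < 1) (x : J) : 0 < 1 + p * x := by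
  have h1 : |p * x| < 1 := by
    rw [abs_mul]
    nlinarith [abs_nonneg p, abs_le.2 x.2, abs_nonneg (x : ℝ)]
  linarith [(abs_lt.1 h1).1]

/-- The right endpoint of `[-1, 1]`. -/
def endpoint : J := ⟨1, by norm_num, le_rfl⟩

/-- The hyperbolic translation of `[-1, 1]` taking `0` to `p`. -/
def mob (p : ℝ) (x : J) : J := projIcc (-1) 1 (by norm_num) ((x + p) / (1 + p * x))

theorem coe_mob {p : ℝ} (hp : |p| < 1) (x : J) : (mob p x : ℝ) = (x + p) / (1 + p * x) := by
  have h := one_add_mul_pos hp x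
  obtain ⟨h1, h2⟩ := abs_lt.1 hp
  obtain ⟨h3, h4⟩ := x.2
  have hm : (x + p) / (1 + p * x) ∈ Icc (-1 : ℝ) 1 := by
    refine ⟨?_, ?_⟩
    · rw [le_div_iff₀ h]; nlinarith
    · rw [div_le_iff₀ h]; nlinarith
  rw [mob, projIcc_of_mem _ hm]

theorem mob_neg_mob {p : ℝ} (hp : |p| < 1) (x : J) : mob (-p) (mob p x) = x := by
  have hp' : |-p| < 1 := by rwa [abs_neg]
  have h := one_add_mul_pos hp x
  have h' := one_add_mul_pos hp' (mob p x)
  apply Subtype.ext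
  rw [coe_mob hp', div_eq_iff h'.ne', coe_mob hp]
  linear_combination div_mul_cancel₀ ((x : ℝ) + p) h.ne'

theorem mob_mob_neg {p : ℝ} (hp : |p| < 1) (x : J) : mob p (mob (-p) x) = x := by
  simpa using mob_neg_mob (p := -p) (by rwa [abs_neg]) x

theorem continuous_mob {X : Type*} [TopologicalSpace X] {p : X → ℝ} {y : X → J}
    (hp : Continuous p) (hp1 : ∀ x, |p x| < 1) (hy : Continuous y) :
    Continuous fun x => mob (p x) (y x) := by
  refine continuous_projIcc.comp (Continuous.div (by fun_prop) (by fun_prop) fun x => ?_)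
  exact (one_add_mul_pos (hp1 x) (y x)).ne'

/-- Hyperbolic translation as a homeomorphism. -/
def mobHomeo (p : ℝ) (hp : |p| < 1) : J ≃ₜ J where
  toFun := mob p
  invFun := mob (-p)
  left_inv := mob_neg_mob hp
  right_inv := mob_mob_neg hp
  continuous_toFun := continuous_mob continuous_const (fun _ => hp) continuous_id
  continuous_invFun :=
    continuous_mob continuous_const (fun _ => by rwa [abs_neg]) continuous_id

/-- The reflection of `[-1, 1]`. -/
def flipHomeo : J ≃ₜ J where
  toFun x := ⟨-x, by linarith [x.2.2], by linarith [x.2.1]⟩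
  invFun x := ⟨-x, by linarith [x.2.2], by linarith [x.2.1]⟩
  left_inv x := by simp
  right_inv x := by simp
  continuous_toFun := by fun_prop
  continuous_invFun := by fun_prop

/-- The homeomorphism of `[-1, 1]` expanding away from `0`, with expansion parameter `K`. -/
def expandHomeo (K : ℝ) (hK : 0 ≤ K) : J ≃ₜ J where
  toFun x := ⟨x * (1 + K) / (1 + K * |(x : ℝ)|), by
    have h1 := abs_le.2 x.2
    have h2 := abs_nonneg (x : ℝ)
    have h3 : 0 < 1 + K * |(x : ℝ)| := by positivity
    rw [mem_Icc, ← abs_le, abs_div, abs_mul, abs_of_pos h3, abs_of_pos (by linarith : 0 < 1 + K),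
      div_le_one h3]
    nlinarith⟩
  invFun x := ⟨x / (1 + K - K * |(x : ℝ)|), by
    have h1 := abs_le.2 x.2
    have h2 := abs_nonneg (x : ℝ)
    have h3 : 0 < 1 + K - K * |(x : ℝ)| := by nlinarith
    rw [mem_Icc, ← abs_le, abs_div, abs_of_pos h3, div_le_one h3]
    nlinarith⟩
  left_inv x := by
    have h1 := abs_le.2 x.2
    have h2 := abs_nonneg (x : ℝ)
    have h3 : 0 < 1 + K * |(x : ℝ)| := by positivity
    have h4 : (1 + K) ≠ 0 := by positivity
    apply Subtype.ext
    simp only [abs_div, abs_mul, abs_of_pos h3, abs_of_pos (by linarith : 0 < 1 + K)]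
    have h5 : 1 + K - K * (|(x : ℝ)| * (1 + K) / (1 + K * |(x : ℝ)|)) =
        (1 + K) / (1 + K * |(x : ℝ)|) := by field_simp; ring
    rw [h5]; field_simp
  right_inv x := by
    have h1 := abs_le.2 x.2
    have h2 := abs_nonneg (x : ℝ)
    have h3 : 0 < 1 + K - K * |(x : ℝ)| := by nlinarith
    have h4 : (1 + K) ≠ 0 := by positivity
    apply Subtype.ext
    simp only [abs_div, abs_of_pos h3]
    have h5 : 1 + K * (|(x : ℝ)| / (1 + K - K * |(x : ℝ)|)) =
        (1 + K) / (1 + K - K * |(x : ℝ)|) := by field_simp; ring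
    rw [h5]; field_simp
  continuous_toFun := by
    refine Continuous.subtype_mk (Continuous.div (by fun_prop) (by fun_prop) fun x => ?_) _
    have := abs_nonneg (x : ℝ)
    positivity
  continuous_invFun := by
    refine Continuous.subtype_mk (Continuous.div (by fun_prop) (by fun_prop) fun x => ?_) _
    have h1 := abs_le.2 x.2
    nlinarith

theorem exists_expandHomeo {ε δ : ℝ} (hε : 0 < ε) (hδ : 0 < δ) :
    ∃ g : J ≃ₜ J, ∀ x : J, ε ≤ |(x : ℝ)| → 1 - δ ≤ |(g x : ℝ)| := by
  refine ⟨expandHomeo (1 / (ε * δ)) (by positivity), fun x hx => ?_⟩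
  change _ ≤ |(x : ℝ) * (1 + 1 / (ε * δ)) / (1 + 1 / (ε * δ) * |(x : ℝ)|)|
  have h1 := abs_le.2 x.2
  have h2 : 0 < |(x : ℝ)| := hε.trans_le hx
  set K := 1 / (ε * δ) with hK
  have hKpos : 0 < K := by positivity
  have h3 : 0 < 1 + K * |(x : ℝ)| := by positivity
  rw [abs_div, abs_mul, abs_of_pos h3, abs_of_pos (by linarith : 0 < 1 + K), le_div_iff₀ h3]
  have h4 : 1 ≤ δ * (K * |(x : ℝ)|) := by
    have : δ * (K * ε) = 1 := by rw [hK]; field_simp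
    calc 1 = δ * (K * ε) := this.symm
      _ ≤ δ * (K * |(x : ℝ)|) := by gcongr
  nlinarith

section FirstStep

variable (C : Type*) [Fintype C]

/-- The slide at the corner opposite to the one used by `slideHomeo`. -/
def flippedSlide : J × (C → J) ≃ₜ J × (C → J) :=
  ((flipHomeo.prodCongr (Homeomorph.refl _)).trans
    (slideHomeo C (1 / 4) (by norm_num) le_rfl).symm).trans
    (flipHomeo.prodCongr (Homeomorph.refl _))

theorem one_add_flippedSlide (q : J × (C → J)) :
    1 + ((flippedSlide C q).1 : ℝ) = pullFst (1 / 4) (1 + q.1) (depth q.2) := by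
  have := BoxMap.one_sub_lift_fst (BoxMap.pull (1 / 4) (by norm_num) le_rfl)
    (flipHomeo q.1, q.2)
  have h2 : 1 - ((flipHomeo q.1 : J) : ℝ) = 1 + q.1 := by simp [flipHomeo]
  rw [h2] at this
  change _ = pullFst (1 / 4) _ _ at this
  rw [← this]
  change 1 + -(_ : ℝ) = _
  rw [← sub_eq_add_neg]
  rfl

theorem abs_pushAway : |(112 / 113 : ℝ)| < 1 := by rw [abs_lt]; norm_num

/-- A homeomorphism that takes every point whose second coordinate is close to the boundary of
the cube to a point whose first coordinate is close to `1`. -/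
def pushAway : J × (C → J) ≃ₜ J × (C → J) :=
  (flippedSlide C).trans ((mobHomeo (112 / 113) abs_pushAway).prodCongr (Homeomorph.refl _))

variable {C}

theorem one_sub_pushAway_le {q : J × (C → J)} (hq : depth q.2 ≤ 1 / 16) :
    1 - ((pushAway C q).1 : ℝ) ≤ 1 / 8 := by
  have h1 := one_add_flippedSlide C q
  have h2 : 1 / 8 ≤ pullFst (1 / 4) (1 + q.1) (depth q.2) := by
    have := le_pullFst (c := 1 / 4) (by linarith [q.1.2.1] : 0 ≤ 1 + (q.1 : ℝ))
      (depth_mem q.2).1 (by linarith)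
    linarith
  change 1 - ((mob (112 / 113) (flippedSlide C q).1 : J) : ℝ) ≤ _
  have h3 := one_add_mul_pos abs_pushAway (flippedSlide C q).1
  rw [coe_mob abs_pushAway, sub_le_comm, le_div_iff₀ h3]
  linarith

end FirstStep

/-- The sequence of slides whose infinite composition moves a product of thin collars to a face. -/
def slideSeq (C : ℕ → Type*) [∀ n, Fintype (C n)] : ∀ n, J × (C n → J) ≃ₜ J × (C n → J)
  | 0 => pushAway (C 0)
  | n + 1 => slideHomeo (C (n + 1)) ((1 / 4) ^ (n + 1)) (by positivity)
      (pow_le_of_le_one (by norm_num) (by norm_num) n.succ_ne_zero)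

theorem exists_homeomorph_to_face (C : ℕ → Type*) [∀ n, Fintype (C n)] :
    ∃ H : (J × ∀ n, C n → J) ≃ₜ (J × ∀ n, C n → J),
      ∀ q, (∀ n, depth (q.2 n) ≤ (1 / 4) ^ (n + 2)) → (H q).1 = endpoint := by
  obtain ⟨H, hH⟩ := exists_homeomorph_tendsto_carry (slideSeq C) (M := 2)
    (by
      rintro (_ | n) p
      · have h1 := (slideSeq C 0 p).1.2
        have h2 := p.1.2
        simp only [mem_Icc] at h1 h2
        rw [abs_le]; constructor <;> norm_num <;> linarith [h1.1, h2.1, h1.2, h2.2]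
      · have h := abs_slideFst_sub_le (c := (1 / 4) ^ (n + 1)) (w := 1 - p.1) (depth_mem p.2).1
          (by positivity)
        have h2 := BoxMap.one_sub_lift_fst (BoxMap.slide ((1 / 4) ^ (n + 1)) (by positivity)
          (pow_le_of_le_one (by norm_num) (by norm_num) n.succ_ne_zero)) p
        change 1 - ((slideSeq C (n + 1) p).1 : ℝ) = slideFst _ _ _ at h2
        rw [← h2] at h
        have h3 : (0 : ℝ) < (1 / 4) ^ (n + 1) := by positivity
        rw [abs_sub_comm]
        refine le_trans (le_of_eq ?_) (h.trans (by linarith))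
        congr 1; ring)
    (by
      rintro (_ | n) hn w w' y
      · omega
      · have h := pullFst_lipschitz (c := (1 / 4) ^ (n + 1)) (w := 1 - w) (w' := 1 - w')
          (r := depth y)
        have h2 := fun v : J => BoxMap.one_sub_lift_fst (BoxMap.pull ((1 / 4) ^ (n + 1))
          (by positivity) (pow_le_of_le_one (by norm_num) (by norm_num) n.succ_ne_zero)) (v, y)
        change ∀ v : J, 1 - (((slideSeq C (n + 1)).symm (v, y)).1 : ℝ) =
          pullFst _ (1 - v) (depth y) at h2
        rw [← h2, ← h2, sub_sub_sub_cancel_left, sub_sub_sub_cancel_left, abs_sub_comm,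
          abs_sub_comm (w' : ℝ)] at h
        exact h)
  refine ⟨H, fun q hq => ?_⟩
  have key : ∀ n, 1 - (carry (slideSeq C) q (n + 1) : ℝ) ≤ (1 / 4) ^ (n + 1) / 2 := fun n => by
    induction n with
    | zero =>
      refine (one_sub_pushAway_le (q := (q.1, q.2 0)) ?_).trans (by norm_num)
      exact (hq 0).trans (by norm_num)
    | succ n ih =>
      have h2 := BoxMap.one_sub_lift_fst (BoxMap.slide ((1 / 4) ^ (n + 1)) (by positivity)
          (pow_le_of_le_one (by norm_num) (by norm_num) n.succ_ne_zero))
          (carry (slideSeq C) q (n + 1), q.2 (n + 1))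
      change 1 - (carry (slideSeq C) q (n + 1 + 1) : ℝ) = slideFst _ _ _ at h2
      rw [h2]
      refine (slideFst_le (one_sub_mem _).1 (depth_mem _).1 ih).trans ((hq (n + 1)).trans ?_)
      have : (0 : ℝ) < (1 / 4) ^ (n + 1 + 1) := by positivity
      rw [show n + 1 + 2 = (n + 1 + 1) + 1 by ring, pow_succ]
      linarith
  have h1 : Filter.Tendsto (fun n => (1 / 4 : ℝ) ^ (n + 1) / 2) Filter.atTop (𝓝 0) := by
    simpa using ((Filter.tendsto_add_atTop_iff_nat 1).2
      (tendsto_pow_atTop_nhds_zero_of_lt_one (by norm_num)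
        (by norm_num : (1 / 4 : ℝ) < 1))).div_const 2
  have h2 : Filter.Tendsto (fun n => 1 - (carry (slideSeq C) q (n + 1) : ℝ)) Filter.atTop
      (𝓝 (1 - ((H q).1 : ℝ))) :=
    tendsto_const_nhds.sub ((continuous_subtype_val.tendsto _).comp
      ((Filter.tendsto_add_atTop_iff_nat 1).2 (hH q)))
  have h3 := le_of_tendsto_of_tendsto' h2 h1 key
  exact Subtype.ext (le_antisymm (H q).1.2.2 (show (1 : ℝ) ≤ _ by linarith))

section Triangular

variable {A : Type*}

theorem exists_triangular_homeomorph {r : A → A → Prop} (hr : WellFounded r)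
    (p : A → (A → J) → ℝ) (hp : ∀ i, Continuous (p i)) (hp1 : ∀ i x, |p i x| < 1)
    (hdep : ∀ i x y, (∀ j, r j i → x j = y j) → p i x = p i y) :
    ∃ Ψ : (A → J) ≃ₜ (A → J), ∀ x i, Ψ x i = mob (-p i x) (x i) := by
  classical
  have hp1' : ∀ i x, |-p i x| < 1 := fun i x => by rw [abs_neg]; exact hp1 i x
  let f : (A → J) → A → J := fun x i => mob (-p i x) (x i)
  have hf : Continuous f := continuous_pi fun i =>
    continuous_mob (hp i).neg (hp1' i) (continuous_apply i)
  have hinj : Function.Injective f := fun x y h => by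
    funext i
    induction i using hr.induction with
    | _ i ih =>
      have h1 : mob (-p i x) (x i) = mob (-p i y) (y i) := congrFun h i
      rw [← mob_mob_neg (hp1 i x) (x i), h1, hdep i x y ih, mob_mob_neg (hp1 i y)]
  have hsurj : Function.Surjective f := fun y => by
    let step : ∀ i, (∀ j, r j i → J) → J := fun i g =>
      mob (p i fun j => if h : r j i then g j h else endpoint) (y i)
    refine ⟨hr.fix step, funext fun i => ?_⟩
    have h1 : hr.fix step i = mob (p i (hr.fix step)) (y i) := by
      rw [hr.fix_eq]
      change mob (p i fun j => if h : r j i then hr.fix step j else endpoint) (y i) = _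
      rw [hdep i _ (hr.fix step) fun j hj => by simp [hj]]
    change mob (-p i (hr.fix step)) (hr.fix step i) = y i
    rw [h1, mob_neg_mob (hp1 i _)]
  exact ⟨hf.homeoOfEquivCompactToT2 (f := Equiv.ofBijective f ⟨hinj, hsurj⟩), fun _ _ => rfl⟩

end Triangular

section Blocks

variable {A : Type u} {τ : Cardinal.{u}} {Z : Set (A → J)}

/-- A closed set that can be avoided by self-maps of the cube fixing any prescribed set of fewer
than `τ` coordinates. -/
def Avoidable (τ : Cardinal.{u}) (Z : Set (A → J)) : Prop :=
  IsClosed Z ∧ ∀ B : Set A, Cardinal.mk B < τ →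
    ∃ f : (A → J) → A → J, Continuous f ∧ (∀ x, ∀ b ∈ B, f x b = x b) ∧ ∀ x, f x ∉ Z

theorem le_abs_mob_neg {p ε : ℝ} (hp : |p| < 1) {x : J} (h : 2 * ε ≤ |(x : ℝ) - p|) :
    ε ≤ |(mob (-p) x : ℝ)| := by
  have hp' : |-p| < 1 := by rwa [abs_neg]
  have h1 := one_add_mul_pos hp' x
  have h2 : 1 + -p * (x : ℝ) ≤ 2 := by
    have h3 := abs_le.2 x.2
    have := (abs_le.1 (show |p * (x : ℝ)| ≤ 1 by
      rw [abs_mul]; nlinarith [abs_nonneg p, abs_nonneg (x : ℝ)])).1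
    linarith
  rw [coe_mob hp', abs_div, abs_of_pos h1, le_div_iff₀ h1, ← sub_eq_add_neg]
  rcases le_or_gt ε 0 with h0 | h0
  · nlinarith [abs_nonneg ((x : ℝ) - p)]
  · nlinarith

theorem Avoidable.exists_shift (hZ : Avoidable τ Z) {B : Set A} (hB : Cardinal.mk B < τ) :
    ∃ (C : Finset A) (p : A → (A → J) → ℝ) (ε : ℝ), 0 < ε ∧ (∀ i ∈ C, i ∉ B) ∧
      (∀ i, Continuous (p i)) ∧ (∀ i x, |p i x| < 1) ∧
      (∀ i x y, (∀ b ∈ B, x b = y b) → p i x = p i y) ∧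
      ∀ z ∈ Z, ∃ i ∈ C, ε ≤ |(mob (-p i z) (z i) : ℝ)| := by
  classical
  obtain ⟨hcl, hZ⟩ := hZ
  obtain ⟨f, hf, hfB, hfZ⟩ := hZ B hB
  let s : (A → J) → A → J := fun x => f fun i => if i ∈ B then x i else endpoint
  have hs : Continuous s := hf.comp <| continuous_pi fun i => by
    by_cases h : i ∈ B
    · simpa [h] using continuous_apply i
    · simpa [h] using continuous_const
  have hsB : ∀ x, ∀ b ∈ B, s x b = x b := fun x b hb => by
    simp only [s]; rw [hfB _ b hb, if_pos hb]
  have hsc : ∀ x y, (∀ b ∈ B, x b = y b) → s x = s y := fun x y h => by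
    have : (fun i => if i ∈ B then x i else endpoint) = fun i => if i ∈ B then y i else endpoint :=
      funext fun i => by split_ifs with hi <;> simp [h, hi]
    simp only [s, this]
  let U : A × ℕ → Set (A → J) := fun k => {z | 1 / ((k.2 : ℝ) + 1) < |(z k.1 : ℝ) - s z k.1|}
  have hU : ∀ k, IsOpen (U k) := fun k => isOpen_lt continuous_const (by fun_prop)
  have hcov : Z ⊆ ⋃ k, U k := fun z hz => by
    have hne : s z ≠ z := fun h => hfZ _ (show s z ∈ Z from h.symm ▸ hz)
    obtain ⟨i, hi⟩ := Function.ne_iff.1 hne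
    have hpos : 0 < |(z i : ℝ) - s z i| :=
      abs_pos.2 (sub_ne_zero.2 fun h => hi (Subtype.ext h.symm))
    obtain ⟨n, hn⟩ := exists_nat_one_div_lt hpos
    exact mem_iUnion.2 ⟨(i, n), hn⟩
  obtain ⟨t, ht⟩ := hcl.isCompact.elim_finite_subcover U hU hcov
  obtain ⟨N, hN⟩ : ∃ N : ℕ, ∀ k ∈ t, k.2 ≤ N :=
    ⟨t.sup Prod.snd, fun k hk => Finset.le_sup (f := Prod.snd) hk⟩
  have hε : (0 : ℝ) < 1 / ((N : ℝ) + 1) := by positivity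
  have hε1 : 1 / ((N : ℝ) + 1) ≤ 1 := by
    rw [div_le_one (by positivity)]; linarith [(Nat.cast_nonneg N : (0 : ℝ) ≤ N)]
  set ε := 1 / ((N : ℝ) + 1) with hεdef
  have hp1 : ∀ i x, |(1 - ε / 2) * (s x i : ℝ)| < 1 := fun i x => by
    rw [abs_mul, abs_of_nonneg (by linarith)]
    nlinarith [abs_le.2 (s x i).2, abs_nonneg (s x i : ℝ)]
  refine ⟨(t.image Prod.fst).filter (· ∉ B), fun i x => (1 - ε / 2) * (s x i : ℝ), ε / 4,
    by linarith, fun i hi => (Finset.mem_filter.1 hi).2, fun i => by fun_prop, hp1,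
    fun i x y h => by simp only [hsc x y h], fun z hz => ?_⟩
  obtain ⟨k, hk, hzk⟩ := mem_iUnion₂.1 (ht hz)
  have h1 : ε ≤ 1 / ((k.2 : ℝ) + 1) := by
    have : (k.2 : ℝ) ≤ N := by exact_mod_cast hN k hk
    rw [hεdef]; gcongr
  have h2 : ε < |(z k.1 : ℝ) - s z k.1| := h1.trans_lt hzk
  refine ⟨k.1, Finset.mem_filter.2 ⟨Finset.mem_image_of_mem _ hk, fun hB => ?_⟩,
    le_abs_mob_neg (hp1 _ _) ?_⟩
  · rw [hsB z _ hB, sub_self, abs_zero] at h2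
    linarith
  · have h3 := abs_sub_abs_le_abs_sub ((z k.1 : ℝ) - s z k.1) (-(ε / 2 * s z k.1))
    have h4 : |-(ε / 2 * (s z k.1 : ℝ))| ≤ ε / 2 := by
      rw [abs_neg, abs_mul, abs_of_pos (by linarith)]
      nlinarith [abs_le.2 (s z k.1).2]
    rw [show (z k.1 : ℝ) - (1 - ε / 2) * s z k.1 = z k.1 - s z k.1 - -(ε / 2 * s z k.1) by ring]
    linarith

theorem exists_wellFounded_choice {D : Type*} {r : A → A → Prop} (hr : WellFounded r)
    (block : D → Set A) (P : Set A → A → D → Prop) (h : ∀ B a, ∃ d, P B a d) :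
    ∃ d : A → D, ∀ a, P {i | ∃ b, r b a ∧ i ∈ block (d b)} a (d a) := by
  choose c hc using h
  let step : ∀ a, (∀ b, r b a → D) → D := fun a g =>
    c {i | ∃ b, ∃ hb : r b a, i ∈ block (g b hb)} a
  refine ⟨hr.fix step, fun a => ?_⟩
  have : hr.fix step a = c {i | ∃ b, r b a ∧ i ∈ block (hr.fix step b)} a := by
    rw [hr.fix_eq]
    simp only [step, exists_prop]
  rw [this]
  exact hc _ _

/-- Currying of families indexed by a sigma type. -/
def homeomorphCurry (C : A → Type*) : ((Σ a, C a) → J) ≃ₜ ∀ a, C a → J where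
  toEquiv := Equiv.piCurry fun _ _ => J
  continuous_toFun := continuous_pi fun _ => continuous_pi fun _ => continuous_apply _
  continuous_invFun := continuous_pi fun s =>
    (continuous_apply s.2).comp (continuous_apply s.1)

/-- The data of one step of the recursion: a coordinate `lead`, finitely many further coordinates
`tail`, and translation amounts `shift`. -/
structure Step (A : Type u) where
  /-- The coordinate that stays free. -/
  lead : A
  /-- The finitely many coordinates to be moved near the ends. -/
  tail : Finset A
  /-- The amounts by which the coordinates are translated. -/
  shift : A → (A → J) → ℝ
  /-- The size of the translated coordinates. -/
  gap : ℝ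

/-- The coordinates used by a step. -/
def Step.block (d : Step A) : Set A := insert d.lead (d.tail : Set A)

/-- A step is admissible for `Z`, given the set `B` of coordinates used before and a coordinate `a`
that has to be used. -/
structure Step.Admissible (Z : Set (A → J)) (B : Set A) (a : A) (d : Step A) : Prop where
  lead_notMem_tail : d.lead ∉ d.tail
  mem : a ∈ B ∪ d.block
  disjoint : Disjoint B d.block
  gap_pos : 0 < d.gap
  continuous_shift : ∀ i, Continuous (d.shift i)
  abs_shift_lt : ∀ i x, |d.shift i x| < 1
  shift_congr : ∀ i x y, (∀ b ∈ B, x b = y b) → d.shift i x = d.shift i y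
  le_abs : ∀ z ∈ Z, ∃ i ∈ d.tail, d.gap ≤ |(mob (-d.shift i z) (z i) : ℝ)|

theorem Avoidable.exists_step (hτ : Cardinal.aleph0 < τ) (hA : Cardinal.mk A = τ)
    (hZ : Avoidable τ Z) {B : Set A} (hB : Cardinal.mk B < τ) (a : A) :
    ∃ d : Step A, d.Admissible Z B a := by
  obtain ⟨C, p, ε, hε, hCB, hpc, hp1, hpB, hC⟩ := hZ.exists_shift hB
  have hw : ∃ w, w ∉ B ∧ w ∉ C ∧ (a ∈ B ∨ a ∈ C ∨ a = w) := by
    by_cases ha : a ∈ B ∨ a ∈ C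
    · have hne : B ∪ (C : Set A) ≠ univ := fun h => by
        have h1 := Cardinal.mk_union_le B (C : Set A)
        have h2 : Cardinal.mk B + Cardinal.mk (C : Set A) < τ :=
          Cardinal.add_lt_of_lt hτ.le hB ((C.finite_toSet.lt_aleph0).trans hτ)
        rw [h, Cardinal.mk_univ, hA] at h1
        exact absurd h1 (not_le.2 h2)
      obtain ⟨w, hw⟩ := (ne_univ_iff_exists_notMem _).1 hne
      rw [mem_union, not_or] at hw
      exact ⟨w, hw.1, by simpa using hw.2, ha.imp_right Or.inl⟩
    · rw [not_or] at ha
      exact ⟨a, ha.1, ha.2, Or.inr (Or.inr rfl)⟩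
  obtain ⟨w, hwB, hwC, ha⟩ := hw
  refine ⟨⟨w, C, p, ε⟩, hwC, ?_, ?_, hε, hpc, hp1, hpB, hC⟩
  · rcases ha with h | h | h
    · exact Or.inl h
    · exact Or.inr (Or.inr h)
    · exact Or.inr (Or.inl h)
  · rw [Set.disjoint_right]
    rintro i (rfl | hi)
    · exact hwB
    · exact hCB i hi

theorem exists_sequence_of_steps (hτ : Cardinal.aleph0 < τ) (hA : Cardinal.mk A = τ)
    (hZ : Avoidable τ Z) :
    ∃ (r : A → A → Prop) (_ : IsWellOrder A r) (d : A → Step A),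
      ∀ a, (d a).Admissible Z {i | ∃ b, r b a ∧ i ∈ (d b).block} a := by
  obtain ⟨r, hr, hord⟩ := Cardinal.exists_ord_eq A
  have hne : Nonempty A := Cardinal.mk_ne_zero_iff.1 (hA ▸ (Cardinal.aleph0_pos.trans hτ).ne')
  have hD : Nonempty (Step A) := ⟨⟨Classical.arbitrary A, ∅, fun _ _ => 0, 0⟩⟩
  obtain ⟨d, hd⟩ := exists_wellFounded_choice hr.wf Step.block
    (fun B a d => Cardinal.mk B < τ → d.Admissible Z B a) (fun B a => by
      by_cases hB : Cardinal.mk B < τ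
      · exact (hZ.exists_step hτ hA hB a).imp fun _ h _ => h
      · exact ⟨Classical.arbitrary _, fun h => absurd h hB⟩)
  refine ⟨r, hr, d, fun a => hd a ?_⟩
  have hinit : Cardinal.mk {b // r b a} < τ := by
    rw [← hA]
    exact Cardinal.card_typein_lt a hord
  have hsub : {i | ∃ b, r b a ∧ i ∈ (d b).block} = ⋃ b : {b // r b a}, (d b).block := by
    ext i; simp
  rw [hsub]
  refine (Cardinal.mk_iUnion_le _).trans_lt (Cardinal.mul_lt_of_lt hτ.le hinit ?_)
  refine (ciSup_le' fun b => ?_).trans_lt hτ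
  exact (((d b).tail.finite_toSet.insert _).lt_aleph0).le

theorem exists_block_homeomorph (hτ : Cardinal.aleph0 < τ) (hA : Cardinal.mk A = τ)
    (hZ : Avoidable τ Z) :
    ∃ (C : A → Finset A) (ε : A → ℝ) (_ : A ⊕ (Σ a, C a) ≃ A)
      (G : (A → J) ≃ₜ (A → J) × ∀ a, C a → J), (∀ a, 0 < ε a) ∧
        ∀ z ∈ Z, ∀ a, ∃ i : C a, ε a ≤ |((G z).2 a i : ℝ)| := by
  obtain ⟨r, hr, d, hd⟩ := exists_sequence_of_steps hτ hA hZ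
  let f : A ⊕ (Σ a, (d a).tail) → A := Sum.elim (fun a => (d a).lead) fun s => s.2
  let rk : A ⊕ (Σ a, (d a).tail) → A := Sum.elim id Sigma.fst
  have hmem : ∀ s, f s ∈ (d (rk s)).block := by
    rintro (a | ⟨a, i⟩)
    · exact Or.inl rfl
    · exact Or.inr i.2
  have hlt : ∀ s t, r (rk s) (rk t) → f s ≠ f t := fun s t h he =>
    Set.disjoint_left.1 (hd (rk t)).disjoint ⟨rk s, h, hmem s⟩ (he ▸ hmem t)
  have hinj : Function.Injective f := fun s t h => by
    rcases trichotomous_of r (rk s) (rk t) with h1 | h1 | h1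
    · exact absurd h (hlt s t h1)
    · obtain a | ⟨a, i⟩ := s <;> obtain b | ⟨b, j⟩ := t <;> obtain rfl : a = b := h1
      · rfl
      · exact absurd (show (d a).lead ∈ (d a).tail from (show (d a).lead = j from h) ▸ j.2)
          (hd a).lead_notMem_tail
      · exact absurd (show (d a).lead ∈ (d a).tail from (show (d a).lead = i from h.symm) ▸ i.2)
          (hd a).lead_notMem_tail
      · rw [Subtype.ext (show (i : A) = j from h)]
    · exact absurd h.symm (hlt t s h1)
  have hblock : ∀ b, ∀ i ∈ (d b).block, ∃ s, rk s = b ∧ f s = i := by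
    rintro b i (rfl | hi)
    · exact ⟨Sum.inl b, rfl, rfl⟩
    · exact ⟨Sum.inr ⟨b, i, hi⟩, rfl, rfl⟩
  have hsurj : Function.Surjective f := fun a => by
    rcases (hd a).mem with ⟨b, -, hb⟩ | hb
    · exact (hblock b a hb).imp fun _ => And.right
    · exact (hblock a a hb).imp fun _ => And.right
  let e : A ⊕ (Σ a, (d a).tail) ≃ A := Equiv.ofBijective f ⟨hinj, hsurj⟩
  let P : A ⊕ (Σ a, (d a).tail) → (A → J) → ℝ :=
    Sum.elim (fun _ _ => 0) fun s => (d s.1).shift s.2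
  obtain ⟨Ψ, hΨ⟩ := exists_triangular_homeomorph
    (InvImage.wf (fun i => rk (e.symm i)) hr.wf) (fun i => P (e.symm i))
    (fun i => by
      rcases e.symm i with a | s
      · exact continuous_const
      · exact (hd s.1).continuous_shift _)
    (fun i x => by
      rcases e.symm i with a | s
      · simp [P]
      · exact (hd s.1).abs_shift_lt _ x)
    (fun i x y h => by
      change ∀ j, r (rk (e.symm j)) (rk (e.symm i)) → x j = y j at h
      generalize e.symm i = t at h
      rcases t with a | s
      · rfl
      · refine (hd s.1).shift_congr _ x y ?_
        rintro j ⟨b, hb, hj⟩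
        obtain ⟨s', rfl, rfl⟩ := hblock b j hj
        refine h _ ?_
        have : e.symm (f s') = s' := e.symm_apply_apply s'
        rwa [this])
  refine ⟨fun a => (d a).tail, fun a => (d a).gap, e,
    Ψ.trans (((Homeomorph.piCongrLeft (Y := fun _ => J) e).symm.trans
      Homeomorph.sumArrowHomeomorphProdArrow).trans
        ((Homeomorph.refl _).prodCongr
          (homeomorphCurry fun a => (d a).tail))), fun a => (hd a).gap_pos,
    fun z hz a => ?_⟩
  obtain ⟨i, hi, h⟩ := (hd a).le_abs z hz
  refine ⟨⟨i, hi⟩, ?_⟩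
  change _ ≤ |((Ψ z (e (Sum.inr ⟨a, i, hi⟩)) : J) : ℝ)|
  rw [hΨ, Equiv.symm_apply_apply]
  exact h

end Blocks

section Face

variable {A : Type u} {τ : Cardinal.{u}} {Z : Set (A → J)}

/-- Regrouping of the factors of a product along a bijection `A × ℕ ≃ A`. -/
def regroup (Y : A → Type*) [∀ b, TopologicalSpace (Y b)] (φ : A × ℕ ≃ A) :
    (A → J) × (∀ b, Y b) ≃ₜ ∀ a, J × ∀ n, Y (φ (a, n)) where
  toFun q a := (q.1 a, fun n => q.2 (φ (a, n)))
  invFun g := (fun a => (g a).1, Homeomorph.piCongrLeft φ fun s : A × ℕ => (g s.1).2 s.2)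
  left_inv q := Prod.ext rfl <|
    (Homeomorph.piCongrLeft (Y := Y) φ).apply_symm_apply q.2
  right_inv g := funext fun a => Prod.ext rfl <| funext fun n =>
    congrFun ((Homeomorph.piCongrLeft (Y := Y) φ).symm_apply_apply fun s => (g s.1).2 s.2) (a, n)
  continuous_toFun := by fun_prop
  continuous_invFun := by
    refine Continuous.prodMk (by fun_prop) ((Homeomorph.continuous _).comp ?_)
    exact continuous_pi fun s =>
      (continuous_apply s.2).comp (continuous_snd.comp (continuous_apply s.1))

theorem exists_homeomorph_to_face_pi (C : A → Type*) [∀ a, Fintype (C a)] (φ : A × ℕ ≃ A) :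
    ∃ K : (A → J) × (∀ a, C a → J) ≃ₜ (A → J) × (∀ a, C a → J),
      ∀ q, (∀ a n, depth (q.2 (φ (a, n))) ≤ (1 / 4) ^ (n + 2)) →
        (K q).1 = fun _ => endpoint := by
  choose H hH using fun a => exists_homeomorph_to_face fun n => C (φ (a, n))
  let R := regroup (fun a => C a → J) φ
  refine ⟨(R.trans (Homeomorph.piCongrRight H)).trans R.symm, fun q hq => funext fun a => ?_⟩
  exact hH a (R q a) (hq a)

theorem Avoidable.exists_face_homeomorph (hτ : Cardinal.aleph0 < τ) (hA : Cardinal.mk A = τ)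
    (hZ : Avoidable τ Z) :
    ∃ (S : Type u) (_ : A ⊕ S ≃ A) (G : (A → J) ≃ₜ (A → J) × (S → J)),
      ∀ z ∈ Z, (G z).1 = fun _ => endpoint := by
  obtain ⟨C, ε, e, G, hε, hG⟩ := exists_block_homeomorph hτ hA hZ
  obtain ⟨φ⟩ : Nonempty (A × ℕ ≃ A) := Cardinal.eq.1 <| by
    rw [Cardinal.mk_prod, Cardinal.lift_uzero, hA, Cardinal.mk_nat, Cardinal.lift_aleph0,
      Cardinal.mul_eq_left hτ.le hτ.le Cardinal.aleph0_ne_zero]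
  obtain ⟨K, hK⟩ := exists_homeomorph_to_face_pi (fun a => C a) φ
  choose g hg using fun a => exists_expandHomeo (hε a)
    (show (0 : ℝ) < (1 / 4) ^ ((φ.symm a).2 + 2) by positivity)
  refine ⟨Σ a, C a, e, G.trans (((Homeomorph.refl _).prodCongr (Homeomorph.piCongrRight fun a =>
    Homeomorph.piCongrRight fun _ => g a)).trans (K.trans ((Homeomorph.refl _).prodCongr
      (homeomorphCurry fun a => C a).symm))), fun z hz => ?_⟩
  refine hK _ fun a n => ?_
  obtain ⟨i, hi⟩ := hG z hz (φ (a, n))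
  have h1 := hg _ _ hi
  rw [Equiv.symm_apply_apply] at h1
  have h2 := abs_le_one_sub_depth (fun i => g (φ (a, n)) ((G z).2 (φ (a, n)) i)) i
  change depth (fun i => g (φ (a, n)) ((G z).2 (φ (a, n)) i)) ≤ _
  linarith

/-- The product of two cubes. -/
abbrev Square (A : Type u) : Type u := (A → J) × (A → J)

theorem exists_double (h : Cardinal.aleph0 ≤ Cardinal.mk A) :
    ∃ D : (A → J) ≃ₜ Square A, D (fun _ => endpoint) = (fun _ => endpoint, fun _ => endpoint) := by
  obtain ⟨k⟩ : Nonempty (A ⊕ A ≃ A) := Cardinal.eq.1 <| by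
    rw [Cardinal.mk_sum, Cardinal.lift_id, Cardinal.add_eq_self h]
  exact ⟨(Homeomorph.piCongrLeft (Y := fun _ => J) k).symm.trans
    Homeomorph.sumArrowHomeomorphProdArrow, rfl⟩

theorem Avoidable.exists_product_homeomorph (hτ : Cardinal.aleph0 < τ) (hA : Cardinal.mk A = τ)
    (hZ : Avoidable τ Z) :
    ∃ Φ : (A → J) ≃ₜ Square A × Square A, ∀ z ∈ Z, (Φ z).1.2 = (fun _ => endpoint) ∧
      (Φ z).2 = (fun _ => endpoint, fun _ => endpoint) := by
  obtain ⟨S, e, G, hG⟩ := hZ.exists_face_homeomorph hτ hA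
  obtain ⟨D, hD⟩ := exists_double (hA ▸ hτ.le)
  let E : (A → J) × (S → J) ≃ₜ (A → J) :=
    Homeomorph.sumArrowHomeomorphProdArrow.symm.trans
      (Homeomorph.piCongrLeft (Y := fun _ => J) e)
  let M : (A → J) × (S → J) ≃ₜ Square A :=
    (D.prodCongr (Homeomorph.refl _)).trans <| (Homeomorph.prodAssoc _ _ _).trans <|
      ((Homeomorph.refl _).prodCongr (Homeomorph.prodComm _ _)).trans <|
        (Homeomorph.prodAssoc _ _ _).symm.trans <| E.prodCongr (Homeomorph.refl _)
  refine ⟨G.trans <| M.trans <| ((Homeomorph.refl _).prodCongr D).trans <|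
    ((Homeomorph.refl _).prodCongr ((Homeomorph.refl _).prodCongr D)).trans
      (Homeomorph.prodAssoc _ _ _).symm, fun z hz => ?_⟩
  have h1 : (M (G z)).2 = (D (G z).1).2 := rfl
  rw [hG z hz, hD] at h1
  change (D (M (G z)).2).1 = _ ∧ D (D (M (G z)).2).2 = _
  rw [h1, hD]
  exact ⟨rfl, hD⟩

end Face

section Centering

variable {C : Type*} [Fintype C]

theorem BoxMap.lift_snd (β : BoxMap) {q : J × (C → J)}
    (h : β.snd (1 - q.1) (depth q.2) = depth q.2) : (β.lift q).2 = q.2 := by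
  funext i
  apply Subtype.ext
  simp [lift, scale, h]

theorem pullSnd_zero {c w : ℝ} (hw : 0 ≤ w) : pullSnd c w 0 = 0 := by
  unfold pullSnd; grind

theorem pullFst_zero {c w : ℝ} (hw : 0 ≤ w) : pullFst c w 0 = w + max 0 (c - w / 2) := by
  unfold pullFst; grind

theorem depth_endpoint : depth (fun _ : Unit => endpoint) = 0 := by
  simp [depth, endpoint]

theorem exists_centering_homeomorph :
    ∃ (E : J × J ≃ₜ J × J) (η : J → J), (∀ t, E (t, endpoint) = (η t, endpoint)) ∧
      ∀ t, |(η t : ℝ)| ≤ 3 / 4 := by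
  let P : J × (Unit → J) ≃ₜ J × (Unit → J) :=
    (slideHomeo Unit (1 / 4) (by norm_num) le_rfl).symm
  let β := BoxMap.pull (1 / 4) (by norm_num) le_rfl
  let U : J × (Unit → J) ≃ₜ J × J := (Homeomorph.refl _).prodCongr (Homeomorph.funUnique Unit J)
  have hsnd : ∀ t : J, (P (t, fun _ => endpoint)).2 = fun _ => endpoint := fun t =>
    β.lift_snd (q := (t, fun _ => endpoint)) <| by
      rw [depth_endpoint]; exact pullSnd_zero (one_sub_mem t).1
  have hfst : ∀ t : J, 1 - ((P (t, fun _ => endpoint)).1 : ℝ) = pullFst (1 / 4) (1 - t) 0 :=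
    fun t => (β.one_sub_lift_fst (t, fun _ => endpoint)).trans <| by rw [depth_endpoint]; rfl
  let η : J → J := fun t =>
    flipHomeo (P (flipHomeo (P (t, fun _ => endpoint)).1, fun _ => endpoint)).1
  refine ⟨U.symm.trans ((P.trans (flippedSlide Unit)).trans U), η, fun t => ?_, fun t => ?_⟩
  · have h1 : P (t, fun _ => endpoint) = ((P (t, fun _ => endpoint)).1, fun _ => endpoint) :=
      Prod.ext rfl (hsnd t)
    have h2 : flippedSlide Unit (P (t, fun _ => endpoint)) = (η t, fun _ => endpoint) := by
      rw [h1]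
      exact Prod.ext rfl (hsnd _)
    exact congrArg U h2
  · have h1 := hfst t
    have h2 := hfst (flipHomeo (P (t, fun _ => endpoint)).1)
    change |-((P (flipHomeo (P (t, fun _ => endpoint)).1, fun _ => endpoint)).1 : ℝ)| ≤ 3 / 4
    rw [pullFst_zero (one_sub_mem _).1] at h1 h2
    change _ = 1 - -((P (t, fun _ => endpoint)).1 : ℝ) +
      max 0 (1 / 4 - (1 - -((P (t, fun _ => endpoint)).1 : ℝ)) / 2) at h2
    generalize ((P (flipHomeo (P (t, fun _ => endpoint)).1, fun _ => endpoint)).1 : ℝ) = x at *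
    generalize ((P (t, fun _ => endpoint)).1 : ℝ) = y at *
    have h4 := t.2
    rw [mem_Icc] at h4
    rw [abs_le]
    rcases max_cases 0 (1 / 4 - (1 - (t : ℝ)) / 2) with h | h <;>
      rcases max_cases 0 (1 / 4 - (1 - -y) / 2) with h' | h' <;>
      constructor <;> linarith

end Centering

section Extension

variable {A T : Type*} [TopologicalSpace T] [CompactSpace T]

/-- The homeomorphism of the product of two cubes translating the coordinates of the second factor
by amounts depending on the first. -/
def shear (f : (A → J) → A → ℝ) (hf : Continuous f) (hf1 : ∀ x i, |f x i| < 1) :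
    (A → J) × (A → J) ≃ₜ (A → J) × (A → J) where
  toFun q := (q.1, fun i => mob (f q.1 i) (q.2 i))
  invFun q := (q.1, fun i => mob (-f q.1 i) (q.2 i))
  left_inv q := Prod.ext rfl (funext fun i => mob_neg_mob (hf1 _ i) _)
  right_inv q := Prod.ext rfl (funext fun i => mob_mob_neg (hf1 _ i) _)
  continuous_toFun := continuous_fst.prodMk <| continuous_pi fun i =>
    continuous_mob (by fun_prop) (fun q => hf1 q.1 i) (by fun_prop)
  continuous_invFun := continuous_fst.prodMk <| continuous_pi fun i =>
    continuous_mob (by fun_prop) (fun q => by rw [abs_neg]; exact hf1 q.1 i) (by fun_prop)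

theorem mob_mob_neg_self {x y : J} (hx : |(x : ℝ)| < 1) (hy : |(y : ℝ)| < 1) :
    mob y (mob (-x) x) = y := by
  apply Subtype.ext
  rw [coe_mob hy, coe_mob (by rwa [abs_neg])]
  simp

theorem exists_homeomorph_moving_second {α β : T → A → J} (hα : Continuous α)
    (hα' : Function.Injective α) (hβ : Continuous β) (hβ1 : ∀ t i, |(β t i : ℝ)| ≤ 3 / 4)
    {q : J} (hq : |(q : ℝ)| ≤ 3 / 4) :
    ∃ S : (A → J) × (A → J) ≃ₜ (A → J) × (A → J), ∀ t, S (α t, fun _ => q) = (α t, β t) := by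
  have he : IsClosedEmbedding α := hα.isClosedEmbedding hα'
  choose f hf hfβ using fun i => ContinuousMap.exists_extension_forall_mem_of_isClosedEmbedding
    (⟨fun t => (β t i : ℝ), by fun_prop⟩ : C(T, ℝ)) (t := Icc (-(3 / 4)) (3 / 4))
    (fun t => abs_le.1 (hβ1 t i)) ⟨0, by norm_num⟩ he
  refine ⟨(shear (fun _ _ => -q) continuous_const fun _ _ => by rw [abs_neg]; linarith).trans
    (shear (fun x i => f i x) (by fun_prop) fun x i => ?_), fun t => ?_⟩
  · exact (abs_le.2 (hf i x)).trans_lt (by norm_num)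
  · refine Prod.ext rfl (funext fun i => ?_)
    change mob (f i (α t)) (mob (-q) q) = β t i
    rw [show f i (α t) = β t i from congrFun (hfβ i) t]
    exact mob_mob_neg_self (by linarith) ((hβ1 t i).trans_lt (by norm_num))

theorem exists_homeomorph_exchanging {α β : T → A → J} (hα : Continuous α)
    (hα' : Function.Injective α) (hα1 : ∀ t i, |(α t i : ℝ)| ≤ 3 / 4) (hβ : Continuous β)
    (hβ' : Function.Injective β) (hβ1 : ∀ t i, |(β t i : ℝ)| ≤ 3 / 4)
    {q : J} (hq : |(q : ℝ)| ≤ 3 / 4) :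
    ∃ S : (A → J) × (A → J) ≃ₜ (A → J) × (A → J),
      ∀ t, S (α t, fun _ => q) = (β t, fun _ => q) := by
  obtain ⟨S, hS⟩ := exists_homeomorph_moving_second hα hα' hβ hβ1 hq
  obtain ⟨S', hS'⟩ := exists_homeomorph_moving_second hβ hβ' hα hα1 hq
  refine ⟨(S.trans (Homeomorph.prodComm _ _)).trans S'.symm, fun t => ?_⟩
  change S'.symm (S (α t, fun _ => q)).swap = _
  rw [hS, Homeomorph.symm_apply_eq, hS']
  rfl

end Extension

section Unknotting

variable {A : Type u} {τ : Cardinal.{u}}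

/-- A homeomorphism of the square acting on the product of two cubes. -/
def squareHomeo (E : J × J ≃ₜ J × J) : Square A ≃ₜ Square A where
  toFun q := (fun i => (E (q.1 i, q.2 i)).1, fun i => (E (q.1 i, q.2 i)).2)
  invFun q := (fun i => (E.symm (q.1 i, q.2 i)).1, fun i => (E.symm (q.1 i, q.2 i)).2)
  left_inv q := by simp
  right_inv q := by simp
  continuous_toFun := by fun_prop
  continuous_invFun := by fun_prop

theorem exists_centered_product_homeomorph (hτ : Cardinal.aleph0 < τ) (hA : Cardinal.mk A = τ) :
    ∃ q : J, |(q : ℝ)| ≤ 3 / 4 ∧ ∀ Z : Set (A → J), Avoidable τ Z →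
      ∃ Φ : (A → J) ≃ₜ Square A × Square A, ∀ z ∈ Z,
        (∀ i, |((Φ z).1.1 i : ℝ)| ≤ 3 / 4) ∧ (Φ z).1.2 = (fun _ => endpoint) ∧
          (Φ z).2 = (fun _ => q, fun _ => endpoint) := by
  obtain ⟨E, η, hE, hη⟩ := exists_centering_homeomorph
  refine ⟨η endpoint, hη _, fun Z hZ => ?_⟩
  obtain ⟨Φ, hΦ⟩ := hZ.exists_product_homeomorph hτ hA
  have hEA : ∀ p : Square A, p.2 = (fun _ => endpoint) →
      squareHomeo E p = (fun i => η (p.1 i), fun _ => endpoint) := by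
    rintro ⟨x, _⟩ rfl
    exact Prod.ext (funext fun i => congrArg Prod.fst (hE _))
      (funext fun i => congrArg Prod.snd (hE _))
  refine ⟨Φ.trans ((squareHomeo E).prodCongr (squareHomeo E)), fun z hz => ?_⟩
  obtain ⟨h1, h2⟩ := hΦ z hz
  have h3 := hEA _ h1
  have h4 := hEA (Φ z).2 (by rw [h2])
  refine ⟨fun i => ?_, congrArg Prod.snd h3, h4.trans (by rw [h2])⟩
  change |((squareHomeo E (Φ z).1).1 i : ℝ)| ≤ _
  rw [h3]
  exact hη _

theorem exists_homeomorph_of_avoidable (hτ : Cardinal.aleph0 < τ) (hA : Cardinal.mk A = τ)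
    {T : Type*} [TopologicalSpace T] [CompactSpace T] {α β : T → A → J} (hα : Continuous α)
    (hα' : Function.Injective α) (hβ : Continuous β) (hβ' : Function.Injective β)
    (hαZ : Avoidable τ (range α)) (hβZ : Avoidable τ (range β)) :
    ∃ H : (A → J) ≃ₜ (A → J), ∀ t, H (α t) = β t := by
  obtain ⟨q, hq, h⟩ := exists_centered_product_homeomorph hτ hA
  obtain ⟨Φ, hΦ⟩ := h _ hαZ
  obtain ⟨Ψ, hΨ⟩ := h _ hβZ
  rw [forall_mem_range] at hΦ hΨ
  have hΦt : ∀ t, Φ (α t) =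
      (((Φ (α t)).1.1, fun _ => endpoint), (fun _ => q, fun _ => endpoint)) := fun t =>
    Prod.ext (Prod.ext rfl (hΦ t).2.1) (hΦ t).2.2
  have hΨt : ∀ t, Ψ (β t) =
      (((Ψ (β t)).1.1, fun _ => endpoint), (fun _ => q, fun _ => endpoint)) := fun t =>
    Prod.ext (Prod.ext rfl (hΨ t).2.1) (hΨ t).2.2
  obtain ⟨S, hS⟩ := exists_homeomorph_exchanging
    (α := fun t => (Φ (α t)).1.1) (β := fun t => (Ψ (β t)).1.1) (by fun_prop)
    (fun s t hst => hα' (Φ.injective (by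
      rw [hΦt s, hΦt t, show (Φ (α s)).1.1 = (Φ (α t)).1.1 from hst])))
    (fun t => (hΦ t).1) (by fun_prop)
    (fun s t hst => hβ' (Ψ.injective (by
      rw [hΨt s, hΨt t, show (Ψ (β s)).1.1 = (Ψ (β t)).1.1 from hst])))
    (fun t => (hΨ t).1) hq
  let R : Square A × Square A ≃ₜ Square A × Square A := Homeomorph.prodProdProdComm _ _ _ _
  refine ⟨Φ.trans (R.trans ((S.prodCongr (Homeomorph.refl _)).trans (R.symm.trans Ψ.symm))),
    fun t => ?_⟩
  change Ψ.symm (R.symm (S.prodCongr (Homeomorph.refl _) (R (Φ (α t))))) = β t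
  rw [Homeomorph.symm_apply_eq, Homeomorph.symm_apply_eq, hΦt, hΨt]
  exact Prod.ext (hS t) rfl

end Unknotting

section ZTauSets

variable {A : Type u} {τ : Cardinal.{u}}

/-- The cover of the cube by the slabs of width `2 / (n + 1)` centred at the points with rational
`b`-th coordinate. -/
def slabCover (b : A) (n : ℕ) : Set (Set (A → unitInterval)) :=
  range fun q : ℚ => {x | |(x b : ℝ) - q| < 1 / ((n : ℝ) + 1)}

theorem isCFOCover_slabCover (b : A) (n : ℕ) : IsCFOCover (slabCover b n) := by
  have hn : (0 : ℝ) < 1 / ((n : ℝ) + 1) := by positivity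
  refine ⟨countable_range _, ?_, eq_univ_of_forall fun x => ?_⟩
  · rintro _ ⟨q, rfl⟩
    refine ⟨fun x => max 0 (1 / ((n : ℝ) + 1) - |(x b : ℝ) - q|), by fun_prop, ?_⟩
    ext x
    simp only [mem_ofPred_eq, mem_preimage, mem_compl_iff, mem_singleton_iff, max_eq_left_iff,
      not_le, sub_pos]
  · obtain ⟨q, h1, h2⟩ := exists_rat_btwn (lt_add_of_pos_right (x b : ℝ) hn)
    refine mem_sUnion.2 ⟨_, ⟨q, rfl⟩, ?_⟩
    rw [mem_ofPred_eq, abs_lt]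
    constructor <;> linarith

theorem eq_of_uClose_slabCover {f : (A → unitInterval) → A → unitInterval} {b : A}
    (h : ∀ n, UClose (slabCover b n) f id) (x : A → unitInterval) : f x b = x b := by
  by_contra hne
  have hpos : 0 < |(f x b : ℝ) - x b| := abs_pos.2 (sub_ne_zero.2 fun h => hne (Subtype.ext h))
  obtain ⟨n, hn⟩ := exists_nat_one_div_lt (half_pos hpos)
  obtain ⟨_, ⟨q, rfl⟩, h1, h2⟩ := h n x
  rw [mem_ofPred_eq] at h1 h2
  have h3 := abs_sub_le (f x b : ℝ) q (x b)
  rw [abs_sub_comm (q : ℝ)] at h3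
  simp only [id] at h2
  linarith

/-- The coordinatewise affine homeomorphism between the two models of the Tychonov cube. -/
def cubeHomeo (A : Type*) : (A → unitInterval) ≃ₜ (A → J) :=
  Homeomorph.piCongrRight fun _ => (iccHomeoI (-1) 1 (by norm_num)).symm

theorem avoidable_of_zTauSet (hτ : Cardinal.aleph0 < τ) {Z : Set (A → unitInterval)}
    (hZ : ZTauSet τ Z) : Avoidable τ (cubeHomeo A '' Z) := by
  refine ⟨(cubeHomeo A).isClosedMap _ hZ.1, fun B hB => ?_⟩
  obtain ⟨f, hf, hfc, φ, -, -, hφ0, hφ1⟩ := hZ.2 id continuous_id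
    (range fun k : B × ℕ => slabCover (k.1 : A) k.2)
    (Cardinal.mk_range_le.trans_lt (by
      rw [Cardinal.mk_prod, Cardinal.lift_uzero, Cardinal.mk_nat, Cardinal.lift_aleph0]
      exact Cardinal.mul_lt_of_lt hτ.le hB hτ))
    (by rintro _ ⟨k, rfl⟩; exact isCFOCover_slabCover _ _)
  refine ⟨fun x => cubeHomeo A (f ((cubeHomeo A).symm x)), by fun_prop, fun x b hb => ?_,
    fun x => ?_⟩
  · have h1 := eq_of_uClose_slabCover (b := b) (fun n => hfc _ ⟨(⟨b, hb⟩, n), rfl⟩)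
      ((cubeHomeo A).symm x)
    have h2 : ∀ y y' : A → unitInterval, y b = y' b → cubeHomeo A y b = cubeHomeo A y' b :=
      fun y y' h => congrArg (iccHomeoI (-1) 1 (by norm_num)).symm h
    exact (h2 _ _ h1).trans (congrFun ((cubeHomeo A).apply_symm_apply x) b)
  · rintro ⟨z, hz, h⟩
    have h1 := hφ1 z hz
    rw [(cubeHomeo A).injective h, hφ0 _ (mem_range_self _)] at h1
    exact zero_ne_one h1

end ZTauSets

end

end TychonovCube

/-- `Z_τ`-set unknotting in the Tychonov cube `I^τ` for `τ > ω`. -/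
theorem Z_tau_unknotting_Tychonov_cube
    (τ : Cardinal.{u}) (hτ : Cardinal.aleph0 < τ)
    (A : Type u) (hA : Cardinal.mk A = τ)
    (Z F : Set (A → unitInterval)) (hZ : ZTauSet τ Z) (hF : ZTauSet τ F)
    (h : ↥Z ≃ₜ ↥F) :
    ∃ H : (A → unitInterval) ≃ₜ (A → unitInterval),
      ∀ z : Z, H (z : A → unitInterval) = (h z : A → unitInterval) := by
  have hZc : CompactSpace Z := isCompact_iff_compactSpace.1 hZ.1.isCompact
  let V := TychonovCube.cubeHomeo A
  have hrZ : range (fun z : Z => V z) = V '' Z := by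
    rw [image_eq_range]
  have hrF : range (fun z : Z => V (h z)) = V '' F := by
    rw [image_eq_range]
    exact h.surjective.range_comp fun y : F => V y
  obtain ⟨H, hH⟩ := TychonovCube.exists_homeomorph_of_avoidable hτ hA
    (α := fun z : Z => V z) (β := fun z : Z => V (h z)) (by fun_prop)
    (V.injective.comp Subtype.val_injective) (by fun_prop)
    (V.injective.comp (Subtype.val_injective.comp h.injective))
    (hrZ ▸ TychonovCube.avoidable_of_zTauSet hτ hZ)
    (hrF ▸ TychonovCube.avoidable_of_zTauSet hτ hF)
  refine ⟨(V.trans H).trans V.symm, fun z => ?_⟩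
  exact V.symm_apply_eq.2 (hH z)
end

section
/- Let τ > ω be a cardinal. The following conditions are equivalent for a closed subset Z of the Tychonov cube I^τ: (i) Z is a Z_τ-set in I^τ; (ii) Z contains no nonempty G_κ-subset of I^τ for any cardinal κ < τ. -/
open Set Topology

universe u

/-- A `G_κ`-subset: an intersection of at most `κ` many open sets. -/
def IsGKappa {X : Type u} [TopologicalSpace X] (κ : Cardinal.{u}) (S : Set X) : Prop :=
  ∃ 𝒪 : Set (Set X), Cardinal.mk ↥𝒪 ≤ κ ∧ (∀ U ∈ 𝒪, IsOpen U) ∧ S = ⋂₀ 𝒪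

/-- A continuous real function on a Tychonov cube depends on countably many coordinates. -/
theorem exists_countable_agree_imp_eq {A : Type*} {φ : (A → unitInterval) → ℝ}
    (hφ : Continuous φ) :
    ∃ B : Set A, B.Countable ∧ ∀ x y, (∀ a ∈ B, x a = y a) → φ x = φ y := by
  have huc : UniformContinuous φ := CompactSpace.uniformContinuous_of_continuous hφ
  have key : ∀ n : ℕ, ∃ F : Set A, F.Finite ∧
      ∀ x y, (∀ a ∈ F, x a = y a) → dist (φ x) (φ y) < 1 / ((n : ℝ) + 1) := by
    intro n
    have hmem := huc (Metric.dist_mem_uniformity (Nat.one_div_pos_of_nat (α := ℝ) (n := n)))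
    rw [Filter.mem_map, Pi.uniformity] at hmem
    obtain ⟨⟨F, f⟩, ⟨hF, hf⟩, hsub⟩ := (Filter.HasBasis.iInf' fun a : A =>
      (uniformity unitInterval).basis_sets.comap
        (fun p : (A → unitInterval) × (A → unitInterval) => (p.1 a, p.2 a))).mem_iff.mp hmem
    refine ⟨F, hF, fun x y hxy => ?_⟩
    have : (x, y) ∈ ⋂ a ∈ F, (fun p : (A → unitInterval) × (A → unitInterval) =>
        (p.1 a, p.2 a)) ⁻¹' f a := by
      simp only [mem_iInter, mem_preimage]
      intro a ha
      rw [hxy a ha]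
      exact refl_mem_uniformity (hf a ha)
    exact hsub this
  choose F hF hFφ using key
  refine ⟨⋃ n, F n, countable_iUnion fun n => (hF n).countable, fun x y hxy => ?_⟩
  refine eq_of_forall_dist_le fun ε hε => ?_
  obtain ⟨n, hn⟩ := exists_nat_one_div_lt hε
  exact ((hFφ n x y fun a ha => hxy a (mem_iUnion.mpr ⟨n, ha⟩)).trans hn).le

/-- A countable functionally open cover of a Tychonov cube depends on countably many
coordinates. -/
theorem IsCFOCover.exists_countable_uClose {A : Type*} {𝒰 : Set (Set (A → unitInterval))}
    (h𝒰 : IsCFOCover 𝒰) :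
    ∃ B : Set A, B.Countable ∧ ∀ f g : (A → unitInterval) → (A → unitInterval),
      (∀ x, ∀ a ∈ B, f x a = g x a) → UClose 𝒰 f g := by
  obtain ⟨hcount, hfo, hcov⟩ := h𝒰
  have key : ∀ U ∈ 𝒰, ∃ B : Set A, B.Countable ∧
      ∀ x y : A → unitInterval, (∀ a ∈ B, x a = y a) → y ∈ U → x ∈ U := by
    intro U hU
    obtain ⟨φ, hφ, rfl⟩ := hfo U hU
    obtain ⟨B, hB, hBφ⟩ := exists_countable_agree_imp_eq hφ
    refine ⟨B, hB, fun x y hxy hy => ?_⟩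
    simpa only [mem_preimage, hBφ x y hxy] using hy
  choose! B hB hBU using key
  refine ⟨⋃ U ∈ 𝒰, B U, hcount.biUnion hB, fun f g hfg x => ?_⟩
  obtain ⟨U, hU, hx⟩ : g x ∈ ⋃₀ 𝒰 := hcov ▸ mem_univ _
  exact ⟨U, hU, hBU U hU _ _ (fun a ha => hfg x a (mem_biUnion hU ha)) hx, hx⟩

/-- Fewer than `τ > ω` countable sets have a union of cardinality less than `τ`. -/
theorem mk_iUnion_lt_of_countable {A ι : Type u} {τ : Cardinal.{u}} (hτ : Cardinal.aleph0 < τ)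
    (hι : Cardinal.mk ι < τ) (s : ι → Set A) (hs : ∀ i, (s i).Countable) :
    Cardinal.mk (⋃ i, s i : Set A) < τ := by
  refine (Cardinal.mk_iUnion_le_sum_mk.trans
    (Cardinal.sum_le_sum _ (fun _ => Cardinal.aleph0) fun i => (hs i).le_aleph0)).trans_lt ?_
  rw [Cardinal.sum_const']
  exact Cardinal.mul_lt_of_lt hτ.le hι hτ

/-- The points of a Tychonov cube agreeing with a given one on a set of fewer than `τ > ω`
coordinates form a `G_κ`-set for some `κ < τ`. -/
theorem exists_isGKappa_setOf_agree {A : Type u} {τ : Cardinal.{u}} (hτ : Cardinal.aleph0 < τ)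
    {C : Set A} (hC : Cardinal.mk C < τ) (p : A → unitInterval) :
    ∃ κ < τ, IsGKappa κ {z : A → unitInterval | ∀ a ∈ C, z a = p a} := by
  let V : C × ULift.{u} ℕ → Set (A → unitInterval) :=
    fun i => {z | dist (z i.1) (p i.1) < 1 / ((i.2.down : ℝ) + 1)}
  refine ⟨Cardinal.mk (C × ULift.{u} ℕ), ?_, range V, Cardinal.mk_range_le, ?_, ?_⟩
  · simpa using Cardinal.mul_lt_of_lt hτ.le hC hτ
  · rintro _ ⟨i, rfl⟩
    exact isOpen_lt (by fun_prop) continuous_const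
  · ext z
    simp only [mem_ofPred_eq, sInter_range, mem_iInter, V]
    refine ⟨fun h i => ?_, fun h a ha => ?_⟩
    · rw [h i.1 i.1.2, dist_self]
      positivity
    · refine eq_of_forall_dist_le fun ε hε => ?_
      obtain ⟨n, hn⟩ := exists_nat_one_div_lt hε
      exact ((h (⟨a, ha⟩, ⟨n⟩)).trans hn).le

open TopologicalSpace in
/-- If a closed set omits a point of every fibre over fewer than `τ` coordinates, then for
`B` with fewer than `τ` coordinates some constant section off `B` avoids that set. -/
theorem exists_piecewise_notMem {A : Type u} {τ : Cardinal.{u}} (hτ : Cardinal.aleph0 < τ)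
    {Z : Set (A → unitInterval)} (hZ : IsClosed Z)
    (hfib : ∀ C : Set A, Cardinal.mk C < τ → ∀ p : A → unitInterval,
      ∃ z ∉ Z, ∀ a ∈ C, z a = p a)
    {B : Set A} (hB : Cardinal.mk B < τ) [∀ a, Decidable (a ∈ B)] :
    ∃ p : A → unitInterval, ∀ x, B.piecewise x p ∉ Z := by
  classical
  let E := Finset (B × countableBasis unitInterval)
  let cyl : E → Set (A → unitInterval) := fun e => {w | ∀ i ∈ e, w i.1 ∈ (i.2 : Set unitInterval)}
  let good : Set (Set (E × Finset A × (A → unitInterval))) := {𝒮 |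
    (∀ s ∈ 𝒮, Disjoint (s.2.1 : Set A) B ∧
      ∀ w ∈ cyl s.1, (∀ a ∈ s.2.1, w a = s.2.2 a) → w ∉ Z) ∧
    ∀ s ∈ 𝒮, ∀ t ∈ 𝒮, (s.1 = t.1 → s = t) ∧
      ∀ a ∈ s.2.1, a ∈ t.2.1 → s.2.2 a = t.2.2 a}
  obtain ⟨𝒮, hmax⟩ : ∃ 𝒮, Maximal (· ∈ good) 𝒮 := by
    refine zorn_subset good fun c hc hchain => ⟨⋃₀ c, ⟨?_, ?_⟩, fun s => subset_sUnion_of_mem⟩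
    · rintro s ⟨𝒮, h𝒮, hs⟩
      exact (hc h𝒮).1 s hs
    · rintro s ⟨𝒮, h𝒮, hs⟩ t ⟨𝒯, h𝒯, ht⟩
      rcases hchain.total h𝒮 h𝒯 with h | h
      · exact (hc h𝒯).2 s (h hs) t ht
      · exact (hc h𝒮).2 s hs t (h ht)
  obtain ⟨h𝒮Z, h𝒮⟩ := hmax.prop
  have hcompat := fun s hs t ht => (h𝒮 s hs t ht).2
  have hE : Cardinal.mk E < τ := by
    have hprod : Cardinal.mk (B × countableBasis unitInterval) < τ := by
      have : Cardinal.lift.{u} (Cardinal.mk (countableBasis unitInterval)) < τ :=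
        (by simp [(countable_countableBasis unitInterval).le_aleph0] :
          Cardinal.lift.{u} (Cardinal.mk (countableBasis unitInterval)) ≤
            Cardinal.aleph0).trans_lt hτ
      simpa using Cardinal.mul_lt_of_lt hτ.le hB this
    rcases finite_or_infinite (B × countableBasis unitInterval) with h | h
    · exact (Cardinal.lt_aleph0_of_finite E).trans hτ
    · rwa [Cardinal.mk_finset_of_infinite]
  have h𝒮card : Cardinal.mk 𝒮 < τ :=
    (Cardinal.mk_le_of_injective (f := fun s : 𝒮 => s.1.1) fun s t hst =>
      Subtype.ext ((h𝒮 s s.2 t t.2).1 hst)).trans_lt hE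
  let C : Set A := ⋃ s : 𝒮, (s.1.2.1 : Set A)
  have hC : Cardinal.mk C < τ :=
    mk_iUnion_lt_of_countable hτ h𝒮card _ fun s => s.1.2.1.countable_toSet
  obtain ⟨p, hp⟩ : ∃ p : A → unitInterval, ∀ s ∈ 𝒮, ∀ a ∈ s.2.1, p a = s.2.2 a := by
    refine ⟨fun a => if h : ∃ s ∈ 𝒮, a ∈ s.2.1 then h.choose.2.2 a else 0, fun s hs a ha => ?_⟩
    have h : ∃ s ∈ 𝒮, a ∈ s.2.1 := ⟨s, hs, ha⟩
    simp only [dif_pos h]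
    exact hcompat _ h.choose_spec.1 s hs a h.choose_spec.2 ha
  have hcov : ∀ x, ∃ s ∈ 𝒮, x ∈ cyl s.1 := by
    intro x
    by_contra! hx
    have hBC : Cardinal.mk (B ∪ C : Set A) < τ :=
      (Cardinal.mk_union_le B C).trans_lt (Cardinal.add_lt_of_lt hτ.le hB hC)
    obtain ⟨z, hzZ, hz⟩ := hfib (B ∪ C) hBC (B.piecewise x p)
    have hzB : ∀ a ∈ B, z a = x a := fun a ha => by
      rw [hz a (Or.inl ha), piecewise_eq_of_mem _ _ _ ha]
    have hzC : ∀ s ∈ 𝒮, ∀ a ∈ s.2.1, z a = s.2.2 a := fun s hs a ha => by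
      rw [hz a (Or.inr (mem_iUnion.mpr ⟨⟨s, hs⟩, ha⟩)),
        piecewise_eq_of_notMem _ _ _ (disjoint_left.mp (h𝒮Z s hs).1 ha), hp s hs a ha]
    obtain ⟨F, u, hu, hFu⟩ := isOpen_pi_iff.mp hZ.isOpen_compl z hzZ
    have hV : ∀ a ∈ F, ∃ V : countableBasis unitInterval, z a ∈ V.1 ∧ V.1 ⊆ u a := by
      intro a ha
      obtain ⟨V, hV, h⟩ := (isBasis_countableBasis unitInterval).exists_subset_of_mem_open
        (hu a ha).2 (hu a ha).1
      exact ⟨⟨V, hV⟩, h⟩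
    have : Nonempty (countableBasis unitInterval) := by
      obtain ⟨V, hV, -⟩ := (isBasis_countableBasis unitInterval).exists_subset_of_mem_open
        (mem_univ 0) isOpen_univ
      exact ⟨⟨V, hV⟩⟩
    choose! V hzV hVu using hV
    let e : E := (F.subtype (· ∈ B)).image fun b => (b, V b)
    have hxe : x ∈ cyl e := by
      intro i hi
      obtain ⟨b, hb, rfl⟩ := Finset.mem_image.mp hi
      simpa only [← hzB b b.2] using hzV b (Finset.mem_subtype.mp hb)
    let s₀ : E × Finset A × (A → unitInterval) := (e, F.filter (· ∉ B), z)
    have hnew : insert s₀ 𝒮 ∈ good := by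
      refine ⟨?_, ?_⟩
      · rintro s (rfl | hs)
        · refine ⟨disjoint_left.mpr fun a ha => (Finset.mem_filter.mp ha).2,
            fun w hw hwz => hFu fun a ha => ?_⟩
          by_cases haB : a ∈ B
          · exact hVu a ha (hw (⟨a, haB⟩, V a)
              (Finset.mem_image.mpr ⟨⟨a, haB⟩, Finset.mem_subtype.mpr ha, rfl⟩))
          · rw [hwz a (Finset.mem_filter.mpr ⟨ha, haB⟩)]
            exact (hu a ha).2
        · exact h𝒮Z s hs
      · rintro s (rfl | hs) t (rfl | ht)
        · exact ⟨fun _ => rfl, fun _ _ _ => rfl⟩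
        · exact ⟨fun h => absurd (h ▸ hxe) (hx t ht), fun a _ ha => hzC t ht a ha⟩
        · exact ⟨fun h => absurd (h ▸ hxe) (hx s hs), fun a ha _ => (hzC s hs a ha).symm⟩
        · exact h𝒮 s hs t ht
    exact hx s₀ (hmax.le_of_ge hnew (subset_insert _ _) (mem_insert _ _)) hxe
  refine ⟨p, fun x => ?_⟩
  obtain ⟨s, hs, hxs⟩ := hcov x
  refine (h𝒮Z s hs).2 _ (fun i hi => ?_) fun a ha => ?_
  · rw [piecewise_eq_of_mem _ _ _ i.1.2]
    exact hxs i hi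
  · rw [piecewise_eq_of_notMem _ _ _ (disjoint_left.mp (h𝒮Z s hs).1 ha), hp s hs a ha]

theorem functionallySeparated_of_disjoint {X : Type*} [TopologicalSpace X] [NormalSpace X]
    {P Q : Set X} (hP : IsClosed P) (hQ : IsClosed Q) (hPQ : Disjoint P Q) :
    FunctionallySeparated P Q := by
  obtain ⟨φ, h0, h1, h⟩ := exists_continuous_zero_one_of_isClosed hP hQ hPQ
  exact ⟨φ, φ.continuous, h, fun x hx => h0 hx, fun x hx => h1 hx⟩

/-- A `Z_τ`-set in a completely regular space contains no nonempty `G_κ`-set with `κ < τ`. -/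
theorem ZTauSet.eq_empty_of_isGKappa {X : Type u} [TopologicalSpace X] [CompletelyRegularSpace X]
    {τ κ : Cardinal.{u}} {Z S : Set X} (hZ : ZTauSet τ Z) (hκ : κ < τ) (hSZ : S ⊆ Z)
    (hS : IsGKappa κ S) : S = ∅ := by
  obtain ⟨𝒪, hcard, hopen, rfl⟩ := hS
  by_contra hne
  obtain ⟨s, hs⟩ := nonempty_iff_ne_empty.mpr hne
  have key : ∀ U : 𝒪, ∃ 𝒰 : Set (Set X), IsCFOCover 𝒰 ∧ ∀ V ∈ 𝒰, s ∈ V → V ⊆ U := by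
    rintro ⟨U, hU⟩
    obtain ⟨φ, hφ, hφs, hφU⟩ := CompletelyRegularSpace.completely_regular s Uᶜ
      (hopen U hU).isClosed_compl (not_not.mpr (hs U hU))
    refine ⟨{(fun x => 1 - (φ x : ℝ)) ⁻¹' {0}ᶜ, (fun x => (φ x : ℝ)) ⁻¹' {0}ᶜ},
      ⟨(toFinite _).countable, ?_, ?_⟩, ?_⟩
    · rintro V (rfl | rfl)
      · exact ⟨_, by fun_prop, rfl⟩
      · exact ⟨_, by fun_prop, rfl⟩
    · refine eq_univ_of_forall fun x => ?_
      by_cases h : (φ x : ℝ) = 0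
      · exact ⟨_, Or.inl rfl, by simp [h]⟩
      · exact ⟨_, Or.inr rfl, h⟩
    · rintro V (rfl | rfl) hsV x hx
      · by_contra hxU
        exact hx (by simp [hφU hxU])
      · exact absurd (by simp [hφs]) hsV
  choose 𝒰 h𝒰 h𝒰U using key
  obtain ⟨f, -, hfg, φ, -, -, h0, h1⟩ := hZ.2 (fun _ => s) continuous_const (range 𝒰)
    ((Cardinal.mk_range_le.trans hcard).trans_lt hκ) (by rintro _ ⟨U, rfl⟩; exact h𝒰 U)
  have hfs : f s ∈ ⋂₀ 𝒪 := by
    intro U hU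
    obtain ⟨V, hV, hfV, hsV⟩ := hfg _ ⟨⟨U, hU⟩, rfl⟩ s
    exact h𝒰U ⟨U, hU⟩ V hV hsV hfV
  exact zero_ne_one ((h0 _ ⟨s, rfl⟩).symm.trans (h1 _ (hSZ hfs)))

/-- A closed subset of the Tychonov cube `I^τ` (`τ > ω`) is a `Z_τ`-set iff it contains
no nonempty `G_κ`-subset of `I^τ` for any `κ < τ`. -/
theorem Z_tau_set_iff_no_Gkappa_Tychonov_cube
    (τ : Cardinal.{u}) (hτ : Cardinal.aleph0 < τ)
    (A : Type u) (hA : Cardinal.mk A = τ)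
    (Z : Set (A → unitInterval)) (hZcl : IsClosed Z) :
    ZTauSet τ Z ↔
      ∀ κ : Cardinal.{u}, κ < τ →
        ∀ S : Set (A → unitInterval), S ⊆ Z → IsGKappa κ S → S = ∅ := by
  classical
  refine ⟨fun h κ hκ S => h.eq_empty_of_isGKappa hκ, fun h => ⟨hZcl, fun g hg 𝒞 h𝒞 hcov => ?_⟩⟩
  choose B hB hBclose using fun 𝒰 : 𝒞 => (hcov 𝒰 𝒰.2).exists_countable_uClose
  have hfib : ∀ C : Set A, Cardinal.mk C < τ → ∀ p : A → unitInterval,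
      ∃ z ∉ Z, ∀ a ∈ C, z a = p a := by
    intro C hC p
    by_contra! hcon
    obtain ⟨κ, hκ, hG⟩ := exists_isGKappa_setOf_agree hτ hC p
    have hempty := h κ hκ _ (fun z (hz : ∀ a ∈ C, z a = p a) => by_contra fun hzZ =>
      let ⟨a, ha, hne⟩ := hcon z hzZ; hne (hz a ha)) hG
    have hp : p ∈ {z : A → unitInterval | ∀ a ∈ C, z a = p a} := fun _ _ => rfl
    exact notMem_empty p (hempty ▸ hp)
  obtain ⟨p, hp⟩ := exists_piecewise_notMem hτ hZcl hfib (mk_iUnion_lt_of_countable hτ h𝒞 B hB)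
  have hf : Continuous fun x => (⋃ 𝒰, B 𝒰).piecewise (g x) p := by
    refine continuous_pi fun a => ?_
    by_cases ha : a ∈ ⋃ 𝒰, B 𝒰
    · simp only [piecewise_eq_of_mem _ _ _ ha]
      fun_prop
    · simp only [piecewise_eq_of_notMem _ _ _ ha]
      fun_prop
  refine ⟨_, hf, fun 𝒰 h𝒰 => hBclose ⟨𝒰, h𝒰⟩ _ _ fun x a ha =>
    piecewise_eq_of_mem _ _ _ (mem_iUnion.mpr ⟨⟨𝒰, h𝒰⟩, ha⟩), ?_⟩
  refine functionallySeparated_of_disjoint (isCompact_range hf).isClosed hZcl ?_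
  rw [disjoint_left]
  rintro _ ⟨x, rfl⟩
  exact hp (g x)
end
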